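/- Let n, r ∈ ℕ and let G be a finite abelian group with G ≅ C_n^r and Davenport constant D(G) ≥ 4. If r ≥ n − 1, n is a prime power, and G' is a finite abelian group such that the systems of sets of lengths satisfy 𝓛(G) = 𝓛(G'), then G and G' are isomorphic. -/

import Mathlib

/- Common definitions: zero-sum sequences over a finite abelian group,
   sets of lengths, the system of sets of lengths, the Davenport constant,
   sets of distances, elasticities, AAPs, Δ₁(G), ρ(G,d,k), ρ(G,d), ρ*(G,d),
   cross numbers, K(G₀), K(G,d), LCN-sets, Δ*(G). -/

open scoped Classical

section Defs

variable {G : Type*} [AddCommGroup G]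

/-- The support of a sequence (multiset) over `G`. -/
def suppSet (A : Multiset G) : Set G := {g | g ∈ A}

/-- `A` is a minimal zero-sum sequence (an atom of `𝓑(G₀)`) over `G₀ ⊆ G`:
a nontrivial zero-sum sequence with terms in `G₀` such that every proper
nontrivial subsequence has nonzero sum. -/
def IsMinZeroSum (G0 : Set G) (A : Multiset G) : Prop :=
  A ≠ 0 ∧ (∀ g ∈ A, g ∈ G0) ∧ A.sum = 0 ∧
    ∀ T : Multiset G, T ≤ A → T.sum = 0 → T = 0 ∨ T = A

/-- `B` is a zero-sum sequence over `G₀ ⊆ G` (an element of `𝓑(G₀)`). -/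
def IsZeroSumSeq (G0 : Set G) (B : Multiset G) : Prop :=
  (∀ g ∈ B, g ∈ G0) ∧ B.sum = 0

/-- The set of lengths `L(B)` of a zero-sum sequence `B` over `G₀`:
all `k` such that `B` is a product of `k` atoms of `𝓑(G₀)`.
(For the trivial sequence this is `{0}`.) -/
def lengthSet (G0 : Set G) (B : Multiset G) : Set ℕ :=
  {k | ∃ U : Fin k → Multiset G, (∀ i, IsMinZeroSum G0 (U i)) ∧ B = ∑ i, U i}

/-- The system of sets of lengths `𝓛(G₀)`. -/
def systemL (G0 : Set G) : Set (Set ℕ) :=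
  {L | ∃ B : Multiset G, IsZeroSumSeq G0 B ∧ L = lengthSet G0 B}

/-- The Davenport constant `D(G)`: the maximal length of a minimal zero-sum
sequence over `G`. -/
noncomputable def davenport (G : Type*) [AddCommGroup G] : ℕ :=
  sSup {m | ∃ A : Multiset G, IsMinZeroSum (Set.univ : Set G) A ∧ Multiset.card A = m}

/-- The set of successive distances `Δ(L)` of a set `L ⊆ ℕ`. -/
def deltaOf (L : Set ℕ) : Set ℕ :=
  {d | 0 < d ∧ ∃ a, a ∈ L ∧ a + d ∈ L ∧ ∀ c ∈ L, ¬(a < c ∧ c < a + d)}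

/-- `Δ(G₀) = ⋃_{L ∈ 𝓛(G₀)} Δ(L)`. -/
def deltaG0 (G0 : Set G) : Set ℕ := ⋃ L ∈ systemL G0, deltaOf L

/-- `Δ*(G) = {min Δ(G₀) : G₀ ⊆ G with Δ(G₀) ≠ ∅}`. -/
def deltaStar (G : Type*) [AddCommGroup G] : Set ℕ :=
  {d | ∃ G0 : Set G, deltaG0 G0 ≠ ∅ ∧ d = sInf (deltaG0 G0)}

/-- The elasticity `ρ(L) = max L / min L` of a (finite) set `L ⊆ ℕ`,
with the convention `ρ({0}) = 1`. -/
noncomputable def rhoL (L : Set ℕ) : ℝ :=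
  if sInf L = 0 then 1 else ((sSup L : ℕ) : ℝ) / ((sInf L : ℕ) : ℝ)

/-- The elasticity `ρ(G₀) = sup {ρ(L) : L ∈ 𝓛(G₀)}`. -/
noncomputable def rhoG0 (G0 : Set G) : ℝ := sSup (rhoL '' systemL G0)

/-- `L` (a set of naturals) is an almost arithmetical progression (AAP)
with difference `d`, length `ℓ` and bound `M`:
`L = y + (L' ∪ {0, d, …, ℓd} ∪ L'') ⊆ y + dℤ` with `L' ⊆ [−M, −1]` and
`L'' ⊆ ℓd + [1, M]`. -/
def IsAAP (L : Set ℕ) (d ℓ M : ℕ) : Prop :=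
  ∃ (y : ℤ) (L1 L2 : Set ℤ),
    L1 ⊆ Set.Icc (-(M : ℤ)) (-1) ∧
    L2 ⊆ Set.Icc ((ℓ : ℤ) * d + 1) ((ℓ : ℤ) * d + M) ∧
    ((fun x : ℕ => (x : ℤ)) '' L) =
      (fun x => y + x) '' (L1 ∪ (fun i : ℤ => (d : ℤ) * i) '' Set.Icc (0 : ℤ) (ℓ : ℤ) ∪ L2) ∧
    (∀ x ∈ L, (d : ℤ) ∣ ((x : ℤ) - y))

/-- `Δ₁(G)`: the set of `d ∈ ℕ` such that for every `k` there is some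
`L ∈ 𝓛(G)` which is an AAP with difference `d` and length at least `k`. -/
def delta1 (G : Type*) [AddCommGroup G] : Set ℕ :=
  {d | 0 < d ∧ ∀ k : ℕ, ∃ L ∈ systemL (Set.univ : Set G), ∃ ℓ ≥ k, ∃ M : ℕ, IsAAP L d ℓ M}

/-- `ρ(G, d, k)`: the supremum of elasticities of sets of lengths of `G` which
are AAPs with difference `d` and length at least `k`. -/
noncomputable def rhoGdk (G : Type*) [AddCommGroup G] (d k : ℕ) : ℝ :=
  sSup (rhoL '' {L | L ∈ systemL (Set.univ : Set G) ∧ ∃ ℓ ≥ k, ∃ M : ℕ, IsAAP L d ℓ M})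

/-- `ρ(G, d)`: the limit of the decreasing sequence `(ρ(G, d, k))_k`,
i.e. its infimum. -/
noncomputable def rhoGd (G : Type*) [AddCommGroup G] (d : ℕ) : ℝ :=
  ⨅ k : ℕ, rhoGdk G d k

/-- `ρ*(G, d) = max {ρ(G₀) : G₀ ⊆ G non-half-factorial with d ∣ min Δ(G₀)}`. -/
noncomputable def rhoStar (G : Type*) [AddCommGroup G] (d : ℕ) : ℝ :=
  sSup {x | ∃ G0 : Set G, deltaG0 G0 ≠ ∅ ∧ d ∣ sInf (deltaG0 G0) ∧ x = rhoG0 G0}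

/-- The cross number `k(S) = Σ_{g ∈ S} 1/ord(g)` of a sequence `S`. -/
noncomputable def crossNum (S : Multiset G) : ℝ :=
  (S.map (fun g => (1 : ℝ) / (addOrderOf g))).sum

/-- `K(G₀) = max {k(A) : A ∈ 𝓐(G₀)}`, the cross number of `G₀`. -/
noncomputable def KG0 (G0 : Set G) : ℝ :=
  sSup {x | ∃ A : Multiset G, IsMinZeroSum G0 A ∧ x = crossNum A}

/-- `K(G, d) = max {K(G₀) : G₀ ⊆ G non-half-factorial with d ∣ min Δ(G₀)}`. -/
noncomputable def KGd (G : Type*) [AddCommGroup G] (d : ℕ) : ℝ :=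
  sSup {x | ∃ G0 : Set G, deltaG0 G0 ≠ ∅ ∧ d ∣ sInf (deltaG0 G0) ∧ x = KG0 G0}

/-- `G₀` is an LCN-set: `k(A) ≥ 1` for every atom `A` of `𝓑(G₀)`. -/
def IsLCN (G0 : Set G) : Prop :=
  ∀ A : Multiset G, IsMinZeroSum G0 A → 1 ≤ crossNum A

end Defs

set_option linter.unusedSectionVars false
set_option linter.style.haveILetI false

namespace LSys

section Basics

variable {G : Type*} [AddCommGroup G]

/-- minimal zero-sum sequences over the whole group -/
def Atom (A : Multiset G) : Prop :=
  A ≠ 0 ∧ A.sum = 0 ∧ ∀ T : Multiset G, T ≤ A → T.sum = 0 → T = 0 ∨ T = A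

/-- factorizations -/
def Fac (F : Multiset (Multiset G)) (B : Multiset G) : Prop :=
  (∀ A ∈ F, Atom A) ∧ F.sum = B

/-- sequences over a subset -/
def Over (S : Set G) (B : Multiset G) : Prop := ∀ g ∈ B, g ∈ S

/-- weights -/
def wt (w : G → ℚ) (B : Multiset G) : ℚ := (B.map w).sum

/-- cross number -/
noncomputable def kq (B : Multiset G) : ℚ := wt (fun g => 1 / (addOrderOf g : ℚ)) B

/-- the sequence `g^{ord g}` -/
noncomputable def rep (g : G) : Multiset G := Multiset.replicate (addOrderOf g) g

/-- all factorization lengths over `S` are congruent mod `d` -/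
def Cong (S : Set G) (d : ℕ) : Prop :=
  ∀ B : Multiset G, Over S B → ∀ F F', Fac F B → Fac F' B →
    (Multiset.card F : ℤ) ≡ Multiset.card F' [ZMOD d]

/-- large cross number sets -/
def LCN (S : Set G) : Prop := ∀ A : Multiset G, Over S A → Atom A → 1 ≤ kq A

lemma atom_iff {A : Multiset G} : IsMinZeroSum Set.univ A ↔ Atom A := by
  unfold IsMinZeroSum Atom; simp

lemma mem_lengthSet {B : Multiset G} {k : ℕ} :
    k ∈ lengthSet Set.univ B ↔ ∃ F, Fac F B ∧ Multiset.card F = k := by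
  constructor
  · rintro ⟨U, hU, hB⟩
    refine ⟨(Finset.univ : Finset (Fin k)).val.map U, ⟨?_, ?_⟩, by simp⟩
    · intro A hA
      obtain ⟨i, -, rfl⟩ := Multiset.mem_map.1 hA
      exact atom_iff.1 (hU i)
    · rw [hB]; rfl
  · rintro ⟨F, ⟨hF, hs⟩, rfl⟩
    induction F using Quotient.inductionOn with
    | h l =>
      refine ⟨fun i => l[i.1]'i.2, fun i => atom_iff.2 (hF _ (List.getElem_mem i.2)), ?_⟩
      rw [← hs]
      exact (Fin.sum_univ_getElem l).symm

lemma Atom.ne {A : Multiset G} (h : Atom A) : A ≠ 0 := h.1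
lemma Atom.sum {A : Multiset G} (h : Atom A) : A.sum = 0 := h.2.1
lemma Atom.min {A : Multiset G} (h : Atom A) {T : Multiset G} (hT : T ≤ A) (hs : T.sum = 0)
    (h0 : T ≠ 0) : T = A := (h.2.2 T hT hs).resolve_left h0

lemma Over.add {S : Set G} {A B : Multiset G} (hA : Over S A) (hB : Over S B) :
    Over S (A + B) := by
  intro g hg
  rcases Multiset.mem_add.1 hg with h | h
  · exact hA g h
  · exact hB g h

lemma Over.le {S : Set G} {A B : Multiset G} (hB : Over S B) (h : A ≤ B) : Over S A :=
  fun g hg => hB g (Multiset.mem_of_le h hg)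

lemma Over.mono {S T : Set G} {A : Multiset G} (hA : Over S A) (h : S ⊆ T) : Over T A :=
  fun g hg => h (hA g hg)

lemma Over.nsmul {S : Set G} {A : Multiset G} (hA : Over S A) (k : ℕ) : Over S (k • A) :=
  fun g hg => hA g (Multiset.mem_of_mem_nsmul hg)

lemma Over.zero {S : Set G} : Over S (0 : Multiset G) := fun g hg => by simp at hg

lemma Over.sum {S : Set G} {F : Multiset (Multiset G)} (h : ∀ A ∈ F, Over S A) : Over S F.sum := by
  induction F using Multiset.induction with
  | empty => simpa using Over.zero
  | cons a s ih =>
    rw [Multiset.sum_cons]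
    exact (h a (by simp)).add (ih fun A hA => h A (by simp [hA]))

lemma over_replicate {S : Set G} {g : G} (hg : g ∈ S) (n : ℕ) : Over S (Multiset.replicate n g) := by
  intro x hx; rw [Multiset.eq_of_mem_replicate hx]; exact hg

lemma over_rep {S : Set G} {g : G} (hg : g ∈ S) : Over S (rep g) := over_replicate hg _

lemma Cong.mono {S T : Set G} {d : ℕ} (h : Cong T d) (hST : S ⊆ T) : Cong S d :=
  fun B hB => h B (hB.mono hST)

lemma LCN.mono {S T : Set G} (h : LCN T) (hST : S ⊆ T) : LCN S :=
  fun A hA => h A (hA.mono hST)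

lemma le_sum_of_mem {F : Multiset (Multiset G)} {A : Multiset G} (h : A ∈ F) : A ≤ F.sum := by
  obtain ⟨t, rfl⟩ := Multiset.exists_cons_of_mem h
  simp

lemma Fac.atom {F : Multiset (Multiset G)} {B A : Multiset G} (h : Fac F B) (hA : A ∈ F) : Atom A :=
  h.1 A hA

lemma Fac.le {F : Multiset (Multiset G)} {B A : Multiset G} (h : Fac F B) (hA : A ∈ F) : A ≤ B :=
  h.2 ▸ le_sum_of_mem hA

lemma Fac.add {F F' : Multiset (Multiset G)} {B B' : Multiset G} (h : Fac F B) (h' : Fac F' B') :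
    Fac (F + F') (B + B') :=
  ⟨fun A hA => (Multiset.mem_add.1 hA).elim (h.1 A) (h'.1 A), by rw [Multiset.sum_add, h.2, h'.2]⟩

lemma Fac.sub {F F' : Multiset (Multiset G)} {B : Multiset G} (h : Fac F B) (h' : F' ≤ F) :
    Fac F' F'.sum := ⟨fun A hA => h.1 A (Multiset.mem_of_le h' hA), rfl⟩

lemma Fac.nil : Fac (0 : Multiset (Multiset G)) 0 := ⟨by simp, by simp⟩

lemma Fac.single {A : Multiset G} (h : Atom A) : Fac {A} A := ⟨by simpa using h, by simp⟩

lemma Fac.cons {F : Multiset (Multiset G)} {A B : Multiset G} (hA : Atom A) (h : Fac F B) :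
    Fac (A ::ₘ F) (A + B) := by
  have := (Fac.single hA).add h
  simpa using this

lemma Fac.nsmul {F : Multiset (Multiset G)} {B : Multiset G} (h : Fac F B) (k : ℕ) :
    Fac (k • F) (k • B) :=
  ⟨fun A hA => h.1 A (Multiset.mem_of_mem_nsmul hA), by rw [Multiset.sum_nsmul, h.2]⟩

lemma Fac.sum_eq {F : Multiset (Multiset G)} {B : Multiset G} (h : Fac F B) : B.sum = 0 := by
  obtain ⟨h1, rfl⟩ := h
  induction F using Multiset.induction with
  | empty => simp
  | cons a s ih =>
    rw [Multiset.sum_cons, Multiset.sum_add, (h1 a (by simp)).sum, ih fun A hA => h1 A (by simp [hA])]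
    simp

lemma Fac.over {F : Multiset (Multiset G)} {B : Multiset G} {S : Set G} (h : Fac F B)
    (hB : Over S B) {A : Multiset G} (hA : A ∈ F) : Over S A := hB.le (h.le hA)

lemma Atom.one_le {A : Multiset G} (h : Atom A) : 1 ≤ Multiset.card A :=
  Multiset.card_pos.2 h.ne

lemma card_msum (F : Multiset (Multiset G)) :
    Multiset.card F.sum = (F.map Multiset.card).sum := by
  induction F using Multiset.induction with
  | empty => simp
  | cons a s ih => simp [ih]

lemma Fac.card_le {F : Multiset (Multiset G)} {B : Multiset G} (h : Fac F B) :
    Multiset.card F ≤ Multiset.card B := by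
  obtain ⟨h1, rfl⟩ := h
  induction F using Multiset.induction with
  | empty => simp
  | cons a s ih =>
    have := (h1 a (by simp)).one_le
    have := ih fun A hA => h1 A (by simp [hA])
    simp only [Multiset.card_cons, Multiset.sum_cons, Multiset.card_add]; omega

lemma Fac.eq_zero {F : Multiset (Multiset G)} (h : Fac F 0) : F = 0 := by
  have := h.card_le
  simpa using this

lemma Fac.pos {F : Multiset (Multiset G)} {B : Multiset G} (h : Fac F B) (hB : B ≠ 0) :
    1 ≤ Multiset.card F := by
  rcases Nat.eq_zero_or_pos (Multiset.card F) with h0 | h0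
  · rw [Multiset.card_eq_zero] at h0
    subst h0
    exact absurd h.2.symm (by simpa using hB)
  · exact h0

lemma Fac.eq_of_atom {F : Multiset (Multiset G)} {A : Multiset G} (h : Fac F A) (hA : Atom A) :
    F = {A} := by
  have hp := h.pos hA.ne
  obtain ⟨U, hU⟩ := Multiset.card_pos_iff_exists_mem.1 hp
  have hUA : U = A := hA.min (h.le hU) (h.atom hU).sum (h.atom hU).ne
  subst hUA
  obtain ⟨t, rfl⟩ := Multiset.exists_cons_of_mem hU
  have h2 := h.2
  rw [Multiset.sum_cons] at h2
  have ht : t.sum = 0 := by simpa using h2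
  have : Fac t 0 := ⟨fun A hA => h.1 A (by simp [hA]), ht⟩
  rw [this.eq_zero]; rfl

lemma Fac.atom_of_card {F : Multiset (Multiset G)} {A : Multiset G} (h : Fac F A)
    (hc : Multiset.card F = 1) : Atom A := by
  obtain ⟨U, rfl⟩ := Multiset.card_eq_one.1 hc
  have := h.2
  simp at this
  subst this
  exact h.1 _ (by simp)

lemma exists_fac (B : Multiset G) (h : B.sum = 0) : ∃ F, Fac F B := by
  induction hn : Multiset.card B using Nat.strong_induction_on generalizing B with
  | _ n ih =>
    subst hn
    by_cases hB : B = 0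
    · exact ⟨0, hB ▸ Fac.nil⟩
    by_cases hA : Atom B
    · exact ⟨{B}, Fac.single hA⟩
    unfold Atom at hA
    push Not at hA
    obtain ⟨T, hT, hTs, hT0, hTB⟩ := hA hB h
    obtain ⟨R, rfl⟩ := Multiset.le_iff_exists_add.1 hT
    have hR0 : R ≠ 0 := by rintro rfl; simp at hTB
    have h1 := Multiset.card_pos.2 hT0
    have h2 := Multiset.card_pos.2 hR0
    have hRs : R.sum = 0 := by simpa [hTs] using h
    obtain ⟨F1, hF1⟩ := ih (Multiset.card T) (by simp; omega) T hTs rfl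
    obtain ⟨F2, hF2⟩ := ih (Multiset.card R) (by simp; omega) R hRs rfl
    exact ⟨F1 + F2, hF1.add hF2⟩

lemma Fac.exists_mem {F : Multiset (Multiset G)} {B : Multiset G} (h : Fac F B) {g : G}
    (hg : g ∈ B) : ∃ A ∈ F, g ∈ A := by
  obtain ⟨h1, rfl⟩ := h
  clear h1
  induction F using Multiset.induction with
  | empty => simp at hg
  | cons a s ih =>
    rw [Multiset.sum_cons, Multiset.mem_add] at hg
    rcases hg with hg | hg
    · exact ⟨a, by simp, hg⟩
    · obtain ⟨A, hA, hgA⟩ := ih hg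
      exact ⟨A, by simp [hA], hgA⟩

lemma exists_atom_mem {B : Multiset G} (h : B.sum = 0) {g : G} (hg : g ∈ B) :
    ∃ A, Atom A ∧ A ≤ B ∧ g ∈ A := by
  obtain ⟨F, hF⟩ := exists_fac B h
  obtain ⟨A, hA, hgA⟩ := hF.exists_mem hg
  exact ⟨A, hF.atom hA, hF.le hA, hgA⟩

/-- split off an atom `A ≤ B` -/
lemma exists_fac_of_le {A B : Multiset G} (hA : Atom A) (hAB : A ≤ B) (hB : B.sum = 0) :
    ∃ F, Fac (A ::ₘ F) B ∧ Fac F (B - A) := by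
  obtain ⟨R, rfl⟩ := Multiset.le_iff_exists_add.1 hAB
  have hR : R.sum = 0 := by simpa [hA.sum] using hB
  obtain ⟨F, hF⟩ := exists_fac R hR
  exact ⟨F, hF.cons hA, by simpa using hF⟩

/-- weights -/
lemma wt_add (w : G → ℚ) (A B : Multiset G) : wt w (A + B) = wt w A + wt w B := by simp [wt]
lemma wt_zero (w : G → ℚ) : wt w 0 = 0 := by simp [wt]
lemma wt_cons (w : G → ℚ) (g : G) (B : Multiset G) : wt w (g ::ₘ B) = w g + wt w B := by simp [wt]
lemma wt_nsmul (w : G → ℚ) (n : ℕ) (B : Multiset G) : wt w (n • B) = n * wt w B := by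
  simp [wt, Multiset.map_nsmul, Multiset.sum_nsmul]
lemma wt_replicate (w : G → ℚ) (n : ℕ) (g : G) : wt w (Multiset.replicate n g) = n * w g := by
  simp [wt]
lemma wt_sum (w : G → ℚ) (F : Multiset (Multiset G)) : wt w F.sum = (F.map (wt w)).sum := by
  induction F using Multiset.induction with
  | empty => simp [wt_zero]
  | cons a s ih => simp [wt_add, ih]
lemma wt_nonneg {w : G → ℚ} (h : ∀ g, 0 ≤ w g) (B : Multiset G) : 0 ≤ wt w B :=
  Multiset.sum_nonneg (by simp only [Multiset.mem_map]; rintro x ⟨a, -, rfl⟩; exact h a)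
lemma wt_le_of_le {w : G → ℚ} (h : ∀ g, 0 ≤ w g) {A B : Multiset G} (hAB : A ≤ B) :
    wt w A ≤ wt w B := by
  obtain ⟨R, rfl⟩ := Multiset.le_iff_exists_add.1 hAB
  rw [wt_add]; linarith [wt_nonneg h R]
lemma wt_congr {w w' : G → ℚ} {B : Multiset G} (h : ∀ g ∈ B, w g = w' g) : wt w B = wt w' B := by
  unfold wt; rw [Multiset.map_congr rfl h]

lemma wt_le_card {w : G → ℚ} {W : ℚ} {B : Multiset G} (h : ∀ g ∈ B, w g ≤ W) :
    wt w B ≤ Multiset.card B * W := by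
  have := Multiset.sum_le_card_nsmul (B.map w) W
    (by simp only [Multiset.mem_map]; rintro x ⟨a, ha, rfl⟩; exact h a ha)
  simpa [wt] using this

lemma card_le_wt {w : G → ℚ} {W : ℚ} {B : Multiset G} (h : ∀ g ∈ B, W ≤ w g) :
    Multiset.card B * W ≤ wt w B := by
  have := Multiset.card_nsmul_le_sum (s := B.map w) (a := W)
    (by simp only [Multiset.mem_map]; rintro x ⟨a, ha, rfl⟩; exact h a ha)
  simpa [wt] using this

lemma fac_wt_le {w : G → ℚ} {κ : ℚ} {F : Multiset (Multiset G)} {B : Multiset G} (hs : F.sum = B)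
    (h : ∀ A ∈ F, wt w A ≤ κ) : wt w B ≤ Multiset.card F * κ := by
  subst hs; rw [wt_sum]
  have := Multiset.sum_le_card_nsmul (F.map (wt w)) κ
    (by simp only [Multiset.mem_map]; rintro x ⟨a, ha, rfl⟩; exact h a ha)
  simpa using this

lemma fac_le_wt {w : G → ℚ} {κ : ℚ} {F : Multiset (Multiset G)} {B : Multiset G} (hs : F.sum = B)
    (h : ∀ A ∈ F, κ ≤ wt w A) : Multiset.card F * κ ≤ wt w B := by
  subst hs; rw [wt_sum]
  have := Multiset.card_nsmul_le_sum (s := F.map (wt w)) (a := κ)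
    (by simp only [Multiset.mem_map]; rintro x ⟨a, ha, rfl⟩; exact h a ha)
  simpa using this

lemma fac_wt_eq {w : G → ℚ} {κ : ℚ} {F : Multiset (Multiset G)} {B : Multiset G} (hs : F.sum = B)
    (h : ∀ A ∈ F, wt w A = κ) : wt w B = Multiset.card F * κ :=
  le_antisymm (fac_wt_le hs fun A hA => (h A hA).le) (fac_le_wt hs fun A hA => (h A hA).ge)

lemma wt_finset (w : G → ℚ) (B : Multiset G) : wt w B = ∑ g ∈ B.toFinset, B.count g * w g := by
  unfold wt
  rw [Finset.sum_multiset_map_count]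
  simp

end Basics

section FiniteBasics

variable {G : Type*} [AddCommGroup G]

lemma kq_add (A B : Multiset G) : kq (A + B) = kq A + kq B := wt_add _ _ _
lemma kq_zero : kq (0 : Multiset G) = 0 := wt_zero _
lemma kq_cons (g : G) (B : Multiset G) : kq (g ::ₘ B) = 1 / (addOrderOf g : ℚ) + kq B := wt_cons _ _ _
lemma kq_nsmul (n : ℕ) (B : Multiset G) : kq (n • B) = n * kq B := wt_nsmul _ _ _
lemma kq_nonneg (B : Multiset G) : 0 ≤ kq B := wt_nonneg (fun g => by positivity) B
lemma kq_replicate (n : ℕ) (g : G) : kq (Multiset.replicate n g) = n / (addOrderOf g : ℚ) := by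
  unfold kq; rw [wt_replicate]; ring

variable [Finite G]

lemma ord_pos (g : G) : 0 < addOrderOf g := addOrderOf_pos g

lemma kq_rep (g : G) : kq (rep g) = 1 := by
  unfold rep; rw [kq_replicate]
  have := ord_pos g
  field_simp

lemma kq_pos {B : Multiset G} (h : B ≠ 0) : 0 < kq B := by
  obtain ⟨g, hg⟩ := Multiset.exists_mem_of_ne_zero h
  obtain ⟨t, rfl⟩ := Multiset.exists_cons_of_mem hg
  rw [kq_cons]
  have := ord_pos g
  have := kq_nonneg t
  positivity

lemma rep_atom (g : G) : Atom (rep g) := by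
  have ho := ord_pos g
  refine ⟨?_, ?_, ?_⟩
  · unfold rep; rw [Ne, ← Multiset.card_eq_zero, Multiset.card_replicate]; omega
  · simp [rep, addOrderOf_nsmul_eq_zero]
  · intro T hT hs
    obtain ⟨k, hk, rfl⟩ := Multiset.le_replicate_iff.1 hT
    rw [Multiset.sum_replicate] at hs
    have := addOrderOf_dvd_iff_nsmul_eq_zero.2 hs
    rcases Nat.eq_zero_or_pos k with h0 | h0
    · left; simp [h0]
    · right; unfold rep; rw [le_antisymm hk (Nat.le_of_dvd h0 this)]

lemma Atom.eq_rep {A : Multiset G} (h : Atom A) {g : G} (hg : addOrderOf g ≤ A.count g) :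
    A = rep g := by
  have h1 : rep g ≤ A := Multiset.le_count_iff_replicate_le.1 hg
  exact (h.min h1 (rep_atom g).sum (rep_atom g).ne).symm

lemma Atom.count_le {A : Multiset G} (h : Atom A) (g : G) : A.count g ≤ addOrderOf g := by
  by_contra hc
  have := h.eq_rep (g := g) (by omega)
  rw [this] at hc
  simp [rep] at hc

lemma Atom.count_lt {A : Multiset G} (h : Atom A) {g : G} (hne : A ≠ rep g) :
    A.count g < addOrderOf g := by
  by_contra hc
  exact hne (h.eq_rep (by omega))

lemma Atom.card_le {A : Multiset G} (h : Atom A) : Multiset.card A ≤ Nat.card G := by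
  haveI := Fintype.ofFinite G
  induction A using Quotient.inductionOn with
  | h l =>
    change Atom (l : Multiset G) at h
    by_contra hc
    have hc' : Nat.card G < l.length := by simpa using hc
    have hninj : ¬ Function.Injective (fun i : Fin l.length => (l.take i).sum) := by
      intro hinj
      have := Fintype.card_le_of_injective _ hinj
      rw [Nat.card_eq_fintype_card] at hc'
      simp at this; omega
    rw [Function.Injective] at hninj
    push Not at hninj
    obtain ⟨a, b, hab, hne⟩ := hninj
    have key : ∀ i j : ℕ, i < j → j < l.length → (l.take i).sum = (l.take j).sum → False := by
      intro i j hij hj hs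
      have h1 : l.take j = l.take i ++ (l.take j).drop i := by
        conv_lhs => rw [← List.take_append_drop i (l.take j)]
        rw [List.take_take, min_eq_left hij.le]
      have h2 : ((l.take j).drop i).sum = 0 := by
        rw [h1, List.sum_append] at hs
        simpa using hs
      have h3 : (((l.take j).drop i : List G) : Multiset G) ≤ (l : Multiset G) :=
        (((List.drop_sublist _ _).trans (List.take_sublist _ _)).subperm)
      have hlen : ((l.take j).drop i).length = j - i := by simp; omega
      have h4 := h.min h3 (by simpa using h2) (by
        rw [Ne, ← Multiset.card_eq_zero, Multiset.coe_card, hlen]; omega)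
      have := congrArg Multiset.card h4
      rw [Multiset.coe_card, hlen, Multiset.coe_card] at this
      omega
    rcases lt_trichotomy (a : ℕ) b with hlt | heq | hgt
    · exact key a b hlt b.2 hab
    · exact hne (Fin.ext heq)
    · exact key b a hgt a.2 hab.symm

lemma dav_bdd : BddAbove {m | ∃ A : Multiset G, IsMinZeroSum (Set.univ : Set G) A ∧
    Multiset.card A = m} := by
  refine ⟨Nat.card G, ?_⟩
  rintro m ⟨A, hA, rfl⟩
  exact (atom_iff.1 hA).card_le

lemma le_dav {A : Multiset G} (h : Atom A) : Multiset.card A ≤ davenport G :=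
  le_csSup dav_bdd ⟨A, atom_iff.2 h, rfl⟩

lemma exists_dav (G : Type*) [AddCommGroup G] [Finite G] :
    ∃ A : Multiset G, Atom A ∧ Multiset.card A = davenport G := by
  have := Nat.sSup_mem (s := {m | ∃ A : Multiset G, IsMinZeroSum (Set.univ : Set G) A ∧
    Multiset.card A = m}) ⟨_, rep (0 : G), atom_iff.2 (rep_atom 0), rfl⟩ dav_bdd
  obtain ⟨A, hA, hc⟩ := this
  exact ⟨A, atom_iff.1 hA, hc⟩

lemma dav_pos (G : Type*) [AddCommGroup G] [Finite G] : 1 ≤ davenport G := by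
  obtain ⟨A, hA, h⟩ := exists_dav G
  rw [← h]; exact hA.one_le

lemma atom_neg {A : Multiset G} (h : Atom A) : Atom (A.map (fun g => -g)) := by
  have hinv : ∀ B : Multiset G, (B.map (fun g => -g)).map (fun g => -g) = B := by
    intro B; rw [Multiset.map_map]; simp
  have hs : ∀ B : Multiset G, (B.map (fun g => -g)).sum = - B.sum := by
    intro B; exact Multiset.sum_map_neg' B
  refine ⟨by simpa using h.ne, by rw [hs, h.sum, neg_zero], ?_⟩
  intro T hT hTs
  have h1 : T.map (fun g => -g) ≤ A := by
    have := Multiset.map_le_map hT (f := fun g : G => -g)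
    rwa [hinv] at this
  rcases h.2.2 _ h1 (by rw [hs, hTs, neg_zero]) with h2 | h2
  · left; simpa using h2
  · right; rw [← h2, hinv]

lemma atom_pair {g : G} (hg : g ≠ 0) : Atom ({g, -g} : Multiset G) := by
  refine ⟨by simp, by simp, ?_⟩
  intro T hT hs
  have hc := Multiset.card_le_card hT
  simp at hc
  interval_cases hcc : Multiset.card T
  · left; simpa using hcc
  · exfalso
    obtain ⟨a, rfl⟩ := Multiset.card_eq_one.1 hcc
    have : a ∈ ({g, -g} : Multiset G) := Multiset.mem_of_le hT (by simp)
    simp at this hs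
    rcases this with rfl | rfl
    · exact hg hs
    · exact hg (by simpa using hs)
  · right; exact Multiset.eq_of_le_of_card_le hT (by simp [hcc])

lemma atom_zero : Atom ({0} : Multiset G) := by
  have := rep_atom (0 : G)
  simpa [rep] using this

lemma atom_mem_zero {A : Multiset G} (h : Atom A) (h0 : (0:G) ∈ A) : A = {0} :=
  (h.min (Multiset.singleton_le.2 h0) (by simp) (by simp)).symm

lemma atom_card_one {A : Multiset G} (h : Atom A) (hc : Multiset.card A = 1) : A = {0} := by
  obtain ⟨a, rfl⟩ := Multiset.card_eq_one.1 hc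
  have := h.sum
  simp at this
  rw [this]

lemma atom_card_two {A : Multiset G} (h : Atom A) {g : G} (hg : g ∈ A) (hg' : -g ∈ A)
    (h2 : 2 ≤ A.count g ∨ g ≠ -g) (h0 : g ≠ 0) : A = {g, -g} := by
  refine (h.min ?_ (by simp) (by simp)).symm
  rw [Multiset.le_iff_count]
  intro a
  have e : ({g, -g} : Multiset G) = g ::ₘ (-g) ::ₘ 0 := rfl
  rw [e, Multiset.count_cons, Multiset.count_cons]
  have p1 := Multiset.count_pos.2 hg
  have p2 := Multiset.count_pos.2 hg'
  by_cases ha : a = g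
  · subst ha
    by_cases hb : a = -a
    · have : 2 ≤ A.count a := h2.resolve_right (by simpa using hb)
      simp [← hb]; omega
    · simp [hb]; omega
  · by_cases hb : a = -g
    · subst hb
      simp [ha]; omega
    · simp [ha, hb]

end FiniteBasics

end LSys

namespace LSys

section HFsec

variable {G : Type*} [AddCommGroup G]

/-- has a factorization into atoms of cross number one -/
def HF1 (B : Multiset G) : Prop := ∃ F, Fac F B ∧ ∀ A ∈ F, kq A = 1

lemma HF1.nil : HF1 (0 : Multiset G) := ⟨0, Fac.nil, by simp⟩

lemma HF1.add {A B : Multiset G} (hA : HF1 A) (hB : HF1 B) : HF1 (A + B) := by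
  obtain ⟨F, hF, h1⟩ := hA
  obtain ⟨F', hF', h1'⟩ := hB
  exact ⟨F + F', hF.add hF', fun X hX => (Multiset.mem_add.1 hX).elim (h1 X) (h1' X)⟩

lemma HF1.nsmul {A : Multiset G} (hA : HF1 A) (n : ℕ) : HF1 (n • A) := by
  induction n with
  | zero => simpa using HF1.nil
  | succ n ih => rw [succ_nsmul]; exact ih.add hA

lemma HF1.msum {M : Multiset (Multiset G)} (h : ∀ A ∈ M, HF1 A) : HF1 M.sum := by
  induction M using Multiset.induction with
  | empty => simpa using HF1.nil
  | cons a s ih =>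
    rw [Multiset.sum_cons]
    exact (h a (by simp)).add (ih fun A hA => h A (by simp [hA]))

lemma HF1.exists_card {B : Multiset G} (h : HF1 B) : ∃ F, Fac F B ∧ (Multiset.card F : ℚ) = kq B := by
  obtain ⟨F, hF, h1⟩ := h
  refine ⟨F, hF, ?_⟩
  have := fac_wt_eq hF.2 h1
  rw [show kq B = _ from this]; ring

lemma HF1.sum {B : Multiset G} (h : HF1 B) : B.sum = 0 := by
  obtain ⟨F, hF, -⟩ := h; exact hF.sum_eq

lemma HF1.of_atom {A : Multiset G} (h : HF1 A) (hA : Atom A) : kq A = 1 := by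
  obtain ⟨F, hF, h1⟩ := h
  have := hF.eq_of_atom hA
  subst this
  exact h1 A (by simp)

lemma hf1_of_atoms {S : Set G} (h : ∀ A, Over S A → Atom A → kq A = 1) {B : Multiset G}
    (hB : Over S B) (hs : B.sum = 0) : HF1 B := by
  obtain ⟨F, hF⟩ := exists_fac B hs
  exact ⟨F, hF, fun A hA => h A (hF.over hB hA) (hF.atom hA)⟩

lemma HF1.single {A : Multiset G} (hA : Atom A) (h : kq A = 1) : HF1 A :=
  ⟨{A}, Fac.single hA, by simpa using h⟩

lemma LCN.card_le {S : Set G} (h : LCN S) {B : Multiset G} (hB : Over S B)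
    {F : Multiset (Multiset G)} (hF : Fac F B) : (Multiset.card F : ℚ) ≤ kq B := by
  have := fac_le_wt (w := fun g => 1 / (addOrderOf g : ℚ)) hF.2
    (fun A hA => h A (hF.over hB hA) (hF.atom hA))
  simpa [kq] using this

lemma LCN.card_lt {S : Set G} (h : LCN S) {B : Multiset G} (hB : Over S B) (hn : ¬ HF1 B)
    {F : Multiset (Multiset G)} (hF : Fac F B) : (Multiset.card F : ℚ) < kq B := by
  have : ∃ A ∈ F, kq A ≠ 1 := by
    by_contra hc
    push Not at hc
    exact hn ⟨F, hF, hc⟩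
  obtain ⟨A, hA, hA1⟩ := this
  have h1 := lt_of_le_of_ne (h A (hF.over hB hA) (hF.atom hA)) (Ne.symm hA1)
  obtain ⟨F', rfl⟩ := Multiset.exists_cons_of_mem hA
  have hF' : Fac F' F'.sum := hF.sub (Multiset.le_cons_self _ _)
  have hsum := hF.2
  rw [Multiset.sum_cons] at hsum
  have := h.card_le (hB.le (hsum ▸ Multiset.le_add_left _ _)) hF'
  rw [← hsum, kq_add]
  push_cast [Multiset.card_cons]
  linarith

lemma LCN.hf1_of_kq {S : Set G} (h : LCN S) {B : Multiset G} (hB : Over S B)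
    {F : Multiset (Multiset G)} (hF : Fac F B) (hc : kq B ≤ Multiset.card F) : HF1 B := by
  by_contra hn
  have := h.card_lt hB hn hF
  linarith

lemma cover (F : Multiset (Multiset G)) : ∀ T : Multiset G, T ≤ F.sum →
    ∃ F1 ≤ F, Multiset.card F1 ≤ Multiset.card T ∧ T ≤ F1.sum := by
  induction F using Multiset.induction with
  | empty => intro T hT; exact ⟨0, le_rfl, by simp, hT⟩
  | cons a s ih =>
    intro T hT
    rw [Multiset.sum_cons] at hT
    by_cases hTa : T - a = T
    · obtain ⟨F1, h1, h2, h3⟩ := ih T (by rw [← hTa]; exact tsub_le_iff_left.2 hT)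
      exact ⟨F1, h1.trans (Multiset.le_cons_self _ _), h2, h3⟩
    · obtain ⟨F1, h1, h2, h3⟩ := ih (T - a) (tsub_le_iff_left.2 hT)
      have hlt : Multiset.card (T - a) < Multiset.card T :=
        Multiset.card_lt_card (lt_of_le_of_ne tsub_le_self hTa)
      refine ⟨a ::ₘ F1, (Multiset.cons_le_cons_iff _).2 h1, by simp; omega, ?_⟩
      rw [Multiset.sum_cons]
      exact tsub_le_iff_left.1 h3

variable [Finite G]

lemma HF1.rep (g : G) : HF1 (rep g) := HF1.single (rep_atom g) (kq_rep g)

lemma int_gap {d : ℕ} {a b : ℤ} (h : a ≡ b [ZMOD d]) (hlt : b < a) : b + d ≤ a := by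
  obtain ⟨k, hk⟩ := (Int.modEq_iff_dvd.1 h.symm)
  have hk0 : 0 < k := by
    by_contra hc
    have : (d:ℤ) * k ≤ 0 := mul_nonpos_of_nonneg_of_nonpos (by positivity) (by omega)
    omega
  nlinarith [(by positivity : (0:ℤ) ≤ d)]

section setup

/-- standing hypotheses for the half-factoriality arguments -/
structure Good (S : Set G) (d : ℕ) : Prop where
  cong : Cong S d
  lcn : LCN S
  pos : 1 ≤ d
  ord : ∀ g ∈ S, addOrderOf g ≤ d + 2
  kq_lt : ∀ A, Over S A → Atom A → kq A < d + 1

variable {S : Set G} {d : ℕ}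

lemma cor1 (hg : Good S d) {B : Multiset G} (hB : Over S B) {e : G} (he : e ∈ S) (h : HF1 (B + rep e)) : HF1 B := by
  obtain ⟨F, hF, h1⟩ := h
  obtain ⟨F1, hF1, hc1, hcov⟩ := cover F (rep e) (by rw [hF.2]; exact Multiset.le_add_left _ _)
  obtain ⟨F2, rfl⟩ := Multiset.le_iff_exists_add.1 hF1
  obtain ⟨Q, hQ⟩ := Multiset.le_iff_exists_add.1 hcov
  have hBe : B = Q + F2.sum := by
    have := hF.2
    rw [Multiset.sum_add, hQ, add_comm B, add_assoc] at this
    exact (add_left_cancel this).symm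
  have hF2 : HF1 F2.sum := ⟨F2, hF.sub (Multiset.le_add_left _ _), fun A hA => h1 A (by simp [hA])⟩
  suffices HF1 Q by rw [hBe]; exact this.add hF2
  by_contra hn
  have hQo : Over S Q := hB.le (hBe ▸ Multiset.le_add_right _ _)
  have hfF1 : Fac F1 F1.sum := hF.sub (Multiset.le_add_right _ _)
  have hk1 : kq F1.sum = Multiset.card F1 := by
    have := fac_wt_eq (w := fun g => 1 / (addOrderOf g : ℚ)) (κ := 1) (rfl : F1.sum = F1.sum)
      (fun A hA => h1 A (by simp [hA]))
    simpa [kq] using this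
  rw [hQ, kq_add, kq_rep] at hk1
  have hQs : Q.sum = 0 := by
    have := hfF1.sum_eq
    rw [hQ, Multiset.sum_add, (rep_atom e).sum, zero_add] at this
    exact this
  obtain ⟨FQ, hFQ⟩ := exists_fac Q hQs
  have hlt := hg.lcn.card_lt hQo hn hFQ
  have hco := hg.cong F1.sum (by rw [hQ]; exact (over_rep he).add hQo) F1 (rep e ::ₘ FQ) hfF1
    (by rw [hQ]; exact hFQ.cons (rep_atom e))
  have hQ0 : Q ≠ 0 := fun h0 => hn (h0 ▸ HF1.nil)
  have hp := hFQ.pos hQ0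
  have hlt' : Multiset.card FQ + 1 < Multiset.card F1 := by
    have : (Multiset.card FQ : ℚ) + 1 < Multiset.card F1 := by linarith
    exact_mod_cast this
  have hgap := int_gap hco (by simp; omega)
  have hcr : Multiset.card (rep e) ≤ d + 2 := by simpa [rep] using hg.ord e he
  simp at hgap
  have hFQ1 : Multiset.card FQ = 1 := by omega
  have hF1c : Multiset.card F1 = d + 2 := by omega
  have hAt := hFQ.atom_of_card hFQ1
  have := hg.kq_lt Q hQo hAt
  rw [hF1c] at hk1
  push_cast at hk1
  linarith

lemma cor1' (hg : Good S d) {B : Multiset G} (hB : Over S B) (E : Multiset G) (hE : Over S E)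
    (h : HF1 (B + (E.map rep).sum)) : HF1 B := by
  induction E using Multiset.induction with
  | empty => simpa using h
  | cons a s ih =>
    have hs : Over S s := hE.le (Multiset.le_cons_self _ _)
    refine ih hs ?_
    refine cor1 hg (B := B + (s.map rep).sum) ?_ (hE a (by simp)) ?_
    · refine hB.add (Over.sum ?_)
      intro A hA
      obtain ⟨g, hg, rfl⟩ := Multiset.mem_map.1 hA
      exact over_rep (hs g hg)
    · rw [Multiset.map_cons, Multiset.sum_cons] at h
      rwa [add_assoc, add_comm (s.map rep).sum]

lemma nsmul_card_eq (V : Multiset G) : ∃ E : Multiset G, (∀ g ∈ E, g ∈ V) ∧ Nat.card G • V = (E.map rep).sum := by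
  induction V using Multiset.induction with
  | empty => exact ⟨0, by simp, by simp⟩
  | cons a s ih =>
    obtain ⟨E, hE, h⟩ := ih
    obtain ⟨k, hk⟩ := addOrderOf_dvd_natCard a
    refine ⟨Multiset.replicate k a + E, ?_, ?_⟩
    · intro g hg
      rcases Multiset.mem_add.1 hg with h | h
      · rw [Multiset.eq_of_mem_replicate h]; simp
      · simp [hE g h]
    · rw [Multiset.map_add, Multiset.sum_add, ← h, Multiset.map_replicate, Multiset.sum_replicate]
      rw [← Multiset.singleton_add, nsmul_add]
      congr 1
      rw [hk, mul_comm, mul_nsmul', rep, Multiset.nsmul_singleton]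

lemma preserve (hg : Good S d) {B V : Multiset G} (hB : Over S B) (hV : Over S V) (h1 : HF1 V)
    (h : HF1 (B + V)) : HF1 B := by
  obtain ⟨E, hE, hEV⟩ := nsmul_card_eq V
  refine cor1' hg hB E (fun g hg => hV g (hE g hg)) ?_
  rw [← hEV]
  have hN : Nat.card G = (Nat.card G - 1) + 1 := by
    have : 0 < Nat.card G := Nat.card_pos
    omega
  rw [hN, succ_nsmul, add_left_comm]
  exact (h1.nsmul _).add h

lemma s2 (hg : Good S d) {C : Multiset G} (hs : C.sum = 0) (T : Finset G) (hT : ∀ g ∈ T, g ∈ S)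
    (hCT : C ≤ ∑ g ∈ T, rep g) (hn : ¬ HF1 C) {F : Multiset (Multiset G)} (hF : Fac F C) :
    d + 1 + Multiset.card F ≤ T.card := by
  obtain ⟨Q, hQ⟩ := Multiset.le_iff_exists_add.1 hCT
  have hR : HF1 (∑ g ∈ T, rep g) := HF1.msum (by
    intro A hA; obtain ⟨g, -, rfl⟩ := Multiset.mem_map.1 hA; exact HF1.rep g)
  have hRo : Over S (∑ g ∈ T, rep g) := Over.sum (by
    intro A hA; obtain ⟨g, hgT, rfl⟩ := Multiset.mem_map.1 hA; exact over_rep (hT g hgT))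
  have hkR : kq (∑ g ∈ T, rep g) = T.card := by
    have := fac_wt_eq (w := fun g => 1 / (addOrderOf g : ℚ)) (κ := 1) (B := ∑ g ∈ T, rep g)
      (F := T.val.map rep) rfl (by
        intro A hA; obtain ⟨g, -, rfl⟩ := Multiset.mem_map.1 hA; exact kq_rep g)
    simpa [kq] using this
  have hRF : Fac (T.val.map rep) (∑ g ∈ T, rep g) :=
    ⟨by intro A hA; obtain ⟨g, -, rfl⟩ := Multiset.mem_map.1 hA; exact rep_atom g, rfl⟩
  have hCo : Over S C := hRo.le hCT
  have hQo : Over S Q := hRo.le (hQ ▸ Multiset.le_add_left _ _)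
  have hnQ : ¬ HF1 Q := fun h => hn (preserve hg hCo hQo h (hQ ▸ hR))
  have hQs : Q.sum = 0 := by
    have := hR.sum
    rw [hQ, Multiset.sum_add, hs, zero_add] at this
    exact this
  obtain ⟨FQ, hFQ⟩ := exists_fac Q hQs
  have l1 := hg.lcn.card_lt hCo hn hF
  have l2 := hg.lcn.card_lt hQo hnQ hFQ
  have hp := hFQ.pos (fun h0 => hnQ (h0 ▸ HF1.nil))
  have hco := hg.cong _ hRo _ (F + FQ) hRF (by rw [hQ]; exact hF.add hFQ)
  rw [hQ, kq_add] at hkR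
  have hlt : Multiset.card F + Multiset.card FQ < T.card := by
    have : (Multiset.card F : ℚ) + Multiset.card FQ < T.card := by linarith
    exact_mod_cast this
  have := int_gap hco (by simp; omega)
  simp at this
  omega

lemma le_sum_rep {C : Multiset G} (T : Finset G) (hC : Over (T : Set G) C)
    (h : ∀ g ∈ T, C.count g ≤ addOrderOf g) : C ≤ ∑ g ∈ T, rep g := by
  rw [Multiset.le_iff_count]
  intro a
  rw [Multiset.count_sum']
  by_cases ha : a ∈ T
  · rw [Finset.sum_eq_single a]
    · simpa [rep] using h a ha
    · intro b _ hb
      simp [rep, Multiset.count_replicate, hb]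
    · exact fun h' => absurd ha h'
  · have : a ∉ C := fun h' => ha (by simpa using hC a h')
    rw [Multiset.count_eq_zero_of_notMem this]
    exact Nat.zero_le _

end setup

lemma atom_kq_lt {A : Multiset G} (hA : Atom A) (T : Finset G) (hT : Over (T : Set G) A) :
    (∃ g, A = rep g) ∨ kq A < T.card := by
  by_cases h : ∃ g, A = rep g
  · exact Or.inl h
  · right
    push Not at h
    unfold kq
    rw [wt_finset]
    have hsub : A.toFinset ⊆ T := by
      intro g hg; simpa using hT g (by simpa using hg)
    have hne : A.toFinset.Nonempty := by
      obtain ⟨g, hg⟩ := Multiset.exists_mem_of_ne_zero hA.ne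
      exact ⟨g, by simpa using hg⟩
    have : ∑ g ∈ A.toFinset, (A.count g : ℚ) * (1 / (addOrderOf g : ℚ)) < ∑ g ∈ A.toFinset, 1 := by
      apply Finset.sum_lt_sum_of_nonempty hne
      intro g _
      have h1 := hA.count_lt (h g)
      have h2 := ord_pos g
      have h3 : (0:ℚ) < addOrderOf g := by exact_mod_cast h2
      rw [mul_one_div, div_lt_one h3]
      exact_mod_cast h1
    refine this.trans_le ?_
    simp
    exact_mod_cast Finset.card_le_card hsub

lemma small_hf {d : ℕ} (hd : 1 ≤ d) (T : Finset G) (hTc : T.card ≤ d + 1)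
    (hC : Cong (T : Set G) d) (hL : LCN (T : Set G)) (hord : ∀ g ∈ T, addOrderOf g ≤ d + 2)
    {B : Multiset G} (hB : Over (T : Set G) B) (hs : B.sum = 0) : HF1 B := by
  have hk : ∀ A, Over (T : Set G) A → Atom A → kq A < d + 1 := by
    intro A hA hAt
    rcases atom_kq_lt hAt T hA with ⟨g, rfl⟩ | h
    · rw [kq_rep]
      have : (1:ℚ) ≤ d := by exact_mod_cast hd
      linarith
    · have : (T.card : ℚ) ≤ d + 1 := by exact_mod_cast hTc
      linarith
  refine hf1_of_atoms ?_ hB hs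
  intro A hA hAt
  by_contra hne
  have hn : ¬ HF1 A := fun h => hne (h.of_atom hAt)
  have := s2 (S := (T : Set G)) ⟨hC, hL, hd, by simpa using hord, hk⟩ hAt.sum T (by simp)
    (le_sum_rep T hA fun g _ => hAt.count_le g) hn (Fac.single hAt)
  simp at this
  omega

lemma closure_repr (E : Set G) {x : G} (hx : x ∈ AddSubgroup.closure E) :
    ∃ Y : Multiset G, Over E Y ∧ Y.sum = x := by
  induction hx using AddSubgroup.closure_induction with
  | mem x hx => exact ⟨{x}, by intro g hg; simp at hg; rwa [hg], by simp⟩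
  | zero => exact ⟨0, Over.zero, by simp⟩
  | add x y _ _ hx hy =>
    obtain ⟨Y, h1, h2⟩ := hx
    obtain ⟨Z, h3, h4⟩ := hy
    exact ⟨Y + Z, h1.add h3, by simp [h2, h4]⟩
  | neg x _ hx =>
    obtain ⟨Y, h1, h2⟩ := hx
    refine ⟨(addOrderOf x - 1) • Y, h1.nsmul _, ?_⟩
    rw [Multiset.sum_nsmul, h2]
    have := ord_pos x
    have h3 : (addOrderOf x - 1 + 1) • x = 0 := by
      rw [Nat.sub_add_cancel this]; exact addOrderOf_nsmul_eq_zero x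
    rw [succ_nsmul] at h3
    exact eq_neg_of_add_eq_zero_left h3

lemma lemmaM {S : Set G} {d : ℕ} (hC : Cong S d)
    (hsm : ∀ B : Multiset G, Over S B → B.sum = 0 → B.toFinset.card ≤ d + 1 → HF1 B)
    {A : Multiset G} (hA : Over S A) {F : Multiset (Multiset G)} (hF : Fac F A)
    (E : Finset G) (hE : ∀ g ∈ E, g ∈ S) (hEc : E.card ≤ d) (j : ℕ)
    (hj : ∀ t ∈ A, j • t ∈ AddSubgroup.closure (E : Set G)) :
    ∃ z : ℤ, (j : ℚ) * (kq A - Multiset.card F) = d * z := by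
  have hY : ∀ t, ∃ Y : Multiset G, t ∈ A → Over (E : Set G) Y ∧ Y.sum = - (j • t) := by
    intro t
    by_cases ht : t ∈ A
    · obtain ⟨Y, h1, h2⟩ := closure_repr (E : Set G) (neg_mem (hj t ht))
      exact ⟨Y, fun _ => ⟨h1, h2⟩⟩
    · exact ⟨0, fun h => absurd h ht⟩
  choose Y hY using hY
  have hES : Set.Subset (E : Set G) S := fun g hg => hE g (by simpa using hg)
  have hsum : (A.map (fun t => Multiset.replicate j t + Y t)).sum = j • A + (A.map Y).sum := by
    rw [Multiset.sum_map_add]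
    congr 1
    generalize A = A'
    induction A' using Multiset.induction with
    | empty => simp
    | cons a s ih =>
      rw [Multiset.map_cons, Multiset.sum_cons, ih, ← Multiset.singleton_add, nsmul_add,
        Multiset.nsmul_singleton]
  have hRo : Over (E : Set G) (A.map Y).sum := Over.sum (by
    intro B hB
    obtain ⟨t, ht, rfl⟩ := Multiset.mem_map.1 hB
    exact (hY t ht).1)
  have hAll : HF1 (A.map (fun t => Multiset.replicate j t + Y t)).sum := by
    apply HF1.msum
    intro B hB
    obtain ⟨t, ht, rfl⟩ := Multiset.mem_map.1 hB
    refine hsm _ ((over_replicate (hA t ht) j).add ((hY t ht).1.mono hES)) ?_ ?_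
    · simp [(hY t ht).2]
    · have : (Multiset.replicate j t + Y t).toFinset ⊆ insert t E := by
        intro x hx
        rw [Multiset.mem_toFinset, Multiset.mem_add] at hx
        rcases hx with hx | hx
        · rw [Multiset.eq_of_mem_replicate hx]; simp
        · have := (hY t ht).1 x hx
          simp at this
          simp [this]
      refine (Finset.card_le_card this).trans ((Finset.card_insert_le _ _).trans (by omega))
  have hRs : (A.map Y).sum.sum = 0 := by
    have := hAll.sum
    rw [hsum, Multiset.sum_add, Multiset.sum_nsmul, hF.sum_eq, smul_zero, zero_add] at this
    exact this
  have hR : HF1 (A.map Y).sum := by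
    refine hsm _ (hRo.mono hES) hRs ?_
    have : (A.map Y).sum.toFinset ⊆ E := by
      intro x hx
      rw [Multiset.mem_toFinset] at hx
      simpa using hRo x hx
    exact (Finset.card_le_card this).trans (by omega)
  rw [hsum] at hAll
  obtain ⟨F1, hF1, hc1⟩ := hAll.exists_card
  obtain ⟨F2, hF2, hc2⟩ := hR.exists_card
  have hco := hC _ ((hA.nsmul j).add (hRo.mono hES)) F1 (j • F + F2) hF1 ((hF.nsmul j).add hF2)
  obtain ⟨z, hz⟩ := Int.modEq_iff_dvd.1 hco.symm
  refine ⟨z, ?_⟩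
  rw [kq_add, kq_nsmul] at hc1
  have hz' : ((Multiset.card F1 : ℤ) : ℚ) - ((Multiset.card (j • F + F2) : ℕ) : ℤ) = d * z := by
    exact_mod_cast hz
  rw [← hz']
  push_cast [Multiset.card_add, Multiset.card_nsmul]
  rw [hc1, hc2]
  ring

end HFsec

end LSys

namespace LSys

section Fam

variable {G : Type*} [AddCommGroup G]

/-- arithmetic families of sets of lengths -/
def Family (G : Type*) [AddCommGroup G] (d x0 y0 : ℕ) : Prop :=
  ∀ j : ℕ, ∃ L ∈ systemL (Set.univ : Set G), j * x0 ∈ L ∧ j * y0 ∈ L ∧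
    ∀ l ∈ L, (l : ℤ) ≡ ((j * x0 : ℕ) : ℤ) [ZMOD d]

/-- `m`-independent `s`-tuples exist -/
def Indep (m s : ℕ) (G : Type*) [AddCommGroup G] : Prop :=
  ∃ y : Fin s → G, (∀ j, m • y j = 0) ∧ ∀ c : Fin s → ℤ, ∑ j, c j • y j = 0 → ∀ j, (m : ℤ) ∣ c j

lemma Family.transfer {G' : Type*} [AddCommGroup G'] {d x0 y0 : ℕ}
    (hL : systemL (Set.univ : Set G) = systemL (Set.univ : Set G')) (h : Family G d x0 y0) :
    Family G' d x0 y0 := by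
  intro j; obtain ⟨L, h1, h2⟩ := h j; exact ⟨L, hL ▸ h1, h2⟩

lemma cong_of_weight {S : Set G} {d : ℕ} (w : G → ℤ) (u : ℤ) (hu : u ≠ 0)
    (h : ∀ A, Over S A → Atom A → (A.map w).sum ≡ u [ZMOD u * d]) : Cong S d := by
  have key : ∀ B : Multiset G, Over S B → ∀ F, Fac F B →
      (B.map w).sum ≡ u * Multiset.card F [ZMOD u * d] := by
    rintro B hB F ⟨hF, rfl⟩
    induction F using Multiset.induction with
    | empty => simp
    | cons a s ih =>
      rw [Multiset.sum_cons, Multiset.map_add, Multiset.sum_add, Multiset.card_cons]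
      rw [Multiset.sum_cons] at hB
      have h1 := h a (hB.le (Multiset.le_add_right _ _)) (hF a (by simp))
      have h2 := ih (fun A hA => hF A (by simp [hA])) (hB.le (Multiset.le_add_left _ _))
      have := h1.add h2
      push_cast
      convert this using 1
      ring
  intro B hB F F' hF hF'
  exact Int.ModEq.mul_left_cancel' hu ((key B hB F hF).symm.trans (key B hB F' hF'))

lemma family_of_cong {S : Set G} {d x0 y0 : ℕ} (hC : Cong S d) {B : Multiset G} (hB : Over S B)
    {F F' : Multiset (Multiset G)} (hF : Fac F B) (hF' : Fac F' B) (hx : Multiset.card F = x0)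
    (hy : Multiset.card F' = y0) : Family G d x0 y0 := by
  intro j
  refine ⟨lengthSet Set.univ (j • B), ⟨j • B, ⟨by simp, ?_⟩, rfl⟩, ?_, ?_, ?_⟩
  · rw [Multiset.sum_nsmul, hF.sum_eq, smul_zero]
  · exact mem_lengthSet.2 ⟨j • F, hF.nsmul j, by simp [hx]⟩
  · exact mem_lengthSet.2 ⟨j • F', hF'.nsmul j, by simp [hy]⟩
  · intro l hl
    obtain ⟨F1, hF1, rfl⟩ := mem_lengthSet.1 hl
    have := hC _ (hB.nsmul j) F1 (j • F) hF1 (hF.nsmul j)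
    simpa [hx] using this

section ind

variable {m s : ℕ} {y : Fin s → G}

lemma ind_repr {e0 : G} {A : Multiset G} (hA : Over (insert e0 (Set.range y)) A) :
    ∃ (a : ℕ) (b : Fin s → ℕ), A = a • {e0} + ∑ i, b i • ({y i} : Multiset G) := by
  induction A using Multiset.induction with
  | empty => exact ⟨0, 0, by simp⟩
  | cons x A ih =>
    obtain ⟨a, b, h⟩ := ih (hA.le (Multiset.le_cons_self _ _))
    rcases hA x (by simp) with hx | ⟨i, hi⟩
    · refine ⟨a + 1, b, ?_⟩
      rw [h, hx, ← Multiset.singleton_add, add_nsmul, one_nsmul]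
      abel
    · refine ⟨a, b + Pi.single i 1, ?_⟩
      have : ∑ j, (b + (Pi.single i 1 : Fin s → ℕ)) j • ({y j} : Multiset G)
          = {x} + ∑ j, b j • ({y j} : Multiset G) := by
        simp only [Pi.add_apply, add_nsmul, Finset.sum_add_distrib]
        rw [add_comm]
        congr 1
        rw [Finset.sum_eq_single i]
        · simp [hi]
        · intro j _ hj; simp [hj]
        · simp
      rw [this, h, ← Multiset.singleton_add]
      abel

variable (hm : 2 ≤ m) (hs : 2 ≤ s) (h0 : ∀ j, m • y j = 0)
  (hi : ∀ c : Fin s → ℤ, ∑ j, c j • y j = 0 → ∀ j, (m : ℤ) ∣ c j)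

lemma sum_repr (a : ℕ) (b : Fin s → ℕ) :
    (a • {∑ i, y i} + ∑ i, b i • ({y i} : Multiset G)).sum = ∑ i, ((a + b i : ℕ) : ℤ) • y i := by
  have h1 : (∑ i, b i • ({y i} : Multiset G)).sum = ∑ i, b i • y i := by
    have := map_sum (Multiset.sumAddMonoidHom : Multiset G →+ G) (fun i => b i • ({y i} : Multiset G))
      Finset.univ
    simpa only [Multiset.coe_sumAddMonoidHom, Multiset.sum_nsmul, Multiset.sum_singleton] using this
  rw [Multiset.sum_add, Multiset.sum_nsmul, Multiset.sum_singleton, h1, Finset.smul_sum,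
    ← Finset.sum_add_distrib]
  refine Finset.sum_congr rfl fun i _ => ?_
  rw [natCast_zsmul, add_nsmul]

lemma ind_dvd (hi : ∀ c : Fin s → ℤ, ∑ j, c j • y j = 0 → ∀ j, (m : ℤ) ∣ c j)
    {a : ℕ} {b : Fin s → ℕ}
    (h : (a • {∑ i, y i} + ∑ i, b i • ({y i} : Multiset G)).sum = 0) (i : Fin s) : m ∣ a + b i := by
  rw [sum_repr] at h
  exact_mod_cast hi _ h i

lemma ind_atoms (hm : 2 ≤ m) (h0 : ∀ j, m • y j = 0)
    (hi : ∀ c : Fin s → ℤ, ∑ j, c j • y j = 0 → ∀ j, (m : ℤ) ∣ c j)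
    {A : Multiset G} (hA : Over (insert (∑ i, y i) (Set.range y)) A) (hAt : Atom A) :
    (∃ i, A = m • {y i}) ∨ A = m • {∑ i, y i} ∨
      ∃ a, 0 < a ∧ a < m ∧ A = a • {∑ i, y i} + ∑ i, (m - a) • ({y i} : Multiset G) := by
  obtain ⟨a, b, rfl⟩ := ind_repr hA
  have hd := ind_dvd hi hAt.sum
  rcases Nat.eq_zero_or_pos a with ha | ha
  · left
    subst ha
    have : ∃ i, b i ≠ 0 := by
      by_contra hc
      push Not at hc
      exact hAt.ne (by simp [hc])
    obtain ⟨i, hbi⟩ := this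
    refine ⟨i, (hAt.min ?_ ?_ ?_).symm⟩
    · rw [zero_smul, zero_add]
      have : b i • ({y i} : Multiset G) ≤ ∑ i, b i • ({y i} : Multiset G) :=
        Finset.single_le_sum (f := fun i => b i • ({y i} : Multiset G)) (fun j _ => zero_le) (Finset.mem_univ i)
      refine le_trans ?_ this
      have hle : m ≤ b i := Nat.le_of_dvd (by omega) (by simpa using hd i)
      exact nsmul_le_nsmul_left (zero_le) hle
    · rw [Multiset.sum_nsmul, Multiset.sum_singleton, h0]
    · intro h; have := congrArg Multiset.card h; simp at this; omega
  · right
    rcases le_or_gt m a with hma | hma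
    · left
      refine (hAt.min ?_ ?_ ?_).symm
      · exact (nsmul_le_nsmul_left (zero_le) hma).trans (Multiset.le_add_right _ _)
      · rw [Multiset.sum_nsmul, Multiset.sum_singleton, Finset.smul_sum]
        exact Finset.sum_eq_zero fun i _ => h0 i
      · intro h; have := congrArg Multiset.card h; simp at this; omega
    · right
      refine ⟨a, ha, hma, (hAt.min ?_ ?_ ?_).symm⟩
      · refine add_le_add_right (Finset.sum_le_sum fun i _ => ?_) _
        have : m ≤ a + b i := Nat.le_of_dvd (by omega) (hd i)
        exact nsmul_le_nsmul_left (zero_le) (by omega)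
      · rw [sum_repr (b := fun _ => m - a)]
        refine Finset.sum_eq_zero fun i _ => ?_
        rw [natCast_zsmul, show a + (m - a) = m by omega, h0]
      · intro h; have := congrArg Multiset.card h; simp at this; omega

lemma ind_ne (hm : 2 ≤ m) (hs : 2 ≤ s)
    (hi : ∀ c : Fin s → ℤ, ∑ j, c j • y j = 0 → ∀ j, (m : ℤ) ∣ c j) (i : Fin s) :
    y i ≠ ∑ j, y j := by
  intro h
  haveI : Nontrivial (Fin s) := Fin.nontrivial_iff_two_le.2 hs
  obtain ⟨k, hk⟩ := exists_ne i
  have := hi (fun j => 1 - if j = i then 1 else 0) (by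
    simp only [sub_smul, Finset.sum_sub_distrib, ite_smul, zero_smul, one_smul]
    simp [← h]) k
  simp [hk] at this
  have := Int.le_of_dvd (by norm_num) this
  omega

lemma ind_inj (hm : 2 ≤ m)
    (hi : ∀ c : Fin s → ℤ, ∑ j, c j • y j = 0 → ∀ j, (m : ℤ) ∣ c j) : Function.Injective y := by
  intro i k h
  by_contra hne
  have := hi (fun j => (if j = i then 1 else 0) - if j = k then 1 else 0) (by
    simp only [sub_smul, Finset.sum_sub_distrib, ite_smul, zero_smul, one_smul]
    simp [h]) i
  simp [hne] at this
  have := Int.le_of_dvd (by norm_num) this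
  omega

lemma ind_W_atom (hm : 2 ≤ m) (hs : 2 ≤ s) (h0 : ∀ j, m • y j = 0)
    (hi : ∀ c : Fin s → ℤ, ∑ j, c j • y j = 0 → ∀ j, (m : ℤ) ∣ c j) :
    Atom ((1:ℕ) • {∑ i, y i} + ∑ i, (m - 1) • ({y i} : Multiset G)) := by
  set W := (1:ℕ) • {∑ i, y i} + ∑ i, (m - 1) • ({y i} : Multiset G) with hW
  have hne := ind_ne hm hs hi
  have hinj := ind_inj hm hi
  have hWs : W.sum = 0 := by
    rw [hW, sum_repr (b := fun _ => m - 1)]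
    refine Finset.sum_eq_zero fun i _ => ?_
    rw [natCast_zsmul, show 1 + (m - 1) = m by omega, h0]
  have hWo : Over (insert (∑ i, y i) (Set.range y)) W := by
    intro g hg
    rw [hW, Multiset.mem_add] at hg
    rcases hg with hg | hg
    · left; simpa using hg
    · right
      rw [Multiset.mem_sum] at hg
      obtain ⟨i, -, hg⟩ := hg
      have := Multiset.mem_of_mem_nsmul hg
      simp at this
      exact ⟨i, this.symm⟩
  have c0 : W.count (∑ i, y i) = 1 := by
    rw [hW, Multiset.count_add, Multiset.count_sum']
    simp only [one_smul, Multiset.count_nsmul, Multiset.count_singleton, if_true]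
    simp [fun i => (hne i).symm]
  have c1 : ∀ i, W.count (y i) = m - 1 := by
    intro i
    rw [hW, Multiset.count_add, Multiset.count_sum']
    simp only [one_smul, Multiset.count_nsmul, Multiset.count_singleton]
    simp [hne i, hinj.eq_iff]
  obtain ⟨A, hA, hAW, -⟩ := exists_atom_mem hWs (g := ∑ i, y i) (by simp [hW])
  rcases ind_atoms hm h0 hi (hWo.le hAW) hA with ⟨i, rfl⟩ | rfl | ⟨a, ha, ham, rfl⟩
  · have := Multiset.count_le_of_le (y i) hAW
    rw [c1, Multiset.count_nsmul] at this
    simp at this; omega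
  · have := Multiset.count_le_of_le (∑ i, y i) hAW
    rw [c0, Multiset.count_nsmul] at this
    simp at this; omega
  · have := Multiset.count_le_of_le (∑ i, y i) hAW
    rw [c0, Multiset.count_add, Multiset.count_nsmul] at this
    simp at this
    have : a = 1 := by omega
    subst this
    exact hA

lemma indep_dav [Finite G] (hm : 2 ≤ m) (hs : 2 ≤ s) (h : Indep m s G) :
    s * (m - 1) + 1 ≤ davenport G := by
  obtain ⟨y, h0, hi⟩ := h
  have := le_dav (ind_W_atom hm hs h0 hi)
  simp at this
  omega

lemma indep_atom (hm : 2 ≤ m) (h0 : ∀ j, m • y j = 0)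
    (hi : ∀ c : Fin s → ℤ, ∑ j, c j • y j = 0 → ∀ j, (m : ℤ) ∣ c j) {g : G} (hg : m • g = 0)
    (hgk : ∀ k : ℕ, k • g = 0 → m ∣ k) : Atom (m • {g} : Multiset G) := by
  have : addOrderOf g = m := Nat.dvd_antisymm (addOrderOf_dvd_of_nsmul_eq_zero hg)
    (hgk _ (addOrderOf_nsmul_eq_zero g))
  rw [Multiset.nsmul_singleton]
  refine ⟨?_, ?_, ?_⟩
  · rw [Ne, ← Multiset.card_eq_zero, Multiset.card_replicate]; omega
  · simp [hg]
  · intro T hT hs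
    obtain ⟨k, hk, rfl⟩ := Multiset.le_replicate_iff.1 hT
    rw [Multiset.sum_replicate] at hs
    rcases Nat.eq_zero_or_pos k with h0 | h0
    · left; simp [h0]
    · right; rw [le_antisymm hk (Nat.le_of_dvd h0 (hgk k hs))]

lemma fam_indep (hm : 2 ≤ m) (hs : 2 ≤ s) (h : Indep m s G) :
    Family G (s - 1) m (1 + s * (m - 1)) := by
  obtain ⟨y, h0, hi⟩ := h
  have hne := ind_ne hm hs hi
  set e := ∑ i, y i with he
  have hC : Cong (insert e (Set.range y)) (s - 1) := by
    refine cong_of_weight (fun g => if g = e then (s:ℤ) else 1) m (by omega) ?_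
    intro A hA hAt
    have hsm : ((s - 1 : ℕ) : ℤ) = s - 1 := by omega
    have hsum : ∀ k : ℕ, ((∑ i, k • ({y i} : Multiset G)).map
        (fun g => if g = e then (s:ℤ) else 1)).sum = s * k := by
      intro k
      rw [Multiset.map_congr (g := fun _ => (1:ℤ)) rfl]
      · simp
      · intro x hx
        rw [Multiset.mem_sum] at hx
        obtain ⟨i, -, hx⟩ := hx
        have := Multiset.mem_of_mem_nsmul hx
        simp at this
        rw [this, if_neg (hne i)]
    rcases ind_atoms hm h0 hi hA hAt with ⟨i, rfl⟩ | rfl | ⟨a, ha, ham, rfl⟩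
    · simp [Multiset.map_nsmul, Multiset.sum_nsmul, hne i]
    · rw [hsm]
      simp [Multiset.map_nsmul, Multiset.sum_nsmul, ← he]
      rw [Int.modEq_iff_dvd]
      exact ⟨-1, by ring⟩
    · rw [Multiset.map_add, Multiset.sum_add, hsum, hsm, Int.modEq_iff_dvd]
      have : ((m - a : ℕ) : ℤ) = m - a := by omega
      simp [Multiset.map_nsmul, Multiset.sum_nsmul, this, ← he]
      exact ⟨-1, by ring⟩
  have hW := ind_W_atom hm hs h0 hi
  rw [← he] at hW
  have hWo : Over (insert e (Set.range y)) ((1:ℕ) • {e} + ∑ i, (m - 1) • ({y i} : Multiset G)) := by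
    intro g hg
    rw [Multiset.mem_add] at hg
    rcases hg with hg | hg
    · left; simpa using hg
    · right
      rw [Multiset.mem_sum] at hg
      obtain ⟨i, -, hg⟩ := hg
      have := Multiset.mem_of_mem_nsmul hg
      simp at this
      exact ⟨i, this.symm⟩
  refine family_of_cong hC (hWo.nsmul m) ((Fac.single hW).nsmul m)
    (F' := {m • {e}} + ∑ i, (m - 1) • ({m • {y i}} : Multiset (Multiset G))) ⟨?_, ?_⟩ ?_ ?_
  · intro A hA
    have hs0 : 0 < s := by omega
    rw [Multiset.mem_add] at hA
    rcases hA with hA | hA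
    · simp at hA
      rw [hA]
      refine indep_atom hm h0 hi ?_ ?_
      · rw [he, Finset.smul_sum]; exact Finset.sum_eq_zero fun i _ => h0 i
      · intro k hk
        have := hi (fun _ => k) (by rw [← hk, he, Finset.smul_sum]; simp) ⟨0, hs0⟩
        exact_mod_cast this
    · rw [Multiset.mem_sum] at hA
      obtain ⟨i, -, hA⟩ := hA
      have := Multiset.mem_of_mem_nsmul hA
      simp at this
      rw [this]
      refine indep_atom hm h0 hi (h0 i) ?_
      intro k hk
      have := hi (fun j => if j = i then (k:ℤ) else 0) (by simp [ite_smul, hk]) i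
      simp at this
      exact_mod_cast this
  · have := map_sum (Multiset.sumAddMonoidHom : Multiset (Multiset G) →+ Multiset G)
      (fun i => (m - 1) • ({m • {y i}} : Multiset (Multiset G))) Finset.univ
    simp only [Multiset.coe_sumAddMonoidHom, Multiset.sum_nsmul, Multiset.sum_singleton] at this
    rw [Multiset.sum_add, this, Multiset.sum_singleton, nsmul_add, Finset.smul_sum, one_nsmul]
    congr 1
    exact Finset.sum_congr rfl fun i _ => smul_comm _ _ _
  · simp
  · simp [add_comm]

end ind

lemma atoms_pair [Finite G] {g : G} (hN : 3 ≤ addOrderOf g) {A : Multiset G}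
    (hA : Over {g, -g} A) (hAt : Atom A) : A = {g, -g} ∨ A = rep g ∨ A = rep (-g) := by
  have hg0 : g ≠ 0 := by rintro rfl; simp at hN
  have hgg : g ≠ -g := by
    intro h
    have : 2 • g = 0 := by rw [two_nsmul]; nth_rewrite 2 [h]; simp
    have := Nat.le_of_dvd (by norm_num) (addOrderOf_dvd_of_nsmul_eq_zero this)
    omega
  have hall : ∀ h : G, (∀ x ∈ A, x = h) → A = rep h := by
    intro h hh
    rw [Multiset.eq_replicate_card.2 hh] at hAt ⊢
    refine hAt.eq_rep ?_
    have := hAt.sum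
    rw [Multiset.sum_replicate] at this
    rw [Multiset.count_replicate_self]
    exact Nat.le_of_dvd (by have := hAt.one_le; simp at this ⊢; omega) (addOrderOf_dvd_of_nsmul_eq_zero this)
  by_cases h1 : g ∈ A
  · by_cases h2 : -g ∈ A
    · left; exact atom_card_two hAt h1 h2 (Or.inr hgg) hg0
    · right; left
      refine hall g fun x hx => ?_
      rcases hA x hx with h | h
      · exact h
      · exact absurd (h ▸ hx) h2
  · right; right
    refine hall (-g) fun x hx => ?_
    rcases hA x hx with h | h
    · exact absurd (h ▸ hx) h1
    · exact h

lemma fam_pair [Finite G] {g : G} (hN : 3 ≤ addOrderOf g) :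
    Family G (addOrderOf g - 2) 2 (addOrderOf g) := by
  have hg0 : g ≠ 0 := by rintro rfl; simp at hN
  have hgg : g ≠ -g := by
    intro h
    have : 2 • g = 0 := by rw [two_nsmul]; nth_rewrite 2 [h]; simp
    have := Nat.le_of_dvd (by norm_num) (addOrderOf_dvd_of_nsmul_eq_zero this)
    omega
  set N := addOrderOf g with hNd
  have hC : Cong {g, -g} (N - 2) := by
    refine cong_of_weight (fun x => if x = g then 1 else (N:ℤ) - 1) N (by omega) ?_
    have hsm : ((N - 2 : ℕ) : ℤ) = N - 2 := by omega
    intro A hA hAt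
    rcases atoms_pair hN hA hAt with rfl | rfl | rfl
    · have e : ({g, -g} : Multiset G) = g ::ₘ {-g} := rfl
      rw [e]
      simp [hgg.symm]
    · simp [rep, hNd]
    · simp [rep, hgg.symm, hsm, ← hNd]
      rw [Int.modEq_iff_dvd]
      exact ⟨-1, by ring⟩
  refine family_of_cong hC (B := rep g + rep (-g)) (F := {rep g} + {rep (-g)})
    (F' := N • {{g, -g}}) ((over_rep (by simp)).add (over_rep (by simp)))
    ((Fac.single (rep_atom g)).add (Fac.single (rep_atom (-g)))) ?_ (by simp) (by simp)
  have := (Fac.single (atom_pair hg0)).nsmul N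
  convert this using 1
  have e : ({g, -g} : Multiset G) = {g} + {-g} := rfl
  rw [e, nsmul_add]
  simp [rep, Multiset.nsmul_singleton, hNd]

/-- the extraction lemma -/
lemma extraction [Finite G] {d x0 y0 : ℕ} (h : Family G d x0 y0) :
    ∃ S : Set G, Cong S d ∧ ∀ (w : G → ℚ) (κ : ℚ), (∀ g, 0 ≤ w g) → 0 ≤ κ →
      (∀ A, Over S A → Atom A → 1 ≤ wt w A ∧ wt w A ≤ κ) → (y0 : ℚ) ≤ κ * x0 := by
  haveI := Fintype.ofFinite G
  have hB : ∀ M : ℕ, ∃ B : Multiset G, (∃ F, Fac F B ∧ Multiset.card F = M ^ 2 * x0) ∧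
      (∃ F, Fac F B ∧ Multiset.card F = M ^ 2 * y0) ∧
      ∀ F, Fac F B → (Multiset.card F : ℤ) ≡ ((M ^ 2 * x0 : ℕ) : ℤ) [ZMOD d] := by
    intro M
    obtain ⟨L, ⟨B, hB, rfl⟩, h1, h2, h3⟩ := h (M ^ 2)
    exact ⟨B, mem_lengthSet.1 h1, mem_lengthSet.1 h2, fun F hF => h3 _ (mem_lengthSet.2 ⟨F, hF, rfl⟩)⟩
  choose B hx hy hcong using hB
  obtain ⟨S, hS⟩ := Finite.exists_infinite_fiber (fun M : ℕ => {g : G | M ≤ (B M).count g})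
  have hS' : ∀ n : ℕ, ∃ M, n ≤ M ∧ {g : G | M ≤ (B M).count g} = S := by
    intro n
    obtain ⟨M, hM, hn⟩ := (Set.infinite_coe_iff.1 hS).exists_gt n
    exact ⟨M, hn.le, hM⟩
  refine ⟨S, ?_, ?_⟩
  · intro C hC F F' hF hF'
    obtain ⟨M, hM, hMS⟩ := hS' (Multiset.card C)
    have hle : C ≤ B M := by
      rw [Multiset.le_iff_count]
      intro g
      by_cases hg : g ∈ C
      · have := hC g hg
        rw [← hMS] at this
        exact ((Multiset.count_le_card g C).trans hM).trans this
      · rw [Multiset.count_eq_zero_of_notMem hg]; exact Nat.zero_le _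
    obtain ⟨R, hR⟩ := Multiset.le_iff_exists_add.1 hle
    have hBs : (B M).sum = 0 := by obtain ⟨F, hF, -⟩ := hx M; exact hF.sum_eq
    have hRs : R.sum = 0 := by
      rw [hR, Multiset.sum_add, hF.sum_eq, zero_add] at hBs; exact hBs
    obtain ⟨FR, hFR⟩ := exists_fac R hRs
    have h1 := hcong M (F + FR) (by rw [hR]; exact hF.add hFR)
    have h2 := hcong M (F' + FR) (by rw [hR]; exact hF'.add hFR)
    have := h1.trans h2.symm
    push_cast [Multiset.card_add] at this
    exact Int.ModEq.add_right_cancel' _ this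
  · intro w κ hw hκ hA
    set n := Fintype.card G with hn
    obtain ⟨W, hW0, hW⟩ : ∃ W : ℚ, 0 ≤ W ∧ ∀ g, w g ≤ W :=
      ⟨∑ g, w g, Finset.sum_nonneg fun g _ => hw g,
        fun g => Finset.single_le_sum (f := w) (fun g _ => hw g) (Finset.mem_univ g)⟩
    have key : ∀ M, {g : G | M ≤ (B M).count g} = S →
        ((M:ℚ) ^ 2) * y0 ≤ κ * (M ^ 2 * x0) + M * n * (1 + n * W) := by
      intro M hMS
      obtain ⟨Fx, hFx, hcx⟩ := hx M
      obtain ⟨Fy, hFy, hcy⟩ := hy M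
      have hv : wt (fun g => if g ∈ S then (0:ℚ) else 1) (B M) ≤ M * n := by
        rw [wt_finset]
        have : ∑ g ∈ (B M).toFinset, ((B M).count g : ℚ) * (if g ∈ S then (0:ℚ) else 1)
            ≤ ∑ g ∈ (B M).toFinset, (M:ℚ) := by
          apply Finset.sum_le_sum
          intro g _
          by_cases hg : g ∈ S
          · simp [hg]
          · have : ¬ M ≤ (B M).count g := by
              intro hh
              exact hg (by rw [← hMS]; exact hh)
            simp [hg]
            omega
        refine this.trans ?_
        rw [Finset.sum_const, nsmul_eq_mul, mul_comm]
        have h2 : ((B M).toFinset.card : ℚ) ≤ n := by exact_mod_cast Finset.card_le_univ _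
        exact mul_le_mul_of_nonneg_left h2 (by positivity)
      have hbad : ∀ F, Fac F (B M) →
          (Multiset.card (F.filter (fun A => ¬ Over S A)) : ℚ) ≤ M * n := by
        intro F hF
        refine le_trans ?_ hv
        have h1 := fac_le_wt (w := fun g => if g ∈ S then (0:ℚ) else 1) (κ := 1)
          (F := F.filter (fun A => ¬ Over S A)) rfl (by
            intro A hAf
            have hAo := (Multiset.mem_filter.1 hAf).2
            unfold Over at hAo
            push Not at hAo
            obtain ⟨g, hg, hgS⟩ := hAo
            obtain ⟨t, rfl⟩ := Multiset.exists_cons_of_mem hg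
            rw [wt_cons, if_neg hgS]
            have := wt_nonneg (w := fun g => if g ∈ S then (0:ℚ) else 1)
              (fun g => by split_ifs <;> norm_num) t
            linarith)
        rw [mul_one] at h1
        refine h1.trans (wt_le_of_le (fun g => by split_ifs <;> norm_num) ?_)
        rw [← hF.2]
        conv_rhs => rw [← Multiset.filter_add_not (fun A => Over S A) F, Multiset.sum_add]
        exact Multiset.le_add_left _ _
      have hlow : (M:ℚ) ^ 2 * y0 - M * n ≤ wt w (B M) := by
        have hb := hbad Fy hFy
        have hsplit := Multiset.filter_add_not (fun A => Over S A) Fy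
        have h1 := fac_le_wt (w := w) (κ := 1) (F := Fy.filter (fun A => Over S A)) rfl (by
          intro A hAf
          obtain ⟨hAF, hAo⟩ := Multiset.mem_filter.1 hAf
          exact (hA A hAo (hFy.atom hAF)).1)
        have h2 : wt w (Fy.filter (fun A => Over S A)).sum ≤ wt w (B M) := by
          refine wt_le_of_le hw ?_
          rw [← hFy.2]
          conv_rhs => rw [← hsplit, Multiset.sum_add]
          exact Multiset.le_add_right _ _
        have h3 : (Multiset.card (Fy.filter (fun A => Over S A)) : ℚ)
            + Multiset.card (Fy.filter (fun A => ¬ Over S A)) = M ^ 2 * y0 := by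
          rw [← Nat.cast_add, ← Multiset.card_add, hsplit, hcy]; push_cast; ring
        linarith
      have hup : wt w (B M) ≤ κ * (M ^ 2 * x0) + M * n * (n * W) := by
        have hb := hbad Fx hFx
        have hsplit := Multiset.filter_add_not (fun A => Over S A) Fx
        have h1 := fac_wt_le (w := w) (κ := κ) (F := Fx.filter (fun A => Over S A)) rfl (by
          intro A hAf
          obtain ⟨hAF, hAo⟩ := Multiset.mem_filter.1 hAf
          exact (hA A hAo (hFx.atom hAF)).2)
        have h2 := fac_wt_le (w := w) (κ := n * W) (F := Fx.filter (fun A => ¬ Over S A)) rfl (by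
          intro A hAf
          obtain ⟨hAF, hAo⟩ := Multiset.mem_filter.1 hAf
          refine (wt_le_card fun g _ => hW g).trans ?_
          have : (Multiset.card A : ℚ) ≤ n := by
            have := (hFx.atom hAF).card_le
            rw [Nat.card_eq_fintype_card] at this
            exact_mod_cast this
          exact mul_le_mul_of_nonneg_right this hW0)
        have h3 : (Multiset.card (Fx.filter (fun A => Over S A)) : ℚ) ≤ M ^ 2 * x0 := by
          have : Multiset.card (Fx.filter (fun A => Over S A)) ≤ M ^ 2 * x0 := by
            rw [← hcx]; exact Multiset.card_le_card (Multiset.filter_le _ _)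
          exact_mod_cast this
        have h4 : wt w (B M) = wt w (Fx.filter (fun A => Over S A)).sum
            + wt w (Fx.filter (fun A => ¬ Over S A)).sum := by
          rw [← wt_add, ← Multiset.sum_add, hsplit, hFx.2]
        have h5 := mul_le_mul_of_nonneg_left h3 hκ
        have h6 := mul_le_mul_of_nonneg_right hb (show (0:ℚ) ≤ n * W by positivity)
        rw [h4]
        linarith
      linarith
    by_contra hc
    push Not at hc
    set δ : ℚ := y0 - κ * x0 with hδ
    have hδ0 : 0 < δ := by rw [hδ]; linarith
    set K : ℚ := n * (1 + n * W) with hK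
    obtain ⟨k, hk⟩ := exists_nat_gt (K / δ)
    obtain ⟨M, hM, hMS⟩ := hS' (k + 1)
    have h1 := key M hMS
    have hMk : (k:ℚ) + 1 ≤ M := by exact_mod_cast hM
    rw [div_lt_iff₀ hδ0] at hk
    have hM0 : (0:ℚ) < M := by
      have : (0:ℚ) ≤ k := by positivity
      linarith
    have h2 : (M:ℚ) * (M * δ) ≤ M * K := by
      rw [hδ, hK]; nlinarith
    have h3 := le_of_mul_le_mul_left h2 hM0
    nlinarith

lemma dav_le {G' : Type*} [AddCommGroup G'] [Finite G] [Finite G'] (h3 : 3 ≤ davenport G)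
    (hL : systemL (Set.univ : Set G) = systemL (Set.univ : Set G')) :
    davenport G ≤ davenport G' := by
  obtain ⟨A, hA, hc⟩ := exists_dav G
  set B := A + A.map (fun g => -g) with hB
  have hA' := atom_neg hA
  have h2 : 2 ∈ lengthSet Set.univ B :=
    mem_lengthSet.2 ⟨_, (Fac.single hA).add (Fac.single hA'), by simp⟩
  have hA0 : ∀ g ∈ A, g ≠ 0 := by
    rintro g hg rfl
    have := atom_mem_zero hA hg
    rw [this] at hc; simp at hc; omega
  have hD : davenport G ∈ lengthSet Set.univ B := by
    refine mem_lengthSet.2 ⟨A.map (fun g => {g, -g}), ⟨?_, ?_⟩, by simpa using hc⟩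
    · intro X hX
      obtain ⟨g, hg, rfl⟩ := Multiset.mem_map.1 hX
      exact atom_pair (hA0 g hg)
    · have : ∀ C : Multiset G, (C.map (fun g => ({g, -g} : Multiset G))).sum
          = C + C.map (fun g => -g) := by
        intro C
        induction C using Multiset.induction with
        | empty => simp
        | cons a s ih =>
          rw [Multiset.map_cons, Multiset.sum_cons, ih, Multiset.map_cons]
          have e : ({a, -a} : Multiset G) = {a} + {-a} := rfl
          rw [e, ← Multiset.singleton_add, ← Multiset.singleton_add (-a)]
          abel
      exact this A
  have hmem : lengthSet Set.univ B ∈ systemL (Set.univ : Set G) :=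
    ⟨B, ⟨by simp, by rw [hB, Multiset.sum_add, hA.sum, hA'.sum, add_zero]⟩, rfl⟩
  rw [hL] at hmem
  obtain ⟨B', -, hB'⟩ := hmem
  rw [hB'] at h2 hD
  obtain ⟨F2, hF2, hc2⟩ := mem_lengthSet.1 h2
  obtain ⟨FD, hFD, hcD⟩ := mem_lengthSet.1 hD
  obtain ⟨U, V, rfl⟩ := Multiset.card_eq_two.1 hc2
  have hUV : U + V = B' := by
    have := hF2.2
    have e : ({U, V} : Multiset (Multiset G')) = {U} + {V} := rfl
    rw [e] at this
    simpa using this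
  have hU : Atom U := hF2.atom (by simp)
  have hV : Atom V := hF2.atom (by simp)
  by_cases h0 : (0 : G') ∈ B'
  · exfalso
    have hex : ∃ Z : Multiset G', Atom Z ∧ B' = {0} + Z := by
      rw [← hUV, Multiset.mem_add] at h0
      rcases h0 with h0 | h0
      · exact ⟨V, hV, by rw [← hUV, ← atom_mem_zero hU h0]⟩
      · exact ⟨U, hU, by rw [← hUV, ← atom_mem_zero hV h0, add_comm]⟩
    obtain ⟨Z, hZ, hBZ⟩ := hex
    obtain ⟨X, hX, h0X⟩ := hFD.exists_mem h0
    have hX0 := atom_mem_zero (hFD.atom hX) h0X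
    obtain ⟨F', rfl⟩ := Multiset.exists_cons_of_mem hX
    have hs := hFD.2
    rw [Multiset.sum_cons, hX0, hBZ] at hs
    have hF' : Fac F' Z := ⟨fun A hA => hFD.1 A (by simp [hA]), add_left_cancel hs⟩
    have := hF'.eq_of_atom hZ
    rw [this] at hcD
    simp at hcD
    omega
  · have h1 : Multiset.card B' ≤ 2 * davenport G' := by
      rw [← hUV, Multiset.card_add]
      have := le_dav hU
      have := le_dav hV
      omega
    have h2 : 2 * davenport G ≤ Multiset.card B' := by
      rw [← hcD, ← hFD.2, card_msum]
      have := Multiset.card_nsmul_le_sum (s := FD.map Multiset.card) (a := 2) (by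
        intro x hx
        obtain ⟨X, hX, rfl⟩ := Multiset.mem_map.1 hx
        have hXA := hFD.atom hX
        have := hXA.one_le
        by_contra hlt
        have := atom_card_one hXA (by omega)
        exact h0 (Multiset.mem_of_le (hFD.le hX) (by simp [this])))
      simp at this
      omega
    omega

lemma dav_eq {G' : Type*} [AddCommGroup G'] [Finite G] [Finite G'] (h3 : 3 ≤ davenport G)
    (hL : systemL (Set.univ : Set G) = systemL (Set.univ : Set G')) :
    davenport G = davenport G' := by
  have h := dav_le h3 hL
  exact le_antisymm h (dav_le (h3.trans h) hL.symm)

end Fam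

end LSys

namespace LSys

section Olson

variable {G : Type*} [AddCommGroup G]

lemma ideal_sum_pow {R : Type*} [CommRing R] {ι : Type*} (I : ι → Ideal R) (q : ℕ) (hq : 1 ≤ q)
    (h : ∀ i, I i ^ q = 0) (s : Finset ι) : (∑ i ∈ s, I i) ^ (s.card * (q - 1) + 1) = 0 := by
  induction s using Finset.induction_on with
  | empty => simp
  | insert a s ha ih =>
    rw [Finset.sum_insert ha, Finset.card_insert_of_notMem ha]
    refine Commute.add_pow_eq_zero_of_add_le_succ_of_pow_eq_zero (Commute.all _ _) (h a) ih ?_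
    have : (s.card + 1) * (q - 1) = s.card * (q - 1) + (q - 1) := by ring
    omega

open AddMonoidAlgebra in
lemma olson_fin (p j : ℕ) [Fact p.Prime] {r N : ℕ} (e : Fin r → G) (hq : ∀ i, p ^ j • e i = 0)
    (g h : Fin N → G) (c : Fin N → ℕ) (hh : ∀ k, h k ∈ AddSubgroup.closure (Set.range e))
    (hg : ∀ k, g k = p ^ c k • h k)
    (hfree : ∀ t : Finset (Fin N), ∑ k ∈ t, g k = 0 → t = ∅) :
    ∑ k, p ^ c k ≤ r * (p ^ j - 1) := by
  by_contra hc
  push Not at hc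
  haveI : CharP (AddMonoidAlgebra (ZMod p) G) p :=
    charP_of_injective_algebraMap (algebraMap (ZMod p) (AddMonoidAlgebra (ZMod p) G)).injective p
  let x : G → AddMonoidAlgebra (ZMod p) G := fun a => single a 1
  have hx_add : ∀ a b, x (a + b) = x a * x b := by
    intro a b; simp only [x]; rw [single_mul_single, mul_one]
  have hx0 : x 0 = 1 := rfl
  have hx_pow : ∀ (n : ℕ) a, x (n • a) = x a ^ n := by
    intro n a
    induction n with
    | zero => simp [hx0]
    | succ n ih => rw [succ_nsmul, hx_add, ih, pow_succ]
  have hx_char : ∀ (n : ℕ) a, (x a - 1) ^ p ^ n = x (p ^ n • a) - 1 := by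
    intro n a
    rw [sub_pow_char_pow, one_pow, hx_pow]
  let I : Fin r → Ideal (AddMonoidAlgebra (ZMod p) G) := fun i => Ideal.span {x (e i) - 1}
  have hI : ∀ i, I i ^ p ^ j = 0 := by
    intro i
    simp only [I]
    rw [Ideal.span_singleton_pow, hx_char, hq, hx0, sub_self]
    simp
  have hpj : 1 ≤ p ^ j := Nat.one_le_pow _ _ (Nat.Prime.pos Fact.out)
  have hJ := ideal_sum_pow I (p ^ j) hpj hI Finset.univ
  rw [Finset.card_univ, Fintype.card_fin] at hJ
  set J := ∑ i, I i with hJd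
  have hmemI : ∀ i, x (e i) - 1 ∈ J := by
    intro i
    have : I i ≤ J := by
      rw [hJd]
      exact Finset.single_le_sum (f := I) (fun _ _ => bot_le) (Finset.mem_univ i)
    exact this (Ideal.mem_span_singleton_self _)
  have hmem : ∀ a ∈ AddSubgroup.closure (Set.range e), x a - 1 ∈ J := by
    intro a ha
    induction ha using AddSubgroup.closure_induction with
    | mem a ha => obtain ⟨i, rfl⟩ := ha; exact hmemI i
    | zero => rw [hx0, sub_self]; exact J.zero_mem
    | add a b _ _ h1 h2 =>
      have : x (a + b) - 1 = x a * (x b - 1) + (x a - 1) := by rw [hx_add]; ring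
      rw [this]
      exact J.add_mem (J.mul_mem_left _ h2) h1
    | neg a _ h1 =>
      have : x (-a) - 1 = - x (-a) * (x a - 1) := by
        have h2 : x (-a) * x a = 1 := by rw [← hx_add]; simp [hx0]
        linear_combination h2
      rw [this]
      exact J.mul_mem_left _ h1
  have hk : ∀ k, 1 + - x (g k) ∈ J ^ p ^ c k := by
    intro k
    have : 1 + - x (g k) = -((x (h k) - 1) ^ p ^ c k) := by
      rw [hx_char, hg]; ring
    rw [this]
    exact neg_mem (Ideal.pow_mem_pow (hmem _ (hh k)) _)
  have hprod : ∏ k, (1 + - x (g k)) = 0 := by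
    have h1 : ∏ k, (1 + - x (g k)) ∈ ∏ k, J ^ p ^ c k :=
      Ideal.prod_mem_prod fun k _ => hk k
    rw [Finset.prod_pow_eq_pow_sum] at h1
    have h2 := Ideal.pow_le_pow_right (I := J) (show r * (p ^ j - 1) + 1 ≤ ∑ k, p ^ c k by omega) h1
    rw [hJ] at h2
    simpa using h2
  rw [Finset.prod_one_add] at hprod
  have hterm : ∀ t : Finset (Fin N), ∏ k ∈ t, (- x (g k)) = single (∑ k ∈ t, g k) ((-1) ^ t.card) := by
    intro t
    induction t using Finset.induction_on with
    | empty => rw [Finset.prod_empty, Finset.sum_empty, Finset.card_empty, pow_zero]; exact hx0.symm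
    | insert a t ha ih =>
      rw [Finset.prod_insert ha, ih, Finset.sum_insert ha, Finset.card_insert_of_notMem ha]
      simp only [x]
      rw [neg_mul, single_mul_single, pow_succ, ← single_neg]
      congr 1; ring
  have hcoef := congrArg (fun f : AddMonoidAlgebra (ZMod p) G => f.coeff 0) hprod
  simp only [hterm] at hcoef
  rw [coeff_sum, Finsupp.finset_sum_apply, Finset.sum_eq_single ∅] at hcoef
  · simp [coeff_single] at hcoef
  · intro t _ ht
    rw [coeff_single]
    exact Finsupp.single_eq_of_ne fun h => ht (hfree t h.symm)
  · simp

lemma olson (p j : ℕ) [Fact p.Prime] {r : ℕ} (e : Fin r → G) (hq : ∀ i, p ^ j • e i = 0)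
    (S : Multiset G) (hS : ∀ T ≤ S, T.sum = 0 → T = 0) (c : G → ℕ)
    (hc : ∀ g ∈ S, ∃ h ∈ AddSubgroup.closure (Set.range e), g = p ^ c g • h) :
    (S.map (fun g => p ^ c g)).sum ≤ r * (p ^ j - 1) := by
  have hch : ∀ g, ∃ h, g ∈ S → h ∈ AddSubgroup.closure (Set.range e) ∧ g = p ^ c g • h := by
    intro g
    by_cases hg : g ∈ S
    · obtain ⟨h, h1, h2⟩ := hc g hg; exact ⟨h, fun _ => ⟨h1, h2⟩⟩
    · exact ⟨0, fun h => absurd h hg⟩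
  choose h hh using hch
  obtain ⟨l, rfl⟩ := Quot.exists_rep S
  change ∀ T ≤ (l : Multiset G), _ at hS
  change (Multiset.map _ (l : Multiset G)).sum ≤ _
  have hl : (l : Multiset G) = (Finset.univ : Finset (Fin l.length)).val.map l.get := by
    rw [Fin.univ_val_map, List.ofFn_get]
  have hmem : ∀ k, l.get k ∈ (l : Multiset G) := fun k => by simp
  have := olson_fin p j e hq (fun k : Fin l.length => l.get k) (fun k => h (l.get k))
    (fun k => c (l.get k)) (fun k => (hh _ (hmem k)).1) (fun k => (hh _ (hmem k)).2) (by
      intro t ht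
      have h1 : t.val.map l.get ≤ (l : Multiset G) := by
        rw [hl]; exact Multiset.map_le_map (Finset.val_le_iff.2 (Finset.subset_univ t))
      have h2 := hS _ h1 ht
      rw [Multiset.map_eq_zero] at h2
      exact Finset.val_eq_zero.1 h2)
  rw [hl, Multiset.map_map]
  exact this

lemma atom_free {A S : Multiset G} {g : G} (hA : Atom A) (h : A = g ::ₘ S) :
    ∀ T ≤ S, T.sum = 0 → T = 0 := by
  intro T hT hs
  by_contra h0
  have := hA.min (hT.trans (h ▸ Multiset.le_cons_self _ _)) hs h0
  have h1 := Multiset.card_le_card hT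
  rw [this, h, Multiset.card_cons] at h1
  omega

lemma dav_le_of_gen [Finite G] (p j : ℕ) [Fact p.Prime] {r : ℕ} (e : Fin r → G)
    (hq : ∀ i, p ^ j • e i = 0) (hgen : AddSubgroup.closure (Set.range e) = ⊤) :
    davenport G ≤ r * (p ^ j - 1) + 1 := by
  obtain ⟨A, hA, hc⟩ := exists_dav G
  obtain ⟨g, hg⟩ := Multiset.exists_mem_of_ne_zero hA.ne
  obtain ⟨S, hS⟩ := Multiset.exists_cons_of_mem hg
  have := olson p j e hq S (atom_free hA hS) (fun _ => 0) (fun g _ => ⟨g, by simp [hgen], by simp⟩)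
  simp at this
  rw [← hc, hS, Multiset.card_cons]
  omega

end Olson

section homog

/-- homocyclic `p`-groups `C_{p^k}^r` -/
structure Homog (G : Type*) [AddCommGroup G] (p k r : ℕ) : Prop where
  prime : p.Prime
  pos : 1 ≤ k
  gen : ∃ e : Fin r → G, AddSubgroup.closure (Set.range e) = ⊤
  tors : ∀ g : G, p ^ k • g = 0
  div : ∀ i ≤ k, ∀ g : G, p ^ i • g = 0 → ∃ h, g = p ^ (k - i) • h
  ind : Indep (p ^ k) r G

variable {G : Type*} [AddCommGroup G] [Finite G] {p k r : ℕ}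

lemma Homog.dav (h : Homog G p k r) (hr : 2 ≤ r) : davenport G = r * (p ^ k - 1) + 1 := by
  haveI : Fact p.Prime := ⟨h.prime⟩
  obtain ⟨e, he⟩ := h.gen
  refine le_antisymm (dav_le_of_gen p k e (fun i => h.tors _) he) ?_
  have : 2 ≤ p ^ k := h.prime.two_le.trans (Nat.le_self_pow (by have := h.pos; omega) p)
  exact indep_dav this hr h.ind

lemma Homog.kq_le_aux (h : Homog G p k r) {A : Multiset G} (hA : Atom A) :
    ∃ i ≤ k, (∃ g ∈ A, addOrderOf g = p ^ i) ∧ (p ^ i : ℚ) * kq A ≤ r * (p ^ i - 1) + 1 := by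
  haveI : Fact p.Prime := ⟨h.prime⟩
  obtain ⟨e, he⟩ := h.gen
  have hord : ∀ g : G, ∃ a ≤ k, addOrderOf g = p ^ a := fun g =>
    (Nat.dvd_prime_pow h.prime).1 (addOrderOf_dvd_of_nsmul_eq_zero (h.tors g))
  choose a ha hao using hord
  obtain ⟨g0, hg0, hmax⟩ := A.toFinset.exists_max_image a (by
    obtain ⟨g, hg⟩ := Multiset.exists_mem_of_ne_zero hA.ne
    exact ⟨g, by simpa using hg⟩)
  have hg0 : g0 ∈ A := by simpa using hg0
  have hmax : ∀ g ∈ A, a g ≤ a g0 := fun g hg => hmax g (by simpa using hg)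
  obtain ⟨S, hS⟩ := Multiset.exists_cons_of_mem hg0
  have hp0 : (0:ℚ) < p := by exact_mod_cast h.prime.pos
  refine ⟨a g0, ha g0, ⟨g0, hg0, hao g0⟩, ?_⟩
  have hmap : ∀ x : G, p ^ (k - a g0) • x ∈
      AddSubgroup.closure (Set.range (fun i => p ^ (k - a g0) • e i)) := by
    intro x
    have hx : x ∈ AddSubgroup.closure (Set.range e) := by simp [he]
    induction hx using AddSubgroup.closure_induction with
    | mem x hx => obtain ⟨i, rfl⟩ := hx; exact AddSubgroup.subset_closure ⟨i, rfl⟩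
    | zero => simp
    | add x y _ _ hx hy => rw [nsmul_add]; exact add_mem hx hy
    | neg x _ hx => rw [smul_neg]; exact neg_mem hx
  have := olson p (a g0) (fun i => p ^ (k - a g0) • e i) (fun i => by
      rw [smul_smul, ← pow_add, Nat.add_sub_cancel' (ha g0)]; exact h.tors _) S
    (atom_free hA hS) (fun g => a g0 - a g) (by
      intro g hg
      have hgA : g ∈ A := hS ▸ Multiset.mem_cons_of_mem hg
      obtain ⟨x, hx⟩ := h.div (a g) (ha g) g (by rw [← hao]; exact addOrderOf_nsmul_eq_zero g)
      refine ⟨_, hmap x, ?_⟩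
      rw [smul_smul, ← pow_add]
      have h1 := hmax g hgA
      have h2 := ha g0
      rwa [show a g0 - a g + (k - a g0) = k - a g by omega])
  have hkS : (p ^ a g0 : ℚ) * kq S = ((S.map (fun g => p ^ (a g0 - a g))).sum : ℕ) := by
    have hle : ∀ g ∈ S, a g ≤ a g0 := fun g hg => hmax g (hS ▸ Multiset.mem_cons_of_mem hg)
    clear this hS
    induction S using Multiset.induction with
    | empty => simp [kq_zero]
    | cons b s ih =>
      rw [kq_cons, mul_add, ih (fun g hg => hle g (by simp [hg])), Multiset.map_cons, Multiset.sum_cons]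
      push_cast
      congr 1
      rw [hao b]
      have := hle b (by simp)
      push_cast
      rw [mul_one_div, pow_sub₀ _ hp0.ne' this, div_eq_mul_inv]
  rw [hS, kq_cons, mul_add, hkS, hao]
  push_cast
  rw [mul_one_div, div_self (by positivity)]
  have h1 : 1 ≤ p ^ a g0 := Nat.one_le_pow _ _ h.prime.pos
  have h2 : (((S.map (fun g => p ^ (a g0 - a g))).sum : ℕ) : ℚ) ≤ ((r * (p ^ a g0 - 1) : ℕ) : ℚ) := by
    exact_mod_cast this
  push_cast [h1] at h2
  push_cast at h2 ⊢
  linarith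

lemma Homog.kq_le (h : Homog G p k r) (hr : 1 ≤ r) {A : Multiset G} (hA : Atom A) :
    (p ^ k : ℚ) * kq A ≤ r * (p ^ k - 1) + 1 := by
  obtain ⟨i, hi, -, hk⟩ := h.kq_le_aux hA
  have hp0 : (1:ℚ) ≤ p := by exact_mod_cast h.prime.pos
  have h1 : (p:ℚ) ^ k = p ^ i * p ^ (k - i) := by rw [← pow_add, Nat.add_sub_cancel' hi]
  have h2 : (1:ℚ) ≤ p ^ (k - i) := one_le_pow₀ hp0
  have h3 : (1:ℚ) ≤ r := by exact_mod_cast hr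
  have h4 := mul_le_mul_of_nonneg_right hk (show (0:ℚ) ≤ p ^ (k - i) by linarith)
  rw [h1]
  nlinarith

lemma Homog.two_le (h : Homog G p k r) : 2 ≤ p ^ k :=
  h.prime.two_le.trans (Nat.le_self_pow (by have := h.pos; omega) p)

lemma Homog.kq_lt (h : Homog G p k r) (hr : 2 ≤ r) {A : Multiset G} (hA : Atom A) : kq A < r := by
  have h1 := h.kq_le (by omega) hA
  have h2 : (2:ℚ) ≤ p ^ k := by exact_mod_cast h.two_le
  have h3 : (2:ℚ) ≤ r := by exact_mod_cast hr
  by_contra hc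
  push Not at hc
  have := mul_le_mul_of_nonneg_left hc (show (0:ℚ) ≤ p ^ k by linarith)
  nlinarith

lemma Indep.torsion_ne {m s : ℕ} (h : Indep m s G) (hs : 1 ≤ s) (hm : 2 ≤ m) :
    ∃ g : G, g ≠ 0 ∧ m • g = 0 := by
  obtain ⟨y, h0, hi⟩ := h
  refine ⟨y ⟨0, hs⟩, fun h => ?_, h0 _⟩
  have := hi (fun j => if j = ⟨0, hs⟩ then 1 else 0) (by simp [h]) ⟨0, hs⟩
  simp at this
  have := Int.le_of_dvd (by norm_num) this
  omega

lemma Homog.not_indep (h : Homog G p k r) (hr : 2 ≤ r) {q : ℕ} (hq : q.Prime) : ¬ Indep q (r + 1) G := by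
  intro hI
  have hqp : q = p := by
    obtain ⟨g, hg0, hg⟩ := hI.torsion_ne (by omega) hq.two_le
    by_contra hne
    have h1 := addOrderOf_dvd_of_nsmul_eq_zero hg
    have h2 := addOrderOf_dvd_of_nsmul_eq_zero (h.tors g)
    have h3 : Nat.Coprime q (p ^ k) := Nat.Coprime.pow_right _ ((Nat.coprime_primes hq h.prime).2 hne)
    have := Nat.eq_one_of_dvd_coprimes h3 h1 h2
    exact hg0 (AddMonoid.addOrderOf_eq_one_iff.1 this)
  subst hqp
  obtain ⟨y, h0, hi⟩ := hI
  have hW := ind_W_atom hq.two_le (by omega) h0 hi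
  obtain ⟨i, hik, ⟨g0, hg0, hgi⟩, hk⟩ := h.kq_le_aux hW
  have hqg : ∀ g ∈ ((1:ℕ) • {∑ i, y i} + ∑ i, (q - 1) • ({y i} : Multiset G)), q • g = 0 := by
    intro g hg
    simp only [Multiset.mem_add, Multiset.mem_sum] at hg
    rcases hg with hg | ⟨i, -, hg⟩
    · have := Multiset.mem_of_mem_nsmul hg
      rw [Multiset.mem_singleton] at this
      rw [this, Finset.smul_sum]; simp [h0]
    · have := Multiset.mem_of_mem_nsmul hg
      rw [Multiset.mem_singleton] at this
      rw [this]; exact h0 i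
  have hcN : Multiset.card ((1:ℕ) • {∑ i, y i} + ∑ i, (q - 1) • ({y i} : Multiset G))
      = (r + 1) * (q - 1) + 1 := by
    simp
  set W := ((1:ℕ) • {∑ i, y i} + ∑ i, (q - 1) • ({y i} : Multiset G)) with hWd
  have hq2 := hq.two_le
  have hgq : addOrderOf g0 = q := by
    rcases (Nat.dvd_prime hq).1 (addOrderOf_dvd_of_nsmul_eq_zero (hqg g0 hg0)) with h1 | h1
    · rw [AddMonoid.addOrderOf_eq_one_iff.1 h1] at hg0
      rw [atom_mem_zero hW hg0] at hcN
      rw [Multiset.card_singleton] at hcN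
      have : 0 < (r + 1) * (q - 1) := Nat.mul_pos (by omega) (by omega)
      omega
    · exact h1
  have hle : ∀ g ∈ W, (1 / q : ℚ) ≤ 1 / (addOrderOf g : ℚ) := by
    intro g hg
    have h1 := addOrderOf_dvd_of_nsmul_eq_zero (hqg g hg)
    have h2 := Nat.le_of_dvd hq.pos h1
    have h3 := ord_pos g
    apply one_div_le_one_div_of_le
    · exact_mod_cast h3
    · exact_mod_cast h2
  have h1 := card_le_wt hle
  change _ ≤ kq _ at h1
  have hq1 : 1 ≤ q := hq.pos
  have hq0 : (2:ℚ) ≤ q := by exact_mod_cast hq.two_le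
  have hqi : (q:ℚ) ^ i = q := by rw [hgq] at hgi; exact_mod_cast hgi.symm
  rw [hqi] at hk
  rw [hcN] at h1
  push_cast [hq1] at h1
  rw [mul_one_div, div_le_iff₀ (by linarith)] at h1
  nlinarith

lemma homog_of_equiv {n : ℕ} (hp : p.Prime) (hk : 1 ≤ k) (hn : n = p ^ k)
    (φ : G ≃+ (Fin r → ZMod n)) : Homog G p k r := by
  haveI : NeZero n := ⟨by rw [hn]; exact (pow_pos hp.pos k).ne'⟩
  have htors : ∀ g : G, p ^ k • g = 0 := by
    intro g
    apply φ.injective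
    rw [map_nsmul, map_zero]
    ext i
    simp [← hn]
  have hrep : ∀ g : G, g = ∑ i, (φ g i).val • φ.symm (Pi.single i 1) := by
    intro g
    apply φ.injective
    simp only [map_sum, map_nsmul, AddEquiv.apply_symm_apply]
    ext j
    rw [Finset.sum_apply, Finset.sum_eq_single j]
    · rw [Pi.smul_apply, Pi.single_eq_same, nsmul_eq_mul, mul_one, ZMod.natCast_zmod_val]
    · intro b _ hb
      rw [Pi.smul_apply, Pi.single_eq_of_ne (Ne.symm hb), smul_zero]
    · simp
  refine ⟨hp, hk, ⟨fun i => φ.symm (Pi.single i 1), ?_⟩, htors, ?_, ?_⟩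
  · rw [eq_top_iff]
    intro g _
    rw [hrep g]
    exact sum_mem fun i _ => AddSubgroup.nsmul_mem _ (AddSubgroup.subset_closure (Set.mem_range_self i)) _
  · intro i hi g hg
    have : ∀ j, ∃ c : ℕ, (φ g j).val = p ^ (k - i) * c := by
      intro j
      have h1 : φ (p ^ i • g) j = 0 := by rw [hg]; simp
      rw [map_nsmul] at h1
      have h2 : ((p ^ i * (φ g j).val : ℕ) : ZMod n) = 0 := by
        push_cast; simpa using h1
      rw [ZMod.natCast_eq_zero_iff] at h2
      generalize (φ g j).val = v at h2 ⊢
      rw [hn] at h2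
      have h3 : p ^ k = p ^ i * p ^ (k - i) := by rw [← pow_add, Nat.add_sub_cancel' hi]
      rw [h3] at h2
      exact Nat.dvd_of_mul_dvd_mul_left (pow_pos hp.pos i) h2
    choose c hc using this
    refine ⟨∑ j, c j • φ.symm (Pi.single j 1), ?_⟩
    rw [Finset.smul_sum]
    conv_lhs => rw [hrep g]
    refine Finset.sum_congr rfl fun j _ => ?_
    rw [smul_smul, hc]
  · refine ⟨fun i => φ.symm (Pi.single i 1), fun j => htors _, ?_⟩
    intro c hc j
    have h1 := congrArg (fun x => φ x j) hc
    simp only [map_sum, map_zsmul, AddEquiv.apply_symm_apply, map_zero] at h1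
    simp [Finset.sum_apply, Pi.single_apply] at h1
    rw [ZMod.intCast_zmod_eq_zero_iff_dvd] at h1
    rwa [← hn]

end homog

end LSys

namespace LSys

section dav

variable {G : Type*} [AddCommGroup G]

lemma le_cons_cases {T U : Multiset G} {h : G} (hT : T ≤ h ::ₘ U) :
    T ≤ U ∨ ∃ T' ≤ U, T = h ::ₘ T' := by
  by_cases hm : h ∈ T
  · right
    exact ⟨T.erase h, Multiset.erase_le_iff_le_cons.2 hT, (Multiset.cons_erase hm).symm⟩
  · left
    exact (Multiset.le_cons_of_notMem hm).1 hT

lemma le_map_exists {H : Type*} {f : H → G} {S : Multiset H} : ∀ {T : Multiset G}, T ≤ S.map f →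
    ∃ T' ≤ S, T = T'.map f := by
  induction S using Multiset.induction with
  | empty => intro T hT; exact ⟨0, le_rfl, by simpa using hT⟩
  | cons a s ih =>
    intro T hT
    rw [Multiset.map_cons] at hT
    rcases le_cons_cases hT with h | ⟨T', h, rfl⟩
    · obtain ⟨T', h1, h2⟩ := ih h
      exact ⟨T', h1.trans (Multiset.le_cons_self _ _), h2⟩
    · obtain ⟨T'', h1, rfl⟩ := ih h
      exact ⟨a ::ₘ T'', Multiset.cons_le_cons _ h1, by simp⟩

lemma dav_inj {H : Type*} [AddCommGroup H] [Finite G] [Finite H] (f : H →+ G)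
    (hf : Function.Injective f) (hs : ¬ Function.Surjective f) : davenport H + 1 ≤ davenport G := by
  obtain ⟨A, hA, hc⟩ := exists_dav H
  obtain ⟨g, hg⟩ := Multiset.exists_mem_of_ne_zero hA.ne
  obtain ⟨S, hS⟩ := Multiset.exists_cons_of_mem hg
  have hfree := atom_free hA hS
  obtain ⟨h, hh⟩ := not_forall.1 hs
  push Not at hh
  have hsum : g + S.sum = 0 := by rw [← Multiset.sum_cons, ← hS]; exact hA.sum
  have hT0 : ∀ T ≤ S.map f, T.sum = 0 → T = 0 := by
    intro T hT h0
    obtain ⟨T', h1, rfl⟩ := le_map_exists hT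
    have : T'.sum = 0 := by
      apply hf
      rw [map_zero, map_multiset_sum]; exact h0
    rw [hfree T' h1 this]; simp
  have hTr : ∀ T ≤ S.map f, ∃ x, f x = T.sum := by
    intro T hT
    obtain ⟨T', h1, rfl⟩ := le_map_exists hT
    exact ⟨T'.sum, map_multiset_sum f T'⟩
  have hB : Atom (h ::ₘ (f g - h) ::ₘ S.map f) := by
    have hBs : (h ::ₘ (f g - h) ::ₘ S.map f).sum = 0 := by
      rw [Multiset.sum_cons, Multiset.sum_cons, ← map_multiset_sum, ← add_assoc, add_sub_cancel,
        ← map_add, hsum, map_zero]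
    refine ⟨by simp, hBs, ?_⟩
    intro T hT h0
    rcases le_cons_cases hT with h1 | ⟨T1, h1, rfl⟩
    · rcases le_cons_cases h1 with h2 | ⟨T2, h2, rfl⟩
      · exact Or.inl (hT0 T h2 h0)
      · exfalso
        obtain ⟨x, hx⟩ := hTr T2 h2
        rw [Multiset.sum_cons, ← hx] at h0
        apply hh (g + x)
        rw [map_add]
        have : f g - h + f x = 0 := h0
        rw [sub_add_eq_add_sub, sub_eq_zero] at this
        exact this
    · rcases le_cons_cases h1 with h2 | ⟨T2, h2, rfl⟩
      · exfalso
        obtain ⟨x, hx⟩ := hTr T1 h2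
        rw [Multiset.sum_cons, ← hx] at h0
        apply hh (-x)
        rw [map_neg]; exact (eq_neg_of_add_eq_zero_left h0).symm
      · right
        obtain ⟨Q, hQ⟩ := Multiset.le_iff_exists_add.1 h2
        have hQ0 : Q.sum = 0 := by
          rw [hQ] at hBs
          simp only [Multiset.sum_cons, Multiset.sum_add] at hBs h0
          have : Q.sum = (h + (f g - h + (T2.sum + Q.sum))) - (h + (f g - h + T2.sum)) := by abel
          rw [this, hBs, h0, sub_zero]
        have := hT0 Q (hQ ▸ Multiset.le_add_left _ _) hQ0
        rw [hQ, this, add_zero]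
  have := le_dav hB
  simp at this
  rw [← hc, hS, Multiset.card_cons]
  exact this

lemma dav_surj {G' : Type*} [AddCommGroup G'] [Finite G] [Finite G'] (f : G →+ G')
    (hf : Function.Surjective f) {x : G} (hx : f x = 0) (hx0 : x ≠ 0) :
    davenport G' + 1 ≤ davenport G := by
  obtain ⟨A, hA, hc⟩ := exists_dav G'
  obtain ⟨g, hg⟩ := Multiset.exists_mem_of_ne_zero hA.ne
  obtain ⟨S, hS⟩ := Multiset.exists_cons_of_mem hg
  obtain ⟨s, hs⟩ := hf.hasRightInverse
  have hsum : g + S.sum = 0 := by rw [← Multiset.sum_cons, ← hS]; exact hA.sum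
  have hSm : (S.map s).map f = S := by
    rw [Multiset.map_map]
    conv_rhs => rw [← Multiset.map_id S]
    exact Multiset.map_congr rfl fun a _ => hs a
  set A' := (x - (S.map s).sum) ::ₘ S.map s with hA'
  have hA's : A'.sum = x := by rw [hA', Multiset.sum_cons]; abel
  have hA'm : A'.map f = A := by
    rw [hA', Multiset.map_cons, hSm, map_sub, hx, map_multiset_sum, hSm, hS]
    congr 1
    rw [zero_sub]; exact (eq_neg_of_add_eq_zero_left hsum).symm
  have hcard : ∀ T ≤ A', (T.map f).sum = 0 → T = 0 ∨ T = A' := by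
    intro T hT h0
    rcases hA.2.2 (T.map f) (hA'm ▸ Multiset.map_le_map hT) h0 with h | h
    · left; simpa using h
    · right
      apply Multiset.eq_of_le_of_card_le hT
      rw [← Multiset.card_map f T, h, ← hA'm, Multiset.card_map]
  have hB : Atom ((-x) ::ₘ A') := by
    refine ⟨by simp, by rw [Multiset.sum_cons, hA's]; abel, ?_⟩
    intro T hT h0
    rcases le_cons_cases hT with h1 | ⟨T1, h1, rfl⟩
    · rcases hcard T h1 (by rw [← map_multiset_sum, h0, map_zero]) with h | h
      · exact Or.inl h
      · rw [h, hA's] at h0; exact absurd h0 hx0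
    · rw [Multiset.sum_cons] at h0
      rcases hcard T1 h1 (by
        rw [← map_multiset_sum, ← neg_eq_of_add_eq_zero_right h0, neg_neg, hx]) with h | h
      · rw [h] at h0; simp at h0; exact absurd h0 hx0
      · right; rw [h]
  have := le_dav hB
  rw [Multiset.card_cons] at this
  rw [← hc, ← hA'm, Multiset.card_map]
  exact this

lemma Indep.combine {m1 m2 s : ℕ} (hc : Nat.Coprime m1 m2) (h1 : Indep m1 s G) (h2 : Indep m2 s G) :
    Indep (m1 * m2) s G := by
  obtain ⟨y1, h10, h1i⟩ := h1
  obtain ⟨y2, h20, h2i⟩ := h2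
  refine ⟨fun j => y1 j + y2 j, fun j => ?_, ?_⟩
  · rw [nsmul_add, mul_comm, mul_nsmul', h10, mul_comm, mul_nsmul', h20]; simp
  · intro c hcs j
    have e1 : ∑ j, (c j * m2) • y1 j = 0 := by
      have := congrArg (fun x => (m2:ℤ) • x) hcs
      simp only [Finset.smul_sum, smul_add, smul_zero] at this
      rw [← this]
      refine Finset.sum_congr rfl fun j _ => ?_
      rw [smul_smul (m2:ℤ) (c j) (y2 j), mul_comm (m2:ℤ), mul_smul (c j) (m2:ℤ) (y2 j), natCast_zsmul (y2 j),
        h20, smul_zero, add_zero, smul_smul, mul_comm]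
    have e2 : ∑ j, (c j * m1) • y2 j = 0 := by
      have := congrArg (fun x => (m1:ℤ) • x) hcs
      simp only [Finset.smul_sum, smul_add, smul_zero] at this
      rw [← this]
      refine Finset.sum_congr rfl fun j _ => ?_
      rw [smul_smul (m1:ℤ) (c j) (y1 j), mul_comm (m1:ℤ), mul_smul (c j) (m1:ℤ) (y1 j), natCast_zsmul (y1 j),
        h10, smul_zero, zero_add, smul_smul, mul_comm]
    have hc' : IsCoprime (m1:ℤ) (m2:ℤ) := Nat.isCoprime_iff_coprime.2 hc
    push_cast
    exact hc'.mul_dvd (hc'.dvd_of_dvd_mul_right (h1i _ e1 j))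
      (hc'.symm.dvd_of_dvd_mul_right (h2i _ e2 j))

lemma indep_of_prime_pow {s : ℕ} (m : ℕ) (hm : m ≠ 0)
    (h : ∀ p b : ℕ, p.Prime → 1 ≤ b → p ^ b ∣ m → Indep (p ^ b) s G) : Indep m s G := by
  induction m using Nat.recOnPosPrimePosCoprime with
  | zero => exact absurd rfl hm
  | one => exact ⟨0, by simp, by simp⟩
  | prime_pow p n hp hn => exact h p n hp hn dvd_rfl
  | coprime a b ha hb hab iha ihb =>
    exact (iha (by omega) fun p b' hp hb' hd => h p b' hp hb' (hd.trans (dvd_mul_right _ _))).combine hab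
      (ihb (by omega) fun p b' hp hb' hd => h p b' hp hb' (hd.trans (dvd_mul_left _ _)))

end dav

section pb

variable {G : Type*} [AddCommGroup G]

lemma mem_closure_split {ι : Type*} (u : ι → G) (E : Finset ι) {e : ι} (he : e ∈ E) {x : G}
    (hx : x ∈ AddSubgroup.closure (u '' E)) :
    ∃ z : ℤ, x - z • u e ∈ AddSubgroup.closure (u '' (E.erase e : Finset ι)) := by
  have : u '' (E : Set ι) = {u e} ∪ u '' (E.erase e : Finset ι) := by
    conv_lhs => rw [← Finset.insert_erase he]
    rw [Finset.coe_insert, Set.image_insert_eq, Set.singleton_union]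
  rw [this, AddSubgroup.closure_union, AddSubgroup.mem_sup] at hx
  obtain ⟨a, ha, b, hb, rfl⟩ := hx
  rw [AddSubgroup.mem_closure_singleton] at ha
  obtain ⟨z, rfl⟩ := ha
  exact ⟨z, by simpa using hb⟩

lemma pbasis {p : ℕ} (hp : p.Prime) (u : G → G) (T : Finset G) :
    ∃ E ⊆ T, (∃ c : ℤ, IsCoprime c (p:ℤ) ∧ ∀ t ∈ T, c • u t ∈ AddSubgroup.closure (u '' E)) ∧
      ∀ e ∈ E, ∀ c : ℤ, IsCoprime c (p:ℤ) →
        c • u e ∉ AddSubgroup.closure (u '' (E.erase e : Finset G)) := by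
  let P : Finset G → Prop := fun E => ∃ c : ℤ, IsCoprime c (p:ℤ) ∧
    ∀ t ∈ T, c • u t ∈ AddSubgroup.closure (u '' E)
  obtain ⟨E, hE, hmin⟩ := (T.powerset.filter P).exists_min_image Finset.card
    ⟨T, by simpa [P] using ⟨1, isCoprime_one_left, fun t ht => by
      rw [one_smul]; exact AddSubgroup.subset_closure ⟨t, by simpa using ht, rfl⟩⟩⟩
  rw [Finset.mem_filter, Finset.mem_powerset] at hE
  refine ⟨E, hE.1, hE.2, ?_⟩
  intro e he c hc hmem
  obtain ⟨c0, hc0, ht⟩ := hE.2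
  have := hmin (E.erase e) (by
    rw [Finset.mem_filter, Finset.mem_powerset]
    refine ⟨(Finset.erase_subset _ _).trans hE.1, c * c0, hc.mul_left hc0, fun t htT => ?_⟩
    obtain ⟨z, hz⟩ := mem_closure_split u E he (ht t htT)
    have : (c * c0) • u t = c • (c0 • u t - z • u e) + z • (c • u e) := by
      rw [smul_sub, smul_smul, smul_smul, smul_smul, mul_comm z c]; abel
    rw [this]
    exact add_mem (AddSubgroup.zsmul_mem _ hz _) (AddSubgroup.zsmul_mem _ hmem _))
  have h2 := Finset.card_erase_lt_of_mem he
  omega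

lemma dim_aux0 {p : ℕ} [Fact p.Prime] {A B ι : Type*} [AddCommGroup A] [AddCommGroup B] [Finite A]
    [Finite B] [Fintype ι] (_ : Module (ZMod p) A) (_ : Module (ZMod p) B)
    (hcard : Nat.card A = Nat.card B) (v : ι → B)
    (hv : ∀ a : ι → ℕ, ∑ e, a e • v e = 0 → ∀ e, p ∣ a e) (s : ℕ) (hs : s ≤ Fintype.card ι) :
    ∃ y : Fin s → A, ∀ c : Fin s → ℤ, ∑ j, c j • y j = 0 → ∀ j, (p : ℤ) ∣ c j := by
  haveI : Module.Finite (ZMod p) A := Module.Finite.of_finite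
  haveI : Module.Finite (ZMod p) B := Module.Finite.of_finite
  have hli : LinearIndependent (ZMod p) v := by
    rw [Fintype.linearIndependent_iff]
    intro a ha e
    have := hv (fun e => (a e).val) (by
      rw [← ha]
      refine Finset.sum_congr rfl fun e _ => ?_
      conv_rhs => rw [← ZMod.natCast_zmod_val (a e)]
      rw [Nat.cast_smul_eq_nsmul]) e
    exact (ZMod.val_eq_zero _).1 (Nat.eq_zero_of_dvd_of_lt this (ZMod.val_lt _))
  have hfr : Fintype.card ι ≤ Module.finrank (ZMod p) B :=
    @LinearIndependent.fintype_card_le_finrank (ZMod p) B _ _ _ _ _ _ _ v hli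
  have hc1 : Nat.card B = p ^ Module.finrank (ZMod p) B := by
    have := Module.natCard_eq_pow_finrank (K := ZMod p) (V := B)
    rwa [Nat.card_zmod] at this
  have hc2 : Nat.card A = p ^ Module.finrank (ZMod p) A := by
    have := Module.natCard_eq_pow_finrank (K := ZMod p) (V := A)
    rwa [Nat.card_zmod] at this
  rw [hc1, hc2] at hcard
  have hp2 : p.Prime := Fact.out
  have hfe := Nat.pow_right_injective hp2.two_le hcard
  have hsf : s ≤ Module.finrank (ZMod p) A := by omega
  let b := Module.finBasis (ZMod p) A
  refine ⟨fun j => b (Fin.castLE hsf j), ?_⟩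
  intro c hc j
  have hli2 := b.linearIndependent.comp (Fin.castLE hsf) (Fin.castLE_injective hsf)
  rw [Fintype.linearIndependent_iff] at hli2
  have := hli2 (fun j => (c j : ZMod p)) (by
    simp only [Int.cast_smul_eq_zsmul, Function.comp]
    exact hc) j
  exact (ZMod.intCast_zmod_eq_zero_iff_dvd _ _).1 this

lemma dim_aux {p : ℕ} [Fact p.Prime] {A B ι : Type*} [AddCommGroup A] [AddCommGroup B] [Finite A]
    [Finite B] [Fintype ι] (hA : ∀ x : A, p • x = 0) (hB : ∀ x : B, p • x = 0)
    (hcard : Nat.card A = Nat.card B) (v : ι → B)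
    (hv : ∀ a : ι → ℕ, ∑ e, a e • v e = 0 → ∀ e, p ∣ a e) (s : ℕ) (hs : s ≤ Fintype.card ι) :
    ∃ y : Fin s → A, ∀ c : Fin s → ℤ, ∑ j, c j • y j = 0 → ∀ j, (p : ℤ) ∣ c j := by
  exact dim_aux0 (AddCommGroup.zmodModule hA) (AddCommGroup.zmodModule hB) hcard v hv s hs

lemma pind_exists [Finite G] {p : ℕ} (hp : p.Prime) (u : G → G) (E : Finset G)
    (hE : ∀ e ∈ E, ∀ c : ℤ, IsCoprime c (p:ℤ) →
        c • u e ∉ AddSubgroup.closure (u '' (E.erase e : Finset G))) (s : ℕ) (hs : s ≤ E.card) :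
    ∃ y : Fin s → G, (∀ j, y j ∈ AddSubgroup.closure (u '' E)) ∧ (∀ j, p • y j = 0) ∧
      ∀ c : Fin s → ℤ, ∑ j, c j • y j = 0 → ∀ j, (p : ℤ) ∣ c j := by
  haveI : Fact p.Prime := ⟨hp⟩
  set K := AddSubgroup.closure (u '' (E : Set G)) with hK
  let f : K →+ K := nsmulAddMonoidHom p
  have hker : ∀ x : f.ker, p • x = 0 := by
    rintro ⟨x, hx⟩
    apply Subtype.ext
    exact (AddMonoidHom.mem_ker.1 hx : p • x = 0)
  have hquo : ∀ x : K ⧸ f.range, p • x = 0 := by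
    intro x
    obtain ⟨x, rfl⟩ := QuotientAddGroup.mk_surjective x
    rw [← QuotientAddGroup.mk_nsmul, QuotientAddGroup.eq_zero_iff]
    exact ⟨x, rfl⟩
  have hcard : Nat.card f.ker = Nat.card (K ⧸ f.range) := by
    have h1 := AddSubgroup.card_eq_card_quotient_mul_card_addSubgroup f.ker
    have h2 := AddSubgroup.card_eq_card_quotient_mul_card_addSubgroup f.range
    have h3 : Nat.card (K ⧸ f.ker) = Nat.card f.range :=
      Nat.card_congr (QuotientAddGroup.quotientKerEquivRange f).toEquiv
    rw [h3] at h1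
    have h4 : 0 < Nat.card f.range := Nat.card_pos
    rw [h2, mul_comm] at h1
    exact (Nat.eq_of_mul_eq_mul_left h4 h1).symm
  have hmem : ∀ e : E, u e ∈ K := fun e => AddSubgroup.subset_closure ⟨e, e.2, rfl⟩
  have hv : ∀ a : E → ℕ, ∑ e : E, a e • ((⟨u e, hmem e⟩ : K) : K ⧸ f.range) = 0 → ∀ e, p ∣ a e := by
    intro a ha e0
    by_contra hne
    have h1 : ((∑ e : E, a e • (⟨u e, hmem e⟩ : K) : K) : K ⧸ f.range) = 0 := by
      rw [← ha]
      rw [QuotientAddGroup.mk_sum]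
      rfl
    rw [QuotientAddGroup.eq_zero_iff] at h1
    obtain ⟨k, hk⟩ := h1
    have hk' : p • (k : G) = ∑ e : E, a e • u e := by
      have := congrArg (Subtype.val) hk
      simpa [f] using this
    obtain ⟨z, hz⟩ := mem_closure_split u E e0.2 k.2
    apply hE e0 e0.2 (a e0 - p * z)
    · apply IsCoprime.symm
      rw [Prime.coprime_iff_not_dvd (Nat.prime_iff_prime_int.1 hp)]
      intro hd
      rw [dvd_sub_left (dvd_mul_right _ _)] at hd
      exact hne (Int.natCast_dvd_natCast.1 hd)
    · have h2 : (a e0 - p * z : ℤ) • u e0 =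
          p • ((k:G) - z • u e0) - ∑ e ∈ Finset.univ.erase e0, a e • u e := by
        rw [smul_sub, hk', ← Finset.add_sum_erase _ _ (Finset.mem_univ e0), sub_smul, natCast_zsmul,
          mul_smul, natCast_zsmul]
        abel
      rw [h2]
      refine sub_mem (AddSubgroup.nsmul_mem _ hz _) (sum_mem fun e he => AddSubgroup.nsmul_mem _
        (AddSubgroup.subset_closure (Set.mem_image_of_mem u ?_)) _)
      have hne' := Finset.ne_of_mem_erase he
      rw [Finset.mem_coe, Finset.mem_erase]
      exact ⟨fun h => hne' (Subtype.ext h), e.2⟩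
  obtain ⟨y, hy⟩ := dim_aux hker hquo hcard _ hv s (by simpa using hs)
  refine ⟨fun j => ((y j : K) : G), fun j => (y j : K).2, ?_, ?_⟩
  · intro j
    have := congrArg (fun x : f.ker => ((x : K) : G)) (hker (y j))
    simpa using this
  · intro c hc j
    refine hy c ?_ j
    apply Subtype.ext; apply Subtype.ext
    push_cast
    exact hc

lemma indep_lift {p i s : ℕ} (y : Fin s → G)
    (hy : ∀ c : Fin s → ℤ, ∑ j, c j • (p ^ i • y j) = 0 → ∀ j, (p : ℤ) ∣ c j) :
    ∀ c : Fin s → ℤ, ∑ j, c j • y j = 0 → ∀ j, ((p ^ (i + 1) : ℕ) : ℤ) ∣ c j := by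
  have key : ∀ a ≤ i + 1, ∀ c : Fin s → ℤ, ∑ j, c j • y j = 0 → ∀ j, ((p ^ a : ℕ) : ℤ) ∣ c j := by
    intro a
    induction a with
    | zero => intro _ c _ j; simp
    | succ a ih =>
      intro ha c hc j
      have h1 := ih (by omega) c hc
      choose c' hc' using h1
      have h2 := hy c' (by
        have := congrArg (fun x => p ^ (i - a) • x) hc
        simp only [Finset.smul_sum, smul_zero] at this
        rw [← this]
        refine Finset.sum_congr rfl fun j _ => ?_
        rw [hc', ← natCast_zsmul, ← natCast_zsmul, smul_smul, smul_smul]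
        congr 1
        have : p ^ i = p ^ (i - a) * p ^ a := by rw [← pow_add]; congr 1; omega
        rw [this]; push_cast; ring) j
      rw [hc', pow_succ]
      push_cast
      exact mul_dvd_mul_left _ h2
  exact key (i + 1) le_rfl

lemma closure_nsmul_exists (q : ℕ) (E : Set G) {x : G}
    (hx : x ∈ AddSubgroup.closure ((fun g => q • g) '' E)) :
    ∃ y ∈ AddSubgroup.closure E, x = q • y := by
  induction hx using AddSubgroup.closure_induction with
  | mem x hx => obtain ⟨y, hy, rfl⟩ := hx; exact ⟨y, AddSubgroup.subset_closure hy, rfl⟩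
  | zero => exact ⟨0, zero_mem _, by simp⟩
  | add x y _ _ hx hy =>
    obtain ⟨a, ha, rfl⟩ := hx
    obtain ⟨b, hb, rfl⟩ := hy
    exact ⟨a + b, add_mem ha hb, by rw [nsmul_add]⟩
  | neg x _ hx =>
    obtain ⟨a, ha, rfl⟩ := hx
    exact ⟨-a, neg_mem ha, by simp⟩

/-- the basic dichotomy -/
lemma PB [Finite G] {p : ℕ} (hp : p.Prime) (T : Finset G) (i s : ℕ) :
    (∃ E ⊆ T, E.card ≤ s ∧ (∃ c : ℕ, c.Coprime p ∧ ∀ t ∈ T,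
        (c * p ^ i) • t ∈ AddSubgroup.closure (E : Set G))) ∨
    ∃ y : Fin (s + 1) → G, (∀ j, y j ∈ AddSubgroup.closure (T : Set G)) ∧
      (∀ j, p ^ (i + 1) • y j = 0) ∧
      ∀ c : Fin (s + 1) → ℤ, ∑ j, c j • y j = 0 → ∀ j, ((p ^ (i + 1) : ℕ) : ℤ) ∣ c j := by
  obtain ⟨E, hET, ⟨c, hc, hcT⟩, hind⟩ := pbasis hp (fun g => p ^ i • g) T
  by_cases hs : E.card ≤ s
  · left
    refine ⟨E, hET, hs, c.natAbs, ?_, fun t ht => ?_⟩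
    · have := Int.isCoprime_iff_gcd_eq_one.1 hc
      simpa [Int.gcd] using this
    · obtain ⟨y, hy, hy2⟩ := closure_nsmul_exists _ _ (hcT t ht)
      have h1 : c • (p ^ i • t) ∈ AddSubgroup.closure (E : Set G) := by
        rw [hy2]; exact AddSubgroup.nsmul_mem _ hy _
      rw [mul_nsmul']
      rcases Int.natAbs_eq c with h | h
      · rw [h, natCast_zsmul] at h1; exact h1
      · rw [h, neg_smul, natCast_zsmul] at h1
        exact neg_mem_iff.1 h1
  · right
    obtain ⟨y', h1, h2, h3⟩ := pind_exists hp (fun g => p ^ i • g) E hind (s + 1) (by omega)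
    choose y hy hy' using fun j => closure_nsmul_exists _ _ (h1 j)
    refine ⟨y, fun j => AddSubgroup.closure_mono (by exact_mod_cast hET) (hy j), fun j => ?_, ?_⟩
    · rw [pow_succ, mul_comm, mul_nsmul', ← hy', h2]
    · apply indep_lift
      intro c hc
      apply h3 c
      rw [← hc]
      exact Finset.sum_congr rfl fun j _ => by rw [hy']

lemma PB' [Finite G] {p : ℕ} (hp : p.Prime) (T : Finset G) (i s : ℕ)
    (h : ¬ Indep (p ^ (i + 1)) (s + 1) G) :
    (∃ E ⊆ T, E.card ≤ s ∧ (∃ c : ℕ, c.Coprime p ∧ ∀ t ∈ T,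
        (c * p ^ i) • t ∈ AddSubgroup.closure (E : Set G))) := by
  rcases PB hp T i s with h' | ⟨y, -, h1, h2⟩
  · exact h'
  · exact absurd ⟨y, h1, h2⟩ h

/-- `p`-bases -/
lemma PB0 [Finite G] {p : ℕ} (hp : p.Prime) (T : Finset G) (s : ℕ) (h : ¬ Indep p (s + 1) G) :
    ∃ E ⊆ T, E.card ≤ s ∧ (∃ c : ℕ, c.Coprime p ∧ ∀ t ∈ T, c • t ∈ AddSubgroup.closure (E : Set G)) ∧
      ∀ e ∈ E, ∀ c : ℤ, IsCoprime c (p:ℤ) →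
        c • e ∉ AddSubgroup.closure ((E.erase e : Finset G) : Set G) := by
  obtain ⟨E, hET, ⟨c, hc, hcT⟩, hind⟩ := pbasis hp (fun g => g) T
  simp only [Set.image_id'] at hcT hind
  refine ⟨E, hET, ?_, ⟨c.natAbs, ?_, fun t ht => ?_⟩, hind⟩
  · by_contra hs
    obtain ⟨y', h1, h2, h3⟩ := pind_exists hp (fun g => g) E (by simpa only [Set.image_id'] using hind)
      (s + 1) (by omega)
    exact h ⟨y', h2, h3⟩
  · have := Int.isCoprime_iff_gcd_eq_one.1 hc
    simpa [Int.gcd] using this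
  · have h1 := hcT t ht
    rcases Int.natAbs_eq c with h | h
    · rw [h, natCast_zsmul] at h1; exact h1
    · rw [h, neg_smul, natCast_zsmul] at h1
      exact neg_mem_iff.1 h1

end pb

end LSys

namespace LSys

section basic

variable {G : Type*} [AddCommGroup G] [Finite G]

lemma pow_fac (N : ℕ) (hN : 0 < N) (A : Multiset G) (h : ∀ g ∈ A, N • g = 0) :
    ∃ F, Fac F (N • A) ∧ (Multiset.card F : ℚ) = N * kq A := by
  induction A using Multiset.induction with
  | empty => exact ⟨0, by simpa using Fac.nil, by simp [kq_zero]⟩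
  | cons a s ih =>
    obtain ⟨F, hF, hc⟩ := ih fun g hg => h g (by simp [hg])
    obtain ⟨k, hk⟩ := addOrderOf_dvd_of_nsmul_eq_zero (h a (by simp))
    have h1 : Fac (k • {rep a}) (N • ({a} : Multiset G)) := by
      have := (Fac.single (rep_atom a)).nsmul k
      have e : k • rep a = N • ({a} : Multiset G) := by
        rw [rep, ← Multiset.nsmul_singleton, smul_smul, hk, mul_comm]
      rwa [e] at this
    refine ⟨k • {rep a} + F, ?_, ?_⟩
    · have := h1.add hF
      rwa [← nsmul_add, Multiset.singleton_add] at this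
    · have h0 : (0:ℚ) < addOrderOf a := by exact_mod_cast ord_pos a
      rw [kq_cons, mul_add, ← hc, hk]
      simp only [Multiset.card_add, Multiset.card_nsmul, Multiset.card_singleton]
      push_cast
      field_simp

lemma card_le_kq (N : ℕ) (hN : 0 < N) (A : Multiset G) (h : ∀ g ∈ A, N • g = 0) :
    (Multiset.card A : ℚ) ≤ N * kq A := by
  have hN' : (0:ℚ) < N := by exact_mod_cast hN
  have h1 : ∀ g ∈ A, (1 / N : ℚ) ≤ 1 / (addOrderOf g : ℚ) := by
    intro g hg
    apply one_div_le_one_div_of_le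
    · exact_mod_cast ord_pos g
    · exact_mod_cast Nat.le_of_dvd hN (addOrderOf_dvd_of_nsmul_eq_zero (h g hg))
  have h2 : _ ≤ kq A := card_le_wt h1
  rw [mul_one_div, div_le_iff₀ hN'] at h2
  linarith

lemma ord_of_kq (N : ℕ) (hN : 0 < N) (A : Multiset G) (h : ∀ g ∈ A, N • g = 0)
    (he : (N : ℚ) * kq A = Multiset.card A) : ∀ g ∈ A, addOrderOf g = N := by
  intro g hg
  obtain ⟨S, rfl⟩ := Multiset.exists_cons_of_mem hg
  have h1 := card_le_kq N hN S fun x hx => h x (by simp [hx])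
  rw [kq_cons, Multiset.card_cons, mul_add] at he
  push_cast at he
  have h0 : (0:ℚ) < addOrderOf g := by exact_mod_cast ord_pos g
  have h2 : (N:ℚ) * (1 / (addOrderOf g : ℚ)) ≤ 1 := by linarith
  rw [mul_one_div, div_le_one h0] at h2
  have h3 := Nat.le_of_dvd hN (addOrderOf_dvd_of_nsmul_eq_zero (h g hg))
  exact le_antisymm h3 (by exact_mod_cast h2)

lemma Atom.kq_one_of_card {A : Multiset G} (hA : Atom A) (h : Multiset.card A < 2) : kq A = 1 := by
  have := hA.one_le
  rw [atom_card_one hA (by omega)]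
  rw [← Multiset.cons_zero, kq_cons, kq_zero]; simp

lemma small_kq {S : Set G} {d : ℕ} (hC : Cong S d) {N : ℕ} (hN : 0 < N)
    (hS : ∀ g ∈ S, N • g = 0) {A : Multiset G} (hO : Over S A) (hA : Atom A) (hk : kq A < 1) :
    ∃ x : ℕ, (x : ℚ) = N * kq A ∧ 2 ≤ Multiset.card A ∧ Multiset.card A ≤ x ∧ x + d ≤ N := by
  obtain ⟨F, hF, hc⟩ := pow_fac N hN A fun g hg => hS g (hO g hg)
  have hN' : (0:ℚ) < N := by exact_mod_cast hN
  have h1 := card_le_kq N hN A fun g hg => hS g (hO g hg)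
  have h2 : 2 ≤ Multiset.card A := by
    by_contra hc'
    have := hA.kq_one_of_card (by omega)
    linarith
  have h3 := hC (N • A) (hO.nsmul N) (N • {A}) F ((Fac.single hA).nsmul N) hF
  have h4 : (Multiset.card F : ℚ) < N := by rw [hc]; nlinarith
  have h4' : Multiset.card F < N := by exact_mod_cast h4
  rw [Multiset.card_nsmul, Multiset.card_singleton, mul_one] at h3
  have h5 := int_gap h3 (by exact_mod_cast h4')
  refine ⟨Multiset.card F, hc, h2, ?_, by exact_mod_cast h5⟩
  rw [← hc] at h1
  exact_mod_cast h1

lemma lcn_small {S : Set G} {d : ℕ} (hC : Cong S d) {N : ℕ} (hN : 0 < N)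
    (hS : ∀ g ∈ S, N • g = 0) (hNd : N ≤ d + 1) : LCN S := by
  intro A hO hA
  by_contra hk
  push Not at hk
  obtain ⟨x, _, h2, h3, h4⟩ := small_kq hC hN hS hO hA hk
  omega

/-- atoms of cross number `< 1` when `N = d + 2` -/
lemma pair_of_small {S : Set G} {d : ℕ} (hC : Cong S d) {N : ℕ} (hN : 0 < N)
    (hS : ∀ g ∈ S, N • g = 0) (hNd : N = d + 2) {A : Multiset G} (hO : Over S A) (hA : Atom A)
    (hk : kq A < 1) : ∃ g ∈ S, -g ∈ S ∧ addOrderOf g = N ∧ A = {g, -g} := by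
  obtain ⟨x, hx, h2, h3, h4⟩ := small_kq hC hN hS hO hA hk
  have hx2 : x = 2 := by omega
  have hc : Multiset.card A = 2 := by omega
  have ho := ord_of_kq N hN A (fun g hg => hS g (hO g hg)) (by rw [← hx, hx2, hc])
  obtain ⟨g, h, rfl⟩ := Multiset.card_eq_two.1 hc
  have hs := hA.sum
  simp at hs
  have hh : h = -g := (neg_eq_of_add_eq_zero_right hs).symm
  subst hh
  exact ⟨g, hO g (by simp), hO (-g) (by simp), ho g (by simp), rfl⟩

lemma Indep.mono {m s s' : ℕ} (h : Indep m s G) (hs : s' ≤ s) : Indep m s' G := by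
  obtain ⟨y, h0, hi⟩ := h
  refine ⟨fun j => y (Fin.castLE hs j), fun j => h0 _, ?_⟩
  intro c hc j
  have := hi (fun i => if h : (i : ℕ) < s' then c ⟨i, h⟩ else 0) (by
    rw [← hc]
    symm
    apply Finset.sum_of_injOn (Fin.castLE hs)
    · exact (Fin.castLE_injective hs).injOn
    · simp
    · intro i _ hi
      have : ¬ (i:ℕ) < s' := by
        intro h
        apply hi
        exact ⟨⟨i, h⟩, by simp, by ext; simp⟩
      simp [this]
    · intro i _
      simp) (Fin.castLE hs j)
  simpa using this

lemma lcn_hsm {S : Set G} {d : ℕ} (hd : 1 ≤ d) (hC : Cong S d) (hL : LCN S)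
    (hord : ∀ g ∈ S, addOrderOf g ≤ d + 2) :
    ∀ B : Multiset G, Over S B → B.sum = 0 → B.toFinset.card ≤ d + 1 → HF1 B := by
  intro B hB hs hc
  have hsub : ((B.toFinset : Finset G) : Set G) ⊆ S := fun g hg => hB g (by simpa using hg)
  exact small_hf hd B.toFinset hc (hC.mono hsub) (hL.mono hsub)
    (fun g hg => hord g (hsub (by simpa using hg))) (fun g hg => by simpa using hg) hs

lemma ann (x : ℚ) (d : ℕ) (hd : 1 ≤ d) :
    ∃ m : ℕ, 1 ≤ m ∧ ∀ j : ℤ, (∃ z : ℤ, (j:ℚ) * x = d * z) ↔ (m:ℤ) ∣ j := by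
  let I : AddSubgroup ℤ :=
    { carrier := {j | ∃ z : ℤ, (j:ℚ) * x = d * z}
      zero_mem' := ⟨0, by simp⟩
      add_mem' := by
        rintro a b ⟨z, hz⟩ ⟨z', hz'⟩
        exact ⟨z + z', by push_cast; linear_combination hz + hz'⟩
      neg_mem' := by
        rintro a ⟨z, hz⟩
        exact ⟨-z, by push_cast; linear_combination -hz⟩ }
  obtain ⟨a, ha⟩ := Int.subgroup_cyclic I
  have hI : ∀ j : ℤ, (∃ z : ℤ, (j:ℚ) * x = d * z) ↔ a ∣ j := by
    intro j
    change j ∈ I ↔ _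
    rw [ha, AddSubgroup.mem_closure_singleton]
    constructor
    · rintro ⟨n, rfl⟩; exact ⟨n, by simp [mul_comm]⟩
    · rintro ⟨n, rfl⟩; exact ⟨n, by simp [mul_comm]⟩
  refine ⟨a.natAbs, ?_, fun j => by rw [hI j, Int.natAbs_dvd]⟩
  by_contra h0
  have ha0 : a = 0 := by omega
  have := (hI (x.den * d)).1 ⟨x.num, by
    push_cast
    have := Rat.den_mul_eq_num x
    linear_combination (d:ℚ) * this⟩
  rw [ha0, zero_dvd_iff] at this
  have h1 := x.den_pos
  have : x.den * d = 0 := by exact_mod_cast this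
  have : 0 < x.den * d := Nat.mul_pos h1 hd
  omega

lemma mA {S : Set G} {d : ℕ} (hd : 1 ≤ d) (hC : Cong S d) (hL : LCN S)
    (hord : ∀ g ∈ S, addOrderOf g ≤ d + 2) {A : Multiset G} (hO : Over S A) (hA : Atom A) :
    ∃ m : ℕ, 1 ≤ m ∧ (∃ z : ℤ, (m:ℚ) * (kq A - 1) = d * z) ∧
      ∀ p b : ℕ, p.Prime → 1 ≤ b → p ^ b ∣ m → ∃ y : Fin (d + 1) → G,
        (∀ j, y j ∈ AddSubgroup.closure S) ∧ (∀ j, p ^ b • y j = 0) ∧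
        ∀ c : Fin (d + 1) → ℤ, ∑ j, c j • y j = 0 → ∀ j, ((p ^ b : ℕ) : ℤ) ∣ c j := by
  obtain ⟨m, hm, hmj⟩ := ann (kq A - 1) d hd
  refine ⟨m, hm, by simpa using (hmj m).2 dvd_rfl, ?_⟩
  intro p b hp hb hpb
  obtain ⟨i, rfl⟩ : ∃ i, b = i + 1 := ⟨b - 1, by omega⟩
  have hsub : ((A.toFinset : Finset G) : Set G) ⊆ S := fun g hg => hO g (by simpa using hg)
  rcases PB hp A.toFinset i d with ⟨E, hE, hEc, c, hc, ht⟩ | ⟨y, h1, h2, h3⟩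
  · exfalso
    have h1 := lemmaM hC (lcn_hsm hd hC hL hord) hO (Fac.single hA) E
      (fun g hg => hsub (by simpa using hE hg)) hEc (c * p ^ i) (fun t htA => ht t (by simpa using htA))
    have h2 := (hmj ((c * p ^ i : ℕ) : ℤ)).1 (by simpa using h1)
    have h3 : m ∣ c * p ^ i := by exact_mod_cast h2
    have h4 := hpb.trans h3
    rw [pow_succ, mul_comm c] at h4
    have h5 := Nat.dvd_of_mul_dvd_mul_left (pow_pos hp.pos i) h4
    have h6 := Nat.Coprime.eq_one_of_dvd hc.symm h5
    exact hp.one_lt.ne' h6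
  · exact ⟨y, fun j => AddSubgroup.closure_mono hsub (h1 j), h2, h3⟩

lemma kq_one_of_m {A : Multiset G} {d : ℕ} (h1 : 1 ≤ kq A) (h2 : kq A < d + 1)
    (h : ∃ z : ℤ, ((1:ℕ):ℚ) * (kq A - 1) = d * z) : kq A = 1 := by
  obtain ⟨z, hz⟩ := h
  have hd : (0:ℚ) < d := by linarith
  push_cast at hz
  rw [one_mul] at hz
  have h3 : (z:ℚ) < 1 := by
    by_contra hc; push Not at hc
    nlinarith
  have h4 : (0:ℚ) ≤ z := by
    by_contra hc; push Not at hc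
    nlinarith
  have h5 : z = 0 := by
    have : z < 1 := by exact_mod_cast h3
    have : 0 ≤ z := by exact_mod_cast h4
    omega
  rw [h5] at hz; simp at hz; linarith

lemma hf_all {S : Set G} {d : ℕ} (hd : 1 ≤ d) (hC : Cong S d) (hL : LCN S)
    (hord : ∀ g ∈ S, addOrderOf g ≤ d + 2) (hk : ∀ A, Over S A → Atom A → kq A < d + 1)
    (hI : ∀ p : ℕ, p.Prime → ¬ ∃ y : Fin (d + 1) → G, (∀ j, y j ∈ AddSubgroup.closure S) ∧
      (∀ j, p • y j = 0) ∧ ∀ c : Fin (d + 1) → ℤ, ∑ j, c j • y j = 0 → ∀ j, (p : ℤ) ∣ c j)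
    {A : Multiset G} (hO : Over S A) (hA : Atom A) : kq A = 1 := by
  obtain ⟨m, hm, hz, hp⟩ := mA hd hC hL hord hO hA
  have hm1 : m = 1 := by
    by_contra hne
    obtain ⟨p, hpp, hpm⟩ := Nat.exists_prime_and_dvd hne
    have := hp p 1 hpp le_rfl (by simpa using hpm)
    simp only [pow_one] at this
    exact hI p hpp this
  subst hm1
  exact kq_one_of_m (hL A hO hA) (hk A hO hA) hz

end basic

section homog2

variable {G : Type*} [AddCommGroup G] [Finite G] {p k r : ℕ}

lemma Homog.hf (h : Homog G p k r) (hr : 2 ≤ r) (hn : p ^ k ≤ r + 1) {S : Set G} {d : ℕ}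
    (hd : r ≤ d) (hC : Cong S d) {A : Multiset G} (hO : Over S A) (hA : Atom A) : kq A = 1 := by
  have h2 := h.two_le
  have hrd : (r:ℚ) ≤ d := by exact_mod_cast hd
  refine hf_all (by omega) hC (lcn_small hC (N := p ^ k) (by omega) (fun g _ => h.tors g) (by omega))
    (fun g _ => ?_) (fun A _ hA => ?_) ?_ hO hA
  · have := Nat.le_of_dvd (by omega) (addOrderOf_dvd_of_nsmul_eq_zero (h.tors g))
    omega
  · have := h.kq_lt hr hA
    linarith
  · rintro q hq ⟨y, -, h1, h3⟩
    have : Indep q (d + 1) G := ⟨y, h1, h3⟩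
    exact h.not_indep hr hq (this.mono (by omega))

lemma Homog.no_family (h : Homog G p k r) (hr : 2 ≤ r) (hn : p ^ k ≤ r + 1) {d x0 y0 : ℕ}
    (hd : r ≤ d) (hF : Family G d x0 y0) : y0 ≤ x0 := by
  obtain ⟨S, hC, hw⟩ := extraction hF
  have := hw (fun g => 1 / (addOrderOf g : ℚ)) 1 (fun g => by positivity) (by norm_num) (by
    intro A hO hA
    have := h.hf hr hn hd hC hO hA
    change 1 ≤ kq A ∧ kq A ≤ 1
    rw [this]; simp)
  rw [one_mul] at this
  exact_mod_cast this

variable {G' : Type*} [AddCommGroup G'] [Finite G']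

lemma Homog.not_indep' (h : Homog G p k r) (hr : 2 ≤ r) (hn : p ^ k ≤ r + 1)
    (hL : systemL (Set.univ : Set G) = systemL (Set.univ : Set G')) {q : ℕ} (hq : 2 ≤ q) :
    ¬ Indep q (r + 1) G' := by
  intro hI
  have h1 := h.no_family hr hn (le_refl r) ((fam_indep hq (by omega) hI).transfer hL.symm)
  have : q - 1 < (r + 1) * (q - 1) := by nlinarith [show 1 ≤ q - 1 by omega]
  omega

lemma Homog.ord_le' (h : Homog G p k r) (hr : 2 ≤ r) (hn : p ^ k ≤ r + 1)
    (hL : systemL (Set.univ : Set G) = systemL (Set.univ : Set G')) (g : G') :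
    addOrderOf g ≤ r + 1 := by
  by_contra hc
  have h1 := h.no_family hr hn (show r ≤ addOrderOf g - 2 by omega)
    ((fam_pair (by omega)).transfer hL.symm)
  omega

lemma hom_of_tors {n r : ℕ} (y : Fin r → G') (hy : ∀ j, n • y j = 0) :
    ∃ φ : (Fin r → ZMod n) →+ G', ∀ c : Fin r → ℤ, φ (fun j => (c j : ZMod n)) = ∑ j, c j • y j := by
  let f : ∀ j, ZMod n →+ G' := fun j => ZMod.lift n ⟨zmultiplesHom G' (y j), by simp [hy]⟩
  refine ⟨∑ j, (f j).comp (Pi.evalAddMonoidHom _ j), fun c => ?_⟩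
  rw [AddMonoidHom.finset_sum_apply]
  refine Finset.sum_congr rfl fun j _ => ?_
  simp [f]

lemma iso_of_indep {n : ℕ} (φ : G ≃+ (Fin r → ZMod n))
    (hD : davenport G = davenport G') (hI : Indep n r G') : Nonempty (G ≃+ G') := by
  obtain ⟨y, h0, hi⟩ := hI
  obtain ⟨ψ, hψ⟩ := hom_of_tors y h0
  have hinj : Function.Injective ψ := by
    rw [injective_iff_map_eq_zero]
    intro x hx
    have hxc : x = fun j => (((x j).cast : ℤ) : ZMod n) := by ext j; simp
    rw [hxc, hψ] at hx
    ext j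
    have := hi _ hx j
    rw [hxc]
    exact (ZMod.intCast_zmod_eq_zero_iff_dvd _ _).2 this
  have hinj' : Function.Injective (ψ.comp φ.toAddMonoidHom) := hinj.comp φ.injective
  have hsurj : Function.Surjective (ψ.comp φ.toAddMonoidHom) := by
    by_contra hc
    have := dav_inj _ hinj' hc
    omega
  exact ⟨AddEquiv.ofBijective _ ⟨hinj', hsurj⟩⟩

lemma iso_of_gen {n : ℕ} (φ : G ≃+ (Fin r → ZMod n))
    (hD : davenport G = davenport G') (y : Fin r → G') (h0 : ∀ j, n • y j = 0)
    (hg : AddSubgroup.closure (Set.range y) = ⊤) : Nonempty (G ≃+ G') := by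
  obtain ⟨ψ, hψ⟩ := hom_of_tors y h0
  have hsurj : Function.Surjective ψ := by
    rw [← AddMonoidHom.range_eq_top, eq_top_iff, ← hg, AddSubgroup.closure_le]
    rintro _ ⟨j, rfl⟩
    refine ⟨fun i => (((if i = j then 1 else 0 : ℤ)) : ZMod n), ?_⟩
    rw [hψ]
    simp
  have hsurj' : Function.Surjective (ψ.comp φ.toAddMonoidHom) := hsurj.comp φ.surjective
  have hinj' : Function.Injective (ψ.comp φ.toAddMonoidHom) := by
    rw [injective_iff_map_eq_zero]
    intro x hx
    by_contra hc
    have := dav_surj _ hsurj' hx hc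
    omega
  exact ⟨AddEquiv.ofBijective _ ⟨hinj', hsurj'⟩⟩

/-- the case of an LCN-set in `G'` -/
lemma lcn_case {n r : ℕ} (hn : 2 ≤ n) (hr : 2 ≤ r) (hD : davenport G' = r * (n - 1) + 1)
    (hord : ∀ g : G', addOrderOf g ≤ r + 1) {S : Set G'} (hC : Cong S (r - 1)) (hL : LCN S)
    (hk : ∀ A, Over S A → Atom A → kq A < r)
    (hw : ∀ (w : G' → ℚ) (κ : ℚ), (∀ g, 0 ≤ w g) → 0 ≤ κ →
      (∀ A, Over S A → Atom A → 1 ≤ wt w A ∧ wt w A ≤ κ) →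
        ((1 + r * (n - 1) : ℕ) : ℚ) ≤ κ * n) : Indep n r G' := by
  by_contra hI
  obtain ⟨d, rfl⟩ : ∃ d, r = d + 1 := ⟨r - 1, by omega⟩
  obtain ⟨n, rfl⟩ : ∃ n', n = n' + 2 := ⟨n - 2, by omega⟩
  simp only [Nat.add_sub_cancel] at hC
  have hd : 1 ≤ d := by omega
  have hd' : (1:ℚ) ≤ d := by exact_mod_cast hd
  have := hw (fun g => 1 / (addOrderOf g : ℚ)) (1 + d * n / (n + 1)) (fun g => by positivity)
    (by positivity) (by
    intro A hO hA
    change 1 ≤ kq A ∧ kq A ≤ _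
    refine ⟨hL A hO hA, ?_⟩
    obtain ⟨m, hm, ⟨z, hz⟩, hp⟩ := mA hd hC hL (fun g _ => by have := hord g; omega) hO hA
    have hIm : Indep m (d + 1) G' := indep_of_prime_pow m (by omega) fun p b hpp hb hd => by
      obtain ⟨y, -, h1, h2⟩ := hp p b hpp hb hd
      exact ⟨y, h1, h2⟩
    have hmn : m ≤ n + 1 := by
      by_contra hc
      have h1 := indep_dav (by omega) (by omega) hIm
      rw [hD] at h1
      have h2 : m - 1 ≤ n + 1 := by
        have : (d + 1) * (m - 1) ≤ (d + 1) * (n + 2 - 1) := by omega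
        exact Nat.le_of_mul_le_mul_left this (by omega)
      have : m = n + 2 := by omega
      subst this
      exact hI hIm
    have hk1 := hk A hO hA
    push_cast at hk1
    have hm' : (1:ℚ) ≤ m := by exact_mod_cast hm
    have hmn' : (m:ℚ) ≤ n + 1 := by exact_mod_cast hmn
    have hz1 : (z:ℚ) < m := by
      by_contra hc; push Not at hc
      nlinarith
    have hz2 : (z:ℚ) ≤ m - 1 := by
      have : z < m := by exact_mod_cast hz1
      have : z ≤ m - 1 := by omega
      exact_mod_cast this
    have h5 : kq A - 1 ≤ d * n / (n + 1) := by
      rw [le_div_iff₀ (by positivity)]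
      have h6 : (m:ℚ) * (kq A - 1) ≤ d * (m - 1) := by rw [hz]; nlinarith
      have h7 : (m:ℚ) * ((kq A - 1) * (n + 1)) ≤ m * (d * n) := by nlinarith
      exact le_of_mul_le_mul_left h7 (by linarith)
    linarith)
  push_cast [show n + 2 - 1 = n + 1 by omega] at this
  have hn0 : (0:ℚ) ≤ n := by positivity
  have h1 : (1 + (d + 1) * (n + 1) : ℚ) * (n + 1) ≤ ((n + 1) + d * n) * (n + 2) := by
    have e : ((1 + d * n / (n + 1)) * (n + 2) : ℚ) * (n + 1) = ((n + 1) + d * n) * (n + 2) := by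
      field_simp
    rw [← e]
    exact mul_le_mul_of_nonneg_right (by linarith) (by linarith)
  nlinarith

end homog2

end LSys

namespace LSys

section mixing

variable {G : Type*} [AddCommGroup G] [Finite G]

lemma decomp (A : Multiset G) (g : G) :
    A = Multiset.replicate (A.count g) g + A.filter (fun x => x ≠ g) := by
  ext x
  rw [Multiset.count_add, Multiset.count_replicate, Multiset.count_filter]
  by_cases h : x = g
  · subst h; simp
  · simp [h, Ne.symm h]

lemma sum_map_cons (x : G) (M : Multiset (Multiset G)) :
    (M.map (fun Y => x ::ₘ Y)).sum = Multiset.replicate (Multiset.card M) x + M.sum := by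
  induction M using Multiset.induction with
  | empty => simp
  | cons a s ih =>
    rw [Multiset.map_cons, Multiset.sum_cons, ih, Multiset.sum_cons, Multiset.card_cons,
      Multiset.replicate_succ]
    simp only [← Multiset.singleton_add]
    abel

lemma mix_exists {g : G} {E : Set G} (hgE : g ∉ E) {m : ℤ}
    (hm : m • g ∈ AddSubgroup.closure E) (hm0 : m • g ≠ 0) :
    ∃ (a : ℕ) (F : Multiset G), 1 ≤ a ∧ Over E F ∧ F ≠ 0 ∧
      Atom (Multiset.replicate a g + F) := by
  obtain ⟨Y, hY, hs⟩ := closure_repr E (AddSubgroup.neg_mem _ hm)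
  have hN := ord_pos g
  have hb0 : 0 ≤ m % (addOrderOf g : ℤ) := Int.emod_nonneg _ (by omega)
  have hb1 : m % (addOrderOf g : ℤ) < addOrderOf g := Int.emod_lt_of_pos _ (by omega)
  obtain ⟨b, hb⟩ := Int.eq_ofNat_of_zero_le hb0
  have hbg : b • g = m • g := by
    rw [← natCast_zsmul, ← hb, mod_addOrderOf_zsmul]
  have hb2 : b ≠ 0 := by rintro rfl; rw [← hbg] at hm0; simp at hm0
  have hsum : (Multiset.replicate b g + Y).sum = 0 := by
    rw [Multiset.sum_add, Multiset.sum_replicate, hs, hbg]; abel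
  obtain ⟨A, hA, hAB, hgA⟩ := exists_atom_mem hsum (g := g)
    (Multiset.mem_add.2 (Or.inl (Multiset.mem_replicate.2 ⟨hb2, rfl⟩)))
  have hgY : g ∉ Y := fun h => hgE (hY g h)
  have hc : A.count g ≤ b := by
    have := Multiset.count_le_of_le g hAB
    rwa [Multiset.count_add, Multiset.count_replicate_self, Multiset.count_eq_zero_of_notMem hgY,
      add_zero] at this
  have hc1 : 1 ≤ A.count g := Multiset.one_le_count_iff_mem.2 hgA
  refine ⟨A.count g, A.filter (fun x => x ≠ g), hc1, ?_, ?_, by rwa [← decomp]⟩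
  · intro x hx
    rw [Multiset.mem_filter] at hx
    have := Multiset.mem_of_le hAB hx.1
    rw [Multiset.mem_add] at this
    rcases this with h | h
    · exact absurd (Multiset.eq_of_mem_replicate h) hx.2
    · exact hY x h
  · intro h0
    have h1 := hA.sum
    rw [decomp A g, h0, add_zero, Multiset.sum_replicate] at h1
    have := Nat.le_of_dvd hc1 (addOrderOf_dvd_of_nsmul_eq_zero h1)
    omega

variable {S : Set G} {d N : ℕ} {g : G}

lemma ne_neg_of_ord (h3 : 3 ≤ addOrderOf g) : g ≠ -g := by
  intro h
  have h1 : 2 • g = 0 := by rw [two_nsmul]; nth_rewrite 2 [h]; simp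
  have := Nat.le_of_dvd (by norm_num) (addOrderOf_dvd_of_nsmul_eq_zero h1)
  omega

lemma mix (hC : Cong S d) (hNd : N = d + 2) (hd : 1 ≤ d) (hg : g ∈ S) (hg' : -g ∈ S)
    (ho : addOrderOf g = N) {a : ℕ} {F : Multiset G} (ha : 1 ≤ a) (hF : Over S F) (hF0 : F ≠ 0)
    (h1 : g ∉ F) (h2 : -g ∉ F) (hA : Atom (Multiset.replicate a g + F)) :
    a < N ∧ ((a = 1 ∧ Atom (Multiset.replicate (N - 1) (-g) + F)) ∨
      ∃ M : Multiset (Multiset G), Multiset.card M = N - a ∧ M.sum = F ∧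
        ∀ Y ∈ M, Atom (-g ::ₘ Y)) := by
  have hgn : g ≠ -g := ne_neg_of_ord (by omega)
  have hg0 : g ≠ 0 := by rintro rfl; simp at ho; omega
  have hga : g ∈ Multiset.replicate a g + F :=
    Multiset.mem_add.2 (Or.inl (Multiset.mem_replicate.2 ⟨by omega, rfl⟩))
  have haN : a < N := by
    have hne : Multiset.replicate a g + F ≠ rep g := by
      intro h
      obtain ⟨f, hf⟩ := Multiset.exists_mem_of_ne_zero hF0
      have : f ∈ rep g := by rw [← h]; simp [hf]
      have := Multiset.eq_of_mem_replicate this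
      subst this; exact h1 hf
    have := hA.count_lt hne
    rwa [Multiset.count_add, Multiset.count_replicate_self, Multiset.count_eq_zero_of_notMem h1, ho,
      add_zero] at this
  refine ⟨haN, ?_⟩
  have hsA := hA.sum
  rw [Multiset.sum_add, Multiset.sum_replicate] at hsA
  have hNg : N • g = 0 := by rw [← ho]; exact addOrderOf_nsmul_eq_zero g
  have hs' : (Multiset.replicate (N - a) (-g) + F).sum = 0 := by
    rw [Multiset.sum_add, Multiset.sum_replicate, ← hsA]
    have : (N - a) • g + a • g = 0 := by rw [← add_nsmul, Nat.sub_add_cancel haN.le, hNg]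
    rw [smul_neg, neg_eq_of_add_eq_zero_right this]
  obtain ⟨F', hF'⟩ := exists_fac _ hs'
  have hmem : ∀ B ∈ F', -g ∈ B := by
    intro B hB
    by_contra hn
    have hle := hF'.le hB
    have hBF : B ≤ F := by
      rw [Multiset.le_iff_count] at hle ⊢
      intro x
      have := hle x
      by_cases hx : x = -g
      · subst hx; rw [Multiset.count_eq_zero_of_notMem hn]; exact Nat.zero_le _
      · rwa [Multiset.count_add, Multiset.count_replicate, if_neg (fun h => hx h.symm), zero_add] at this
    have := hA.min (hBF.trans (Multiset.le_add_left _ _)) (hF'.atom hB).sum (hF'.atom hB).ne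
    rw [← this] at hga
    exact h1 (Multiset.mem_of_le hBF hga)
  set M := F'.map (fun B => B.erase (-g)) with hM
  have hMF : M.map (fun Y => -g ::ₘ Y) = F' := by
    rw [hM, Multiset.map_map]
    conv_rhs => rw [← Multiset.map_id F']
    refine Multiset.map_congr rfl fun B hB => ?_
    simp [Multiset.cons_erase (hmem B hB)]
  have hsum := sum_map_cons (-g) M
  rw [hMF, hF'.2] at hsum
  have hcM : Multiset.card M = Multiset.card F' := by simp [hM]
  have hle : Multiset.card F' ≤ N - a := by
    have := congrArg (Multiset.count (-g)) hsum
    rw [Multiset.count_add, Multiset.count_add, Multiset.count_replicate_self,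
      Multiset.count_replicate_self, Multiset.count_eq_zero_of_notMem h2, hcM] at this
    omega
  have hpos : 1 ≤ Multiset.card F' := hF'.pos (by
    intro h
    obtain ⟨f, hf⟩ := Multiset.exists_mem_of_ne_zero hF0
    have : f ∈ (0 : Multiset G) := by rw [← h]; simp [hf]
    simp at this)
  -- length congruence
  have hf1 : Fac ({Multiset.replicate a g + F} + {rep (-g)})
      ((Multiset.replicate a g + F) + rep (-g)) :=
    (Fac.single hA).add (Fac.single (rep_atom _))
  have hf2 : Fac (a • {{g, -g}} + F') (a • {g, -g} + (Multiset.replicate (N - a) (-g) + F)) :=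
    ((Fac.single (atom_pair hg0)).nsmul a).add hF'
  have heq : a • {g, -g} + (Multiset.replicate (N - a) (-g) + F) =
      (Multiset.replicate a g + F) + rep (-g) := by
    rw [rep, addOrderOf_neg, ho, show ({g, -g} : Multiset G) = {g} + {-g} from rfl, nsmul_add,
      Multiset.nsmul_singleton, Multiset.nsmul_singleton]
    conv_rhs => rw [← Nat.add_sub_cancel' haN.le, Multiset.replicate_add]
    abel
  rw [heq] at hf2
  have hO : Over S ((Multiset.replicate a g + F) + rep (-g)) :=
    ((over_replicate hg a).add hF).add (over_rep hg')
  have hcong := hC _ hO _ _ hf2 hf1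
  simp only [Multiset.card_add, Multiset.card_nsmul, Multiset.card_singleton, mul_one] at hcong
  by_cases hc2 : a + Multiset.card F' = 2
  · left
    have h3 : a = 1 := by omega
    subst h3
    exact ⟨rfl, hF'.atom_of_card (by omega)⟩
  · right
    have h3 := int_gap hcong (by push_cast; omega)
    have h4 : Multiset.card F' = N - a := by push_cast at h3; omega
    refine ⟨M, by omega, ?_, ?_⟩
    · rw [hcM, h4] at hsum
      exact (add_left_cancel hsum).symm
    · intro Y hY
      apply hF'.atom
      rw [← hMF]
      exact Multiset.mem_map_of_mem _ hY

/-- elementary mixing sequences -/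
def Mx (N : ℕ) (g : G) (F : Multiset G) : Prop :=
  g ∉ F ∧ -g ∉ F ∧ Atom (-g ::ₘ F) ∧ Atom (Multiset.replicate (N - 1) g + F)

lemma mix2 (hC : Cong S d) (hNd : N = d + 2) (hd : 1 ≤ d) (hg : g ∈ S) (hg' : -g ∈ S)
    (ho : addOrderOf g = N) {a : ℕ} {F : Multiset G} (ha : 1 ≤ a) (hF : Over S F) (hF0 : F ≠ 0)
    (h1 : g ∉ F) (h2 : -g ∉ F) (hA : Atom (Multiset.replicate a g + F)) :
    a < N ∧ ((a = 1 ∧ Mx N (-g) F) ∨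
      ∃ M : Multiset (Multiset G), Multiset.card M = N - a ∧ M.sum = F ∧
        ∀ Y ∈ M, Mx N g Y) := by
  obtain ⟨haN, h⟩ := mix hC hNd hd hg hg' ho ha hF hF0 h1 h2 hA
  refine ⟨haN, ?_⟩
  rcases h with ⟨rfl, h⟩ | ⟨M, hMc, hMs, hM⟩
  · left
    refine ⟨rfl, h2, by simpa using h1, ?_, h⟩
    simpa using hA
  · right
    refine ⟨M, hMc, hMs, fun Y hY => ?_⟩
    have hYF : Y ≤ F := hMs ▸ le_sum_of_mem hY
    have hg1 : g ∉ Y := fun h => h1 (Multiset.mem_of_le hYF h)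
    have hg2 : -g ∉ Y := fun h => h2 (Multiset.mem_of_le hYF h)
    have hg0 : g ≠ 0 := by rintro rfl; simp at ho; omega
    have hY0 : Y ≠ 0 := by
      rintro rfl
      have := (hM 0 hY).sum
      simp at this
      exact hg0 this
    refine ⟨hg1, hg2, hM Y hY, ?_⟩
    obtain ⟨-, h⟩ := mix (g := -g) hC hNd hd hg' (by simpa using hg) (by simpa using ho) (a := 1)
      le_rfl (hF.le hYF) hY0 hg2 (by simpa using hg1) (by simpa using hM Y hY)
    rcases h with ⟨-, h⟩ | ⟨M', hMc', hMs', hM'⟩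
    · simpa using h
    · exfalso
      obtain ⟨Z, hZ⟩ : ∃ Z, Z ∈ M' := Multiset.card_pos_iff_exists_mem.1 (by omega)
      obtain ⟨M'', rfl⟩ := Multiset.exists_cons_of_mem hZ
      obtain ⟨W, hW⟩ : ∃ Z, Z ∈ M'' := Multiset.card_pos_iff_exists_mem.1 (by
        rw [Multiset.card_cons] at hMc'; omega)
      have hZa := hM' Z hZ
      have hWa := hM' W (by simp [hW])
      rw [neg_neg] at hZa hWa
      have hW0 : W ≠ 0 := by
        rintro rfl
        have := hWa.sum
        simp at this
        exact hg0 this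
      rw [Multiset.sum_cons] at hMs'
      have hle : g ::ₘ Z ≤ Multiset.replicate a g + F := by
        rw [← Multiset.singleton_add]
        apply add_le_add
        · rw [Multiset.singleton_le]; exact Multiset.mem_replicate.2 ⟨by omega, rfl⟩
        · exact le_trans (hMs' ▸ Multiset.le_add_right _ _) hYF
      have := congrArg Multiset.card (hA.min hle hZa.sum hZa.ne)
      have c1 := congrArg Multiset.card hMs'
      have c2 := Multiset.card_le_card hYF
      have c3 := Multiset.card_le_card (le_sum_of_mem hW)
      have c4 := Multiset.card_pos.2 hW0
      simp at this c1
      omega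

end mixing

end LSys

namespace LSys

section mixing2

variable {G : Type*} [AddCommGroup G] [Finite G] {S : Set G} {d N : ℕ} {g : G}

lemma lcn_insert (hC : Cong S d) (hNd : N = d + 2) (hd : 1 ≤ d) (hS : ∀ g ∈ S, N • g = 0)
    (hg : g ∈ S) (ho : addOrderOf g = N) {E : Finset G} (hE : ∀ e ∈ E, e ∈ S) {p : ℕ}
    (hind : ∀ e ∈ E, ∀ c : ℤ, IsCoprime c (p:ℤ) →
        c • e ∉ AddSubgroup.closure ((E.erase e : Finset G) : Set G)) (hgE : -g ∉ E) :
    LCN (insert g (E : Set G)) := by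
  have hsub : insert g (E : Set G) ⊆ S := by
    intro x hx
    rcases hx with rfl | hx
    · exact hg
    · exact hE x hx
  intro A hO hA
  by_contra hk
  push Not at hk
  obtain ⟨h, h1, h2, h3, -⟩ := pair_of_small (hC.mono hsub) (N := N) (by omega)
    (fun x hx => hS x (hsub hx)) hNd hO hA hk
  have hgn : g ≠ -g := ne_neg_of_ord (by omega)
  have hhn : h ≠ -h := ne_neg_of_ord (by omega)
  rcases h1 with rfl | h1
  · rcases h2 with h2 | h2
    · exact hgn h2.symm
    · exact hgE h2
  · rcases h2 with h2 | h2
    · apply hgE; rw [← h2, neg_neg]; exact h1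
    · apply hind h h1 1 isCoprime_one_left
      rw [one_smul, ← neg_neg h]
      apply AddSubgroup.neg_mem
      rw [neg_neg]
      exact AddSubgroup.subset_closure (by
        simp only [Finset.coe_erase, Set.mem_diff, Set.mem_singleton_iff]
        exact ⟨h2, fun h => hhn h.symm⟩)

/-- a `p`-independent subset of the support carrying an elementary mixing sequence -/
lemma mx_exists (hC : Cong S d) (hNd : N = d + 2) (hd : 1 ≤ d) (hg : g ∈ S) (hg' : -g ∈ S)
    (ho : addOrderOf g = N) {E : Finset G} (hE : ∀ e ∈ E, e ∈ S) (h1 : g ∉ E) (h2 : -g ∉ E)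
    {m : ℤ} (hm : m • g ∈ AddSubgroup.closure (E : Set G)) (hm0 : m • g ≠ 0) :
    ∃ F, Over (E : Set G) F ∧ (Mx N g F ∨ Mx N (-g) F) := by
  obtain ⟨a, F, ha, hF, hF0, hA⟩ := mix_exists (by simpa using h1) hm hm0
  obtain ⟨haN, h⟩ := mix2 hC hNd hd hg hg' ho ha (hF.mono hE) hF0
    (fun h => h1 (by simpa using hF _ h)) (fun h => h2 (by simpa using hF _ h)) hA
  rcases h with ⟨-, h⟩ | ⟨M, hMc, hMs, hM⟩
  · exact ⟨F, hF, Or.inr h⟩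
  · obtain ⟨Z, hZ⟩ : ∃ Z, Z ∈ M := Multiset.card_pos_iff_exists_mem.1 (by omega)
    exact ⟨Z, hF.le (hMs ▸ le_sum_of_mem hZ), Or.inl (hM Z hZ)⟩

lemma coprime_smul_ne {p : ℕ} {x : G} (hp : p.Prime) (hx : p ∣ addOrderOf x) {c : ℕ}
    (hc : c.Coprime p) : c • x ≠ 0 := by
  intro h
  have h1 := hx.trans (addOrderOf_dvd_of_nsmul_eq_zero h)
  have := Nat.Coprime.eq_one_of_dvd hc.symm h1
  exact hp.one_lt.ne' this

lemma mixing_basis (hNI : ∀ p : ℕ, p.Prime → ¬ Indep p (d + 2) G)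
    {a : ℕ} {F : Multiset G} {x : G} (hx : x ≠ 0) (hs : F.sum = x) :
    ∃ (p : ℕ) (E : Finset G) (c : ℕ), p.Prime ∧ E ⊆ F.toFinset ∧ E.card ≤ d + 1 ∧
      p ∣ addOrderOf x ∧ c • x ≠ 0 ∧ c • x ∈ AddSubgroup.closure (E : Set G) ∧
      c.Coprime p ∧
      ∀ e ∈ E, ∀ c : ℤ, IsCoprime c (p:ℤ) →
        c • e ∉ AddSubgroup.closure ((E.erase e : Finset G) : Set G) := by
  have h1 : addOrderOf x ≠ 1 := by rwa [Ne, AddMonoid.addOrderOf_eq_one_iff]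
  obtain ⟨p, hp, hpx⟩ := Nat.exists_prime_and_dvd h1
  obtain ⟨E, hEs, hEc, ⟨c, hc, ht⟩, hind⟩ := PB0 hp F.toFinset (d + 1) (hNI p hp)
  refine ⟨p, E, c, hp, hEs, hEc, hpx, coprime_smul_ne hp hpx hc, ?_, hc, hind⟩
  have he : c • F.sum = (F.map fun t => c • t).sum := by
    rw [Multiset.sum_map_nsmul, Multiset.map_id']
  rw [← hs, he]
  apply AddSubgroup.multiset_sum_mem
  intro y hy
  obtain ⟨t, ht', rfl⟩ := Multiset.mem_map.1 hy
  exact ht t (by simpa using ht')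

lemma mx_kq (ho : addOrderOf g = N) (F : Multiset G) :
    kq (-g ::ₘ F) = 1 / N + kq F ∧
      kq (Multiset.replicate (N - 1) g + F) = ((N - 1 : ℕ) : ℚ) / N + kq F := by
  rw [kq_cons, kq_add, kq_replicate, addOrderOf_neg, ho]
  exact ⟨rfl, rfl⟩

lemma mx_contra (hC : Cong S d) (hNd : N = d + 2) (hd : 1 ≤ d) (hS : ∀ g ∈ S, N • g = 0)
    (hNN : ¬ Indep N (d + 1) G)
    (hg : g ∈ S) (hg' : -g ∈ S) (ho : addOrderOf g = N) {E : Finset G} (hE : ∀ e ∈ E, e ∈ S)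
    (h1 : g ∉ E) (h2 : -g ∉ E) {p : ℕ}
    (hind : ∀ e ∈ E, ∀ c : ℤ, IsCoprime c (p:ℤ) →
        c • e ∉ AddSubgroup.closure ((E.erase e : Finset G) : Set G))
    {F : Multiset G} (hF : Over (E : Set G) F) (hM : Mx N g F) : False := by
  obtain ⟨q, b, hq, hb, hqb, hI⟩ : ∃ q b : ℕ, q.Prime ∧ 1 ≤ b ∧ q ^ b ∣ N ∧
      ¬ Indep (q ^ b) (d + 1) G := by
    by_contra hc
    push Not at hc
    exact hNN (indep_of_prime_pow N (by omega) fun p b h1 h2 h3 => hc p b h1 h2 h3)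
  obtain ⟨i, rfl⟩ : ∃ i, b = i + 1 := ⟨b - 1, by omega⟩
  have key : ∀ h : G, h ∈ S → addOrderOf h = N → -h ∉ E → ∀ A : Multiset G,
      Over (insert h (E : Set G)) A → Atom A → ∃ c : ℕ, c.Coprime q ∧
        ∃ z : ℤ, ((c * q ^ i : ℕ) : ℚ) * (kq A - 1) = d * z := by
    intro h hhS hho hhE A hO hA
    have hsub : insert h (E : Set G) ⊆ S := by
      intro x hx
      rcases hx with rfl | hx
      · exact hhS
      · exact hE x hx
    have hL := lcn_insert hC hNd hd hS hhS hho hE hind hhE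
    obtain ⟨E', hE', hEc, c, hc, ht⟩ := PB' hq (insert h E) i d hI
    refine ⟨c, hc, ?_⟩
    have := lemmaM (hC.mono hsub) (lcn_hsm hd (hC.mono hsub) hL (fun x hx => by
        have := Nat.le_of_dvd (by omega) (addOrderOf_dvd_of_nsmul_eq_zero (hS x (hsub hx)))
        omega)) hO (Fac.single hA) E'
      (fun x hx => by simpa using hE' hx) hEc (c * q ^ i) (fun t htA => ht t (by simpa using hO t htA))
    simpa using this
  obtain ⟨c1, hc1, z1, hz1⟩ := key (-g) hg' (by simpa using ho) (by simpa using h1) (-g ::ₘ F)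
    (fun x hx => by
      rcases Multiset.mem_cons.1 hx with rfl | hx
      · exact Set.mem_insert _ _
      · exact Set.mem_insert_of_mem _ (hF x hx)) hM.2.2.1
  obtain ⟨c2, hc2, z2, hz2⟩ := key g hg ho h2 _
    ((over_replicate (Set.mem_insert _ _) _).add (hF.mono (Set.subset_insert _ _))) hM.2.2.2
  rw [(mx_kq ho F).1] at hz1
  rw [(mx_kq ho F).2] at hz2
  have hN0 : (0:ℚ) < N := by exact_mod_cast (by omega : 0 < N)
  have hNd' : ((N - 1 : ℕ) : ℚ) = d + 1 := by rw [hNd]; push_cast [show d + 2 - 1 = d + 1 by omega]; ring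
  have hd0 : (0:ℚ) < d := by exact_mod_cast hd
  rw [hNd'] at hz2
  have e1 : ((c1 * c2 * q ^ i : ℕ) : ℚ) = N * (c1 * z2 - c2 * z1) := by
    have : (d:ℚ) * ((c1 * c2 * q ^ i : ℕ) : ℚ) = d * (N * (c1 * z2 - c2 * z1)) := by
      have hx : ((d + 1 : ℚ) / N + kq F - 1) - (1 / N + kq F - 1) = d / N := by field_simp; ring
      have h3 : ((c1 * c2 * q ^ i : ℕ) : ℚ) * (d / N) = d * (c1 * z2 - c2 * z1) := by
        rw [← hx]
        push_cast at hz1 hz2 ⊢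
        linear_combination (c1:ℚ) * hz2 - c2 * hz1
      rw [mul_div_assoc', div_eq_iff hN0.ne'] at h3
      linarith
    exact mul_left_cancel₀ hd0.ne' this
  have e2 : ((c1 * c2 * q ^ i : ℕ) : ℤ) = N * (c1 * z2 - c2 * z1) := by exact_mod_cast e1
  have e3 : (N:ℤ) ∣ ((c1 * c2 * q ^ i : ℕ) : ℤ) := ⟨_, e2⟩
  have e4 : N ∣ c1 * c2 * q ^ i := by exact_mod_cast e3
  have e5 := hqb.trans e4
  rw [pow_succ, mul_comm (c1 * c2)] at e5
  have e6 := Nat.dvd_of_mul_dvd_mul_left (pow_pos hq.pos i) e5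
  exact hq.one_lt.ne' (Nat.Coprime.eq_one_of_dvd (Nat.Coprime.mul_left hc1 hc2).symm e6)

lemma mixing_contra (hC : Cong S d) (hNd : N = d + 2) (hd : 1 ≤ d) (hS : ∀ g ∈ S, N • g = 0)
    (hNI : ∀ p : ℕ, p.Prime → ¬ Indep p (d + 2) G) (hNN : ¬ Indep N (d + 1) G)
    (hg : g ∈ S) (hg' : -g ∈ S) (ho : addOrderOf g = N) {a : ℕ} {F : Multiset G} (ha : 1 ≤ a)
    (hF : Over S F) (hF0 : F ≠ 0) (h1 : g ∉ F) (h2 : -g ∉ F)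
    (hA : Atom (Multiset.replicate a g + F)) : False := by
  obtain ⟨haN, -⟩ := mix hC hNd hd hg hg' ho ha hF hF0 h1 h2 hA
  have hs : F.sum = (-(a:ℤ)) • g := by
    have := hA.sum
    rw [Multiset.sum_add, Multiset.sum_replicate] at this
    rw [neg_smul, natCast_zsmul]
    exact (neg_eq_of_add_eq_zero_right this).symm
  have hx : (-(a:ℤ)) • g ≠ 0 := by
    rw [neg_smul, natCast_zsmul, neg_ne_zero]
    intro h
    have := Nat.le_of_dvd ha (addOrderOf_dvd_of_nsmul_eq_zero h)
    omega
  obtain ⟨p, E, c, hp, hEF, hEc, -, hc0, hcE, -, hind⟩ := mixing_basis (a := a) hNI hx hs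
  have hE : ∀ e ∈ E, e ∈ F := fun e he => by simpa using hEF he
  rw [← natCast_zsmul, smul_smul] at hc0 hcE
  obtain ⟨F', hF', hM⟩ := mx_exists hC hNd hd hg hg' ho (E := E) (fun e he => hF e (hE e he))
    (fun h => h1 (hE _ h)) (fun h => h2 (hE _ h)) hcE hc0
  rcases hM with hM | hM
  · exact mx_contra hC hNd hd hS hNN hg hg' ho (fun e he => hF e (hE e he))
      (fun h => h1 (hE _ h)) (fun h => h2 (hE _ h)) hind hF' hM
  · exact mx_contra hC hNd hd hS hNN hg' (by simpa using hg) (by simpa using ho)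
      (fun e he => hF e (hE e he)) (fun h => h2 (hE _ h))
      (fun h => h1 (hE _ (by simpa using h))) hind hF' hM

/-- atoms in the non-mixing case -/
lemma nonmix_atoms (ho : addOrderOf g = N) (hN : 3 ≤ N)
    (hnm : ∀ (a : ℕ) (F : Multiset G), 1 ≤ a → Over S F → F ≠ 0 → g ∉ F → -g ∉ F →
      ¬ Atom (Multiset.replicate a g + F)) {A : Multiset G} (hO : Over S A) (hA : Atom A)
    (hgA : g ∈ A) : A = {g, -g} ∨ A = rep g := by
  have hgn : g ≠ -g := ne_neg_of_ord (by omega)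
  have hg0 : g ≠ 0 := by rintro rfl; simp at ho; omega
  by_cases h2 : -g ∈ A
  · left; exact atom_card_two hA hgA h2 (Or.inr hgn) hg0
  · right
    by_cases hF : A.filter (fun x => x ≠ g) = 0
    · apply hA.eq_rep
      have h1 := hA.sum
      rw [decomp A g, hF, add_zero, Multiset.sum_replicate] at h1
      exact Nat.le_of_dvd (Multiset.one_le_count_iff_mem.2 hgA) (addOrderOf_dvd_of_nsmul_eq_zero h1)
    · exfalso
      apply hnm (A.count g) (A.filter (fun x => x ≠ g)) (Multiset.one_le_count_iff_mem.2 hgA)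
        (hO.le (Multiset.filter_le _ _)) hF
      · simp
      · intro h; exact h2 (Multiset.mem_of_mem_filter h)
      · rwa [← decomp]

lemma nonlcn (hC : Cong S d) (hNd : N = d + 2) (hd : 1 ≤ d) (hS : ∀ g : G, N • g = 0)
    (hNI : ∀ p : ℕ, p.Prime → ¬ Indep p (d + 2) G) (hNN : ¬ Indep N (d + 1) G)
    (hk : ∀ A, Over S A → Atom A → kq A < d + 1) (hL : ¬ LCN S) :
    (∃ g : G, addOrderOf g = N) ∧
    ∃ w : G → ℚ, (∀ g, 0 ≤ w g) ∧ ∀ A, Over S A → Atom A → 1 ≤ wt w A ∧ wt w A ≤ N / 2 := by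
  have hN3 : (3:ℚ) ≤ N := by exact_mod_cast (by omega : 3 ≤ N)
  obtain ⟨A0, hO0, hA0, hk0⟩ : ∃ A, Over S A ∧ Atom A ∧ kq A < 1 := by
    unfold LCN at hL; push Not at hL; exact hL
  obtain ⟨g0, hg0, hg0', ho0, -⟩ := pair_of_small hC (by omega) (fun g _ => hS g) hNd hO0 hA0 hk0
  refine ⟨⟨g0, ho0⟩, ?_⟩
  let X : Set G := {g | g ∈ S ∧ -g ∈ S ∧ addOrderOf g = N}
  have hnm : ∀ g ∈ X, ∀ (a : ℕ) (F : Multiset G), 1 ≤ a → Over S F → F ≠ 0 → g ∉ F → -g ∉ F →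
      ¬ Atom (Multiset.replicate a g + F) := by
    intro g hg a F ha hF hF0 h1 h2 hA
    exact mixing_contra hC hNd hd (fun g _ => hS g) hNI hNN hg.1 hg.2.1 hg.2.2 ha hF hF0 h1 h2 hA
  have hat : ∀ g ∈ X, ∀ A, Over S A → Atom A → g ∈ A → A = {g, -g} ∨ A = rep g :=
    fun g hg A hO hA hgA => nonmix_atoms hg.2.2 (by omega) (hnm g hg) hO hA hgA
  have hXneg : ∀ g ∈ X, -g ∈ X := fun g hg =>
    ⟨hg.2.1, by simpa using hg.1, by simpa using hg.2.2⟩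
  let R : Set G := S \ X
  have hRS : R ⊆ S := Set.diff_subset
  have hLR : LCN R := by
    intro A hO hA
    by_contra hk
    push Not at hk
    obtain ⟨h, h1, h2, h3, -⟩ := pair_of_small (hC.mono hRS) (N := N) (by omega)
      (fun x _ => hS x) hNd hO hA hk
    exact h1.2 ⟨hRS h1, hRS h2, h3⟩
  have hord : ∀ g : G, addOrderOf g ≤ d + 2 := fun g => by
    have := Nat.le_of_dvd (by omega) (addOrderOf_dvd_of_nsmul_eq_zero (hS g))
    omega
  have hR1 : ∀ A, Over R A → Atom A → kq A = 1 := by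
    intro A hO hA
    refine hf_all hd (hC.mono hRS) hLR (fun g _ => hord g) (fun A hO hA => hk A (hO.mono hRS) hA) ?_
      hO hA
    rintro p hp ⟨y, hyR, hy0, hyi⟩
    apply hNI p hp
    have hpN : p ∣ N := by
      have hy1 : y 0 ≠ 0 := by
        intro h
        have := hyi (fun j => if j = 0 then 1 else 0) (by simp [h]) 0
        simp at this
        have h1 := Int.natAbs_dvd_natAbs.2 this
        simp at h1
        exact hp.one_lt.ne' h1
      have h1 : addOrderOf (y 0) ∣ p := addOrderOf_dvd_of_nsmul_eq_zero (hy0 0)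
      rcases (Nat.dvd_prime hp).1 h1 with h2 | h2
      · rw [AddMonoid.addOrderOf_eq_one_iff] at h2; exact absurd h2 hy1
      · rw [← h2]; exact addOrderOf_dvd_of_nsmul_eq_zero (hS _)
    obtain ⟨t, ht⟩ := hpN
    refine ⟨Fin.cons (t • g0) y, ?_, ?_⟩
    · intro j
      refine Fin.cases ?_ (fun j => ?_) j
      · simp only [Fin.cons_zero]; rw [smul_smul, ← ht]; exact hS _
      · simpa using hy0 j
    · intro c hc
      rw [Fin.sum_univ_succ] at hc
      simp only [Fin.cons_zero, Fin.cons_succ] at hc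
      have hmem : (c 0 * t) • g0 ∈ AddSubgroup.closure R := by
        have : (c 0 * t) • g0 = -∑ i : Fin (d + 1), c i.succ • y i := by
          rw [mul_smul, natCast_zsmul]
          exact eq_neg_of_add_eq_zero_left hc
        rw [this]
        apply AddSubgroup.neg_mem
        exact AddSubgroup.sum_mem _ fun i _ => AddSubgroup.zsmul_mem _ (hyR i) _
      have hgX : g0 ∈ X := ⟨hg0, hg0', ho0⟩
      have hz : (c 0 * t) • g0 = 0 := by
        by_contra hne
        obtain ⟨a, F, ha, hF, hF0, hA⟩ := mix_exists (E := R) (fun h => h.2 hgX) hmem hne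
        exact hnm g0 hgX a F ha (hF.mono hRS) hF0 (fun h => (hF _ h).2 hgX)
          (fun h => (hF _ h).2 (hXneg _ hgX)) hA
      have h0 : (p:ℤ) ∣ c 0 := by
        have h1 := addOrderOf_dvd_iff_zsmul_eq_zero.2 hz
        rw [ho0, ht] at h1
        push_cast at h1
        have : (t:ℤ) ≠ 0 := by
          rintro h
          have : t = 0 := by exact_mod_cast h
          rw [this] at ht; omega
        exact Int.dvd_of_mul_dvd_mul_right this h1
      have hrest := hyi (fun i => c i.succ) (by
        rw [mul_smul, natCast_zsmul] at hz
        rw [hz, zero_add] at hc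
        exact hc)
      intro j
      refine Fin.cases h0 (fun j => hrest j) j
  refine ⟨fun g => if g ∈ X then 1 / 2 else 1 / (addOrderOf g : ℚ), fun g => by
    dsimp only; split_ifs <;> positivity, ?_⟩
  intro A hO hA
  by_cases hX : ∃ g ∈ X, g ∈ A
  · obtain ⟨g, hg, hgA⟩ := hX
    rcases hat g hg A hO hA hgA with rfl | rfl
    · rw [show ({g, -g} : Multiset G) = g ::ₘ -g ::ₘ 0 from rfl, wt_cons, wt_cons, wt_zero, if_pos hg, if_pos (hXneg g hg)]
      constructor <;> linarith
    · rw [rep, wt_replicate, if_pos hg, hg.2.2]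
      constructor <;> linarith
  · push Not at hX
    have h1 := hR1 A (fun x hx => ⟨hO x hx, fun h => hX x h hx⟩) hA
    have h2 : wt (fun g => if g ∈ X then 1 / 2 else 1 / (addOrderOf g : ℚ)) A = kq A :=
      wt_congr fun x hx => if_neg fun h => hX x h hx
    rw [h2, h1]
    constructor <;> linarith

/-- a group with `davenport = order of an element` is cyclic -/
lemma cyclic_of_dav (h : addOrderOf g = davenport G) (x : G) : ∃ m : ℕ, x = m • g := by
  have hs : Function.Surjective (AddSubgroup.zmultiples g).subtype := by
    by_contra hc
    have h1 := dav_inj _ (AddSubgroup.subtype_injective _) hc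
    have h2 := le_dav (rep_atom (⟨g, AddSubgroup.mem_zmultiples g⟩ : AddSubgroup.zmultiples g))
    rw [rep, Multiset.card_replicate] at h2
    have h3 : addOrderOf (⟨g, AddSubgroup.mem_zmultiples g⟩ : AddSubgroup.zmultiples g) =
      addOrderOf g := by
      rw [← AddSubgroup.addOrderOf_coe]
    omega
  obtain ⟨⟨y, hy⟩, rfl⟩ := hs x
  have := (mem_multiples_iff_mem_zmultiples (x := g) (y := y)).2 hy
  obtain ⟨m, hm⟩ := AddSubmonoid.mem_multiples_iff _ _ |>.1 this
  exact ⟨m, hm.symm⟩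

end mixing2

end LSys

namespace LSys

section cyc

variable {G : Type*} [AddCommGroup G] [Finite G] {S : Set G} {N : ℕ}

lemma cyc_repr {g : G} (ho : addOrderOf g = N) (hg : ∀ x : G, ∃ m : ℕ, x = m • g) (x : G) :
    ∃ a : ℕ, 1 ≤ a ∧ a ≤ N ∧ x = a • g := by
  obtain ⟨m, rfl⟩ := hg x
  have hN : 0 < N := ho ▸ ord_pos g
  have h1 : m • g = (m % N) • g := by rw [← ho, mod_addOrderOf_nsmul]
  by_cases h0 : m % N = 0
  · exact ⟨N, hN, le_rfl, by rw [h1, h0, zero_smul, ← ho, addOrderOf_nsmul_eq_zero]⟩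
  · exact ⟨m % N, by omega, (Nat.mod_lt _ hN).le, h1⟩

lemma U_atom {g : G} (ho : addOrderOf g = N) {a : ℕ} (ha : 1 ≤ a) (haN : a ≤ N) :
    Atom ((a • g) ::ₘ Multiset.replicate (N - a) g) := by
  refine ⟨by simp, ?_, ?_⟩
  · rw [Multiset.sum_cons, Multiset.sum_replicate, ← add_nsmul, Nat.add_sub_cancel' haN, ← ho,
      addOrderOf_nsmul_eq_zero]
  · intro T hT hs
    rcases le_cons_cases hT with h | ⟨T', hT', rfl⟩
    · left
      obtain ⟨k, hk, rfl⟩ := Multiset.le_replicate_iff.1 h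
      rw [Multiset.sum_replicate] at hs
      have h1 := addOrderOf_dvd_of_nsmul_eq_zero hs
      by_cases hk0 : k = 0
      · simp [hk0]
      · have := Nat.le_of_dvd (by omega) h1; omega
    · right
      obtain ⟨k, hk, rfl⟩ := Multiset.le_replicate_iff.1 hT'
      rw [Multiset.sum_cons, Multiset.sum_replicate, ← add_nsmul] at hs
      have := Nat.le_of_dvd (by omega) (addOrderOf_dvd_of_nsmul_eq_zero hs)
      rw [show k = N - a by omega]

lemma gen_rel (hN : 5 ≤ N) (hC : Cong S (N - 3)) {g : G} (hgS : g ∈ S) (ho : addOrderOf g = N)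
    {a : ℕ} (ha : 1 ≤ a) (haN : a ≤ N) (hhS : a • g ∈ S) :
    a ∣ N ∨ (a = N - 2 ∧ N.gcd a = 1) := by
  have hm := addOrderOf_nsmul' g (show a ≠ 0 by omega)
  rw [ho] at hm
  have hc0 : 0 < N.gcd a := Nat.gcd_pos_of_pos_right _ ha
  obtain ⟨m, hm'⟩ := Nat.gcd_dvd_left N a
  obtain ⟨t, ht'⟩ := Nat.gcd_dvd_right N a
  have hcop : Nat.gcd (N / N.gcd a) (a / N.gcd a) = 1 := Nat.coprime_div_gcd_div_gcd hc0
  set c := N.gcd a with hc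
  have hmm : N / c = m := by rw [hm']; exact Nat.mul_div_cancel_left _ hc0
  have htt : a / c = t := by
    conv_lhs => rw [ht']
    exact Nat.mul_div_cancel_left _ hc0
  rw [hmm] at hm
  rw [hmm, htt] at hcop
  have htm : t ≤ m := Nat.le_of_mul_le_mul_left (show c * t ≤ c * m by omega) hc0
  have ht1 : 1 ≤ t := by
    rcases Nat.eq_zero_or_pos t with h | h
    · rw [h] at ht'; omega
    · exact h
  have hU := U_atom ho ha haN
  have hf1 := (Fac.single hU).nsmul m
  have hf2 : Fac ({rep (a • g)} + (m - t) • {rep g}) (rep (a • g) + (m - t) • rep g) :=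
    (Fac.single (rep_atom _)).add ((Fac.single (rep_atom g)).nsmul (m - t))
  have heq : rep (a • g) + (m - t) • rep g = m • ((a • g) ::ₘ Multiset.replicate (N - a) g) := by
    rw [rep, rep, hm, ho, ← Multiset.singleton_add, nsmul_add, Multiset.nsmul_singleton,
      Multiset.nsmul_replicate, Multiset.nsmul_replicate]
    congr 2
    rw [Nat.sub_mul, Nat.mul_sub]
    congr 1
    have : m * a = m * (c * t) := by rw [← ht']
    rw [this]
    have : t * N = t * (c * m) := by rw [← hm']
    rw [this]; ring
  rw [heq] at hf2
  have hO : Over S (m • ((a • g) ::ₘ Multiset.replicate (N - a) g)) := by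
    apply Over.nsmul
    intro x hx
    rcases Multiset.mem_cons.1 hx with rfl | hx
    · exact hhS
    · rw [Multiset.eq_of_mem_replicate hx]; exact hgS
  have hcong := hC _ hO _ _ hf1 hf2
  simp only [Multiset.card_add, Multiset.card_nsmul, Multiset.card_singleton, mul_one] at hcong
  have hc2 : (t:ℤ) ≡ 1 [ZMOD ((N - 3 : ℕ) : ℤ)] := by
    have h3 : ((1 + (m - t) : ℕ) : ℤ) + t = m + 1 := by push_cast [htm]; ring
    have h4 := hcong.add_right (t - m : ℤ)
    have e1 : (m:ℤ) + (t - m) = t := by ring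
    have e2 : ((1 + (m - t) : ℕ) : ℤ) + (t - m) = 1 := by linarith
    rwa [e1, e2] at h4
  by_cases h1 : t = 1
  · left; rw [ht', h1, mul_one]; exact Nat.gcd_dvd_left N a
  · right
    have h2 := int_gap hc2 (by omega)
    have hct : c * t ≤ N := by omega
    have hc1 : c = 1 := by
      by_contra hne
      have : 2 * t ≤ c * t := Nat.mul_le_mul_right _ (by omega)
      omega
    rw [hc1, one_mul] at ht' hm'
    rw [← ht'] at hc2 h1 h2 hcop
    refine ⟨?_, hc1⟩
    by_contra hne
    have h5 : a ≠ N := by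
      intro h; rw [h, ← hm'] at hcop; simp at hcop; omega
    have h6 : a = N - 1 := by omega
    have h7 := hc2.dvd
    have h8 : ((N - 3 : ℕ) : ℤ) ∣ 1 := by
      have h9 : (1:ℤ) = -(1 - (a:ℤ)) - ((N - 3 : ℕ) : ℤ) := by omega
      rw [h9]
      exact dvd_sub (dvd_neg.2 h7) dvd_rfl
    have := Int.le_of_dvd (by norm_num) h8
    omega

lemma cyc_hf_gen (hN : 5 ≤ N) (hC : Cong S (N - 3)) (hD : davenport G = N) {g : G} (hgS : g ∈ S)
    (ho : addOrderOf g = N) {A : Multiset G} (hO : Over S A) (hA : Atom A) : kq A = 1 := by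
  have hcyc : ∀ g : G, addOrderOf g = N → ∀ x : G, ∃ m : ℕ, x = m • g := fun g h x =>
    cyclic_of_dav (by rw [h, hD]) x
  have hdiv : ∀ h ∈ S, ∃ a : ℕ, 1 ≤ a ∧ a ≤ N ∧ a ∣ N ∧ h = a • g := by
    intro h hh
    obtain ⟨a, ha, haN, rfl⟩ := cyc_repr ho (hcyc g ho) h
    rcases gen_rel hN hC hgS ho ha haN hh with h1 | ⟨h1, hgcd⟩
    · exact ⟨a, ha, haN, h1, rfl⟩
    · exfalso
      have hoh : addOrderOf (a • g) = N := by
        rw [addOrderOf_nsmul' g (by omega), ho, hgcd, Nat.div_one]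
      obtain ⟨b, hb, hbN, hgb⟩ := cyc_repr hoh (hcyc _ hoh) g
      have hgb' := gen_rel hN hC hh hoh hb hbN (hgb ▸ hgS)
      have hob : addOrderOf (b • a • g) = N := by rw [← hgb, ho]
      rw [addOrderOf_nsmul' _ (by omega), hoh] at hob
      have hgb1 : N.gcd b = 1 := by
        have h1 := Nat.div_mul_cancel (Nat.gcd_dvd_left N b)
        rw [hob] at h1
        exact Nat.eq_of_mul_eq_mul_left (show 0 < N by omega) (by omega)
      have hrel : ((b * a : ℤ) - 1) • g = 0 := by
        rw [sub_smul, one_smul, mul_smul, natCast_zsmul, natCast_zsmul, ← hgb, sub_self]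
      have hdv := addOrderOf_dvd_iff_zsmul_eq_zero.2 hrel
      rw [ho] at hdv
      have hbb : b = 1 ∨ b = N - 2 := by
        rcases hgb' with h2 | ⟨h2, -⟩
        · left; rwa [Nat.gcd_eq_right h2] at hgb1
        · right; exact h2
      have hN2 : ((N - 2 : ℕ) : ℤ) = N - 2 := by omega
      rcases hbb with h2 | h2
      · rw [h2, h1, hN2] at hdv
        have h3 := Int.le_of_dvd (by push_cast; omega) hdv
        push_cast at h3; omega
      · have : (N : ℤ) ∣ 3 := by
          have e : (3:ℤ) = ((b * a : ℤ) - 1) - (N : ℤ) * (N - 4) := by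
            rw [h2, h1, hN2]; ring
          rw [e]
          exact dvd_sub hdv (dvd_mul_right _ _)
        have := Int.le_of_dvd (by norm_num) this
        omega
  choose! f hf1 hfN hfd hfg using hdiv
  by_cases hc1 : Multiset.card A < 2
  · exact hA.kq_one_of_card hc1
  have hN0 : (0:ℚ) < N := by exact_mod_cast (by omega : 0 < N)
  have hfk : ∀ h ∈ S, (1 / (addOrderOf h : ℚ)) = f h / N := by
    intro h hh
    have e : addOrderOf h = N / f h := by
      conv_lhs => rw [hfg h hh]
      rw [addOrderOf_nsmul' g (by have := hf1 h hh; omega), ho, Nat.gcd_eq_right (hfd h hh)]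
    have h1 := hf1 h hh
    have h1' : (0:ℚ) < f h := by exact_mod_cast h1
    rw [e, Nat.cast_div (hfd h hh) h1'.ne']
    field_simp
  have hfhalf : ∀ h ∈ A, 2 * f h ≤ N := by
    intro h hh
    have hhS := hO h hh
    have hne : f h ≠ N := by
      intro he
      have h0 := hfg h hhS
      rw [he, ← ho, addOrderOf_nsmul_eq_zero] at h0
      subst h0
      rw [atom_mem_zero hA hh] at hc1
      simp at hc1
    obtain ⟨k, hk⟩ := hfd h hhS
    have hk2 : 2 ≤ k := by
      by_contra hk1
      have : k = 0 ∨ k = 1 := by omega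
      rcases this with rfl | rfl
      · omega
      · omega
    have : f h * 2 ≤ f h * k := Nat.mul_le_mul_left _ hk2
    omega
  -- sums
  have hS1 : ∀ B : Multiset G, Over S B → B.sum = (B.map f).sum • g ∧
      (N:ℚ) * kq B = ((B.map f).sum : ℕ) ∧ (B.map f).sum ≤ N * Multiset.card B ∧
      ∃ F, Fac F (B + Multiset.replicate (N * Multiset.card B - (B.map f).sum) g) ∧
        Multiset.card F = Multiset.card B := by
    intro B
    induction B using Multiset.induction with
    | empty => intro _; exact ⟨by simp, by simp [kq_zero], by simp, 0, by simpa using Fac.nil, by simp⟩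
    | cons h s ih =>
      intro hB
      obtain ⟨i1, i2, i3, F, i4, i5⟩ := ih (fun x hx => hB x (by simp [hx]))
      have hh := hB h (by simp)
      have hfh := hfN h hh
      refine ⟨?_, ?_, ?_, ?_⟩
      · rw [Multiset.sum_cons, i1, Multiset.map_cons, Multiset.sum_cons, add_nsmul, ← hfg h hh]
      · rw [kq_cons, mul_add, i2, hfk h hh, Multiset.map_cons, Multiset.sum_cons]
        push_cast; field_simp
      · rw [Multiset.map_cons, Multiset.sum_cons, Multiset.card_cons, mul_add]; omega
      · refine ⟨(h ::ₘ Multiset.replicate (N - f h) g) ::ₘ F, ?_, by simp [i5]⟩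
        have hU := U_atom ho (hf1 h hh) hfh
        rw [← hfg h hh] at hU
        have := Fac.cons hU i4
        convert this using 1
        rw [Multiset.map_cons, Multiset.sum_cons, Multiset.card_cons,
          show N * (Multiset.card s + 1) - (f h + (s.map f).sum) =
            (N - f h) + (N * Multiset.card s - (s.map f).sum) by rw [mul_add]; omega,
          Multiset.replicate_add]
        simp only [← Multiset.singleton_add]
        abel
  obtain ⟨s1, s2, s3, F, s4, s5⟩ := hS1 A hO
  rw [hA.sum] at s1
  obtain ⟨t, ht⟩ := addOrderOf_dvd_of_nsmul_eq_zero s1.symm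
  rw [ho] at ht
  rw [ht] at s2 s3 s4
  have hkt : kq A = t := by
    push_cast at s2
    exact mul_left_cancel₀ hN0.ne' s2
  have htA : t ≤ Multiset.card A := Nat.le_of_mul_le_mul_left s3 (by omega)
  have hf2 : Fac (A ::ₘ (Multiset.card A - t) • {rep g}) (A + (Multiset.card A - t) • rep g) :=
    Fac.cons hA ((Fac.single (rep_atom g)).nsmul _)
  have heq : A + (Multiset.card A - t) • rep g =
      A + Multiset.replicate (N * Multiset.card A - N * t) g := by
    rw [rep, Multiset.nsmul_replicate, ho, ← Nat.mul_sub, mul_comm]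
  rw [heq] at hf2
  have hcong := hC _ (hO.add (over_replicate hgS _)) _ _ s4 hf2
  simp only [Multiset.card_cons, Multiset.card_nsmul, Multiset.card_singleton, mul_one, s5] at hcong
  have hc2 : (t:ℤ) ≡ 1 [ZMOD ((N - 3 : ℕ) : ℤ)] := by
    have h4 := hcong.add_right (t - Multiset.card A : ℤ)
    have e1 : (Multiset.card A:ℤ) + (t - Multiset.card A) = t := by ring
    have e2 : ((Multiset.card A - t + 1 : ℕ) : ℤ) + (t - Multiset.card A) = 1 := by
      push_cast [htA]; ring
    rwa [e1, e2] at h4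
  have ht0 : 0 < t := by
    have := kq_pos hA.ne
    rw [hkt] at this
    exact_mod_cast this
  have htN : 2 * t ≤ N := by
    have h1 : (A.map (fun x => 2 * f x)).sum ≤ Multiset.card A • N := by
      have := Multiset.sum_le_card_nsmul (A.map (fun x => 2 * f x)) N (by
        intro x hx
        obtain ⟨y, hy, rfl⟩ := Multiset.mem_map.1 hx
        exact hfhalf y hy)
      simpa using this
    rw [Multiset.sum_map_mul_left, ht, smul_eq_mul] at h1
    have h2 := le_dav hA
    rw [hD] at h2
    have h3 : N * (2 * t) ≤ N * N := by
      calc N * (2 * t) = 2 * (N * t) := by ring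
        _ ≤ _ := h1
        _ ≤ N * N := Nat.mul_le_mul_right _ h2
    exact Nat.le_of_mul_le_mul_left h3 (by omega)
  have ht1 : t = 1 := by
    by_contra hne
    have := int_gap hc2 (by omega)
    omega
  rw [hkt, ht1]; simp

end cyc

end LSys

namespace LSys

section cyc2

variable {G : Type*} [AddCommGroup G] [Finite G] {S : Set G} {N : ℕ}

lemma cyc_hf (hN : 5 ≤ N) (hC : Cong S (N - 3)) (hD : davenport G = N) {g : G}
    (ho : addOrderOf g = N) {A : Multiset G} (hO : Over S A) (hA : Atom A) : kq A = 1 := by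
  by_cases hgen : ∃ h ∈ S, addOrderOf h = N
  · obtain ⟨h, hhS, hho⟩ := hgen
    exact cyc_hf_gen hN hC hD hhS hho hO hA
  push Not at hgen
  have hrep := cyc_repr ho (fun x => cyclic_of_dav (by rw [ho, hD]) x)
  have htor : ∀ x : G, N • x = 0 := by
    intro x
    obtain ⟨a, -, -, rfl⟩ := hrep x
    rw [smul_comm, ← ho, addOrderOf_nsmul_eq_zero, smul_zero]
  have hhalf : ∀ x ∈ S, 2 * addOrderOf x ≤ N := by
    intro x hx
    obtain ⟨k, hk⟩ := addOrderOf_dvd_of_nsmul_eq_zero (htor x)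
    have hne := hgen x hx
    have hk2 : 2 ≤ k := by
      by_contra hk1
      have : k = 0 ∨ k = 1 := by omega
      rcases this with rfl | rfl
      · omega
      · omega
    have : addOrderOf x * 2 ≤ addOrderOf x * k := Nat.mul_le_mul_left _ hk2
    omega
  have hL : LCN S := by
    intro B hOB hB
    by_contra hk
    push Not at hk
    obtain ⟨x, hx, h2, h3, h4⟩ := small_kq hC (N := N) (by omega) (fun g _ => htor g) hOB hB hk
    have h5 : (Multiset.card B : ℚ) * (2 / N) ≤ kq B := by
      apply card_le_wt
      intro y hy
      have h6 := hhalf y (hOB y hy)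
      have h7 := ord_pos y
      rw [div_le_div_iff₀ (by exact_mod_cast (by omega : 0 < N)) (by exact_mod_cast h7)]
      rw [one_mul]; exact_mod_cast h6
    have hN0 : (0:ℚ) < N := by exact_mod_cast (by omega : 0 < N)
    have h8 : (Multiset.card B : ℚ) * 2 ≤ x := by
      rw [hx]
      have e : (Multiset.card B : ℚ) * 2 = N * ((Multiset.card B : ℚ) * (2 / N)) := by field_simp
      rw [e]
      exact mul_le_mul_of_nonneg_left h5 hN0.le
    have h9 : Multiset.card B * 2 ≤ x := by exact_mod_cast h8
    omega
  have hTf : S.Finite := Set.toFinite S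
  have hcard : hTf.toFinset.card ≤ (N - 3) + 1 := by
    have hsub : hTf.toFinset ⊆ ((Finset.Icc 2 N).erase (N - 1)).image (fun m => m • g) := by
      intro x hx
      have hxS : x ∈ S := by simpa using hx
      obtain ⟨a, ha, haN, rfl⟩ := hrep x
      refine Finset.mem_image.2 ⟨a, ?_, rfl⟩
      rw [Finset.mem_erase, Finset.mem_Icc]
      refine ⟨?_, ?_, haN⟩
      · rintro rfl
        apply hgen _ hxS
        rw [addOrderOf_nsmul' g (by omega), ho]
        have : Nat.Coprime N (N - 1) := by
          rw [Nat.coprime_self_sub_right (by omega)]; simp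
        rw [this.gcd_eq_one, Nat.div_one]
      · by_contra hc
        have : a = 1 := by omega
        subst this
        exact hgen _ hxS (by rw [one_smul, ho])
    refine (Finset.card_le_card hsub).trans (Finset.card_image_le.trans ?_)
    rw [Finset.card_erase_of_mem (by simp; omega), Nat.card_Icc]
    omega
  have hsT : ((hTf.toFinset : Finset G) : Set G) = S := by simp
  have := small_hf (d := N - 3) (by omega) hTf.toFinset hcard (by rwa [hsT]) (by rwa [hsT])
    (fun x hx => by
      have := hhalf x (by simpa using hx)
      omega) (B := A) (by rwa [hsT]) hA.sum
  exact this.of_atom hA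

variable {G' : Type*} [AddCommGroup G'] [Finite G']

lemma f1 {r : ℕ} (hr : 4 ≤ r) (hI : Indep 2 r G)
    (hL : systemL (Set.univ : Set G) = systemL (Set.univ : Set G')) (hD : davenport G' = r + 1)
    {g : G'} (ho : addOrderOf g = r + 1) : False := by
  have hfam := (fam_indep (m := 2) (s := r - 1) le_rfl (by omega) (hI.mono (by omega))).transfer hL
  obtain ⟨S, hC, hw⟩ := extraction hfam
  rw [show r - 1 - 1 = (r + 1) - 3 by omega] at hC
  have := hw (fun g => 1 / (addOrderOf g : ℚ)) 1 (fun g => by positivity) (by norm_num) (by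
    intro A hO hA
    have := cyc_hf (by omega) hC hD ho hO hA
    change 1 ≤ kq A ∧ kq A ≤ 1
    rw [this]; simp)
  rw [one_mul] at this
  have : 1 + (r - 1) * (2 - 1) ≤ 2 := by exact_mod_cast this
  omega

lemma atom4 {A : Multiset G} (h2 : ∀ x : G, x + x = 0) (hn : A.Nodup) (h0 : (0:G) ∉ A)
    (hc : Multiset.card A = 4) (hs : A.sum = 0) : Atom A := by
  refine ⟨by rintro rfl; simp at hc, hs, ?_⟩
  intro T hT hTs
  have hTn : T.Nodup := Multiset.nodup_of_le hT hn
  have hle := Multiset.card_le_card hT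
  have key : ∀ R : Multiset G, R ≤ A → R.sum = 0 → Multiset.card R ≠ 1 := by
    intro R hR hRs hR1
    obtain ⟨x, rfl⟩ := Multiset.card_eq_one.1 hR1
    simp at hRs
    subst hRs
    exact h0 (Multiset.singleton_le.1 hR)
  have hR := key T hT hTs
  obtain ⟨U, rfl⟩ := Multiset.le_iff_exists_add.1 hT
  rw [Multiset.sum_add, hTs, zero_add] at hs
  have hU := key U (Multiset.le_add_left _ _) hs
  rw [Multiset.card_add] at hc
  have h22 : Multiset.card T ≠ 2 := by
    intro h
    obtain ⟨x, y, rfl⟩ := Multiset.card_eq_two.1 h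
    simp at hTs hTn
    apply hTn
    have := h2 y
    exact add_right_cancel (hTs.trans this.symm)
  rcases (by omega : Multiset.card T = 0 ∨ Multiset.card U = 0) with h | h
  · left; exact Multiset.card_eq_zero.1 h
  · right; rw [Multiset.card_eq_zero.1 h, add_zero]

lemma c4_atoms {g : G} (ho : addOrderOf g = 4) (hD : davenport G = 4) {A : Multiset G}
    (hA : Atom A) (hc : Multiset.card A = 4) : A = rep g ∨ A = rep (-g) := by
  have hrep := cyc_repr ho (fun x => cyclic_of_dav (by rw [ho, hD]) x)
  have h4 : 4 • g = 0 := by rw [← ho, addOrderOf_nsmul_eq_zero]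
  have h0 : (0:G) ∉ A := by
    intro h
    rw [atom_mem_zero hA h] at hc; simp at hc
  have hgn : g ≠ -g := ne_neg_of_ord (by omega)
  have hg0 : g ≠ 0 := by rintro rfl; simp at ho
  have h3 : 3 • g = -g := by
    have : 3 • g + g = 0 := by rw [← h4]; abel
    exact eq_neg_of_add_eq_zero_left this
  have ho2 : addOrderOf (2 • g) = 2 := by
    rw [addOrderOf_nsmul' g (by norm_num), ho]; norm_num
  have h2c : A.count (2 • g) < 2 := by
    have := hA.count_lt (g := 2 • g) (by
      intro h
      rw [h, rep, ho2] at hc; simp at hc)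
    omega
  have hmem : ∀ x ∈ A, x = g ∨ x = -g ∨ x = 2 • g := by
    intro x hx
    obtain ⟨a, ha, haN, rfl⟩ := hrep x
    interval_cases a
    · left; simp
    · right; right; rfl
    · right; left; exact h3
    · exfalso; rw [h4] at hx; exact h0 hx
  have key : ∀ h : G, addOrderOf h = 4 → 2 • h = 2 • g → (∀ x ∈ A, x = h ∨ x = 2 • g) → A = rep h := by
    intro h hh h2 hm
    apply hA.eq_rep
    rw [hh]
    have hne : h ≠ 2 • g := by intro he; rw [he, ho2] at hh; omega
    have hA' : A = Multiset.replicate (A.count h) h + Multiset.replicate (A.count (2 • g)) (2 • g) := by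
      ext x
      rw [Multiset.count_add, Multiset.count_replicate, Multiset.count_replicate]
      by_cases hx : x ∈ A
      · rcases hm x hx with rfl | rfl
        · simp [Ne.symm hne]
        · simp [hne]
      · rw [Multiset.count_eq_zero_of_notMem hx]
        split_ifs with e1 e2 e2
        · exact absurd (e1.trans e2.symm) hne
        · subst e1; rw [Multiset.count_eq_zero_of_notMem hx]
        · subst e2; rw [Multiset.count_eq_zero_of_notMem hx]
        · rfl
    have hcard := congrArg Multiset.card hA'
    simp only [Multiset.card_add, Multiset.card_replicate] at hcard
    by_contra hlt
    have c1 : A.count h = 3 := by omega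
    have c2 : A.count (2 • g) = 1 := by omega
    have hs := hA.sum
    rw [hA', c1, c2, Multiset.sum_add, Multiset.sum_replicate, Multiset.sum_replicate, one_smul,
      ← h2, ← add_nsmul] at hs
    have := addOrderOf_dvd_of_nsmul_eq_zero hs
    rw [hh] at this
    omega
  by_cases hgA : g ∈ A
  · left
    have hng : -g ∉ A := by
      intro h
      rw [atom_card_two hA hgA h (Or.inr hgn) hg0] at hc
      simp at hc
    refine key g ho rfl fun x hx => ?_
    rcases hmem x hx with h | h | h
    · exact Or.inl h
    · subst h; exact absurd hx hng
    · exact Or.inr h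
  · right
    refine key (-g) (by simpa using ho) ?_ fun x hx => ?_
    · rw [smul_neg]
      have : 2 • g + 2 • g = 0 := by rw [← add_nsmul, h4]
      exact neg_eq_of_add_eq_zero_left this
    rcases hmem x hx with h | h | h
    · subst h; exact absurd hx hgA
    · exact Or.inl h
    · exact Or.inr h

lemma f2a (h2 : ∀ x : G, x + x = 0) (hI : Indep 2 3 G) :
    ∃ B : Multiset G, B.sum = 0 ∧ (∃ F, Fac F B ∧ Multiset.card F = 3) ∧
      ∃ F, Fac F B ∧ Multiset.card F = 6 := by
  obtain ⟨y, -, hi⟩ := hI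
  have hne : ∀ a b c : ℤ, (a % 2 ≠ 0 ∨ b % 2 ≠ 0 ∨ c % 2 ≠ 0) →
      a • y 0 + b • y 1 + c • y 2 ≠ 0 := by
    intro a b c h h0
    have := hi ![a, b, c] (by simpa [Fin.sum_univ_three] using h0)
    have h1 := this 0
    have h2 := this 1
    have h3 := this 2
    simp at h1 h2 h3
    omega
  set a := y 0
  set b := y 1
  set s := y 2
  have n1 : a ≠ 0 := by simpa using hne 1 0 0 (by norm_num)
  have n2 : b ≠ 0 := by simpa using hne 0 1 0 (by norm_num)
  have n3 : s ≠ 0 := by simpa using hne 0 0 1 (by norm_num)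
  have n4 : a + b ≠ 0 := by simpa using hne 1 1 0 (by norm_num)
  have n5 : a + s ≠ 0 := by simpa using hne 1 0 1 (by norm_num)
  have n6 : b + s ≠ 0 := by simpa using hne 0 1 1 (by norm_num)
  have n7 : a + b + s ≠ 0 := by simpa using hne 1 1 1 (by norm_num)
  have hneg : ∀ x : G, -x = x := fun x => neg_eq_of_add_eq_zero_left (h2 x)
  have hcan : ∀ x y : G, x + y ≠ 0 → x ≠ y := by
    rintro x _ h rfl; exact h (h2 x)
  -- a pair of cosets gives an atom
  have hat : ∀ x z : G, x ≠ 0 → z ≠ 0 → x + s ≠ 0 → z + s ≠ 0 → x + z ≠ 0 → x + z + s ≠ 0 →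
      Atom ({x, x + s, z, z + s} : Multiset G) := by
    intro x z m1 m2 m3 m4 m5 m6
    apply atom4 h2
    · have e1 : x ≠ x + s := by simpa using n3
      have e2 : x ≠ z := hcan _ _ m5
      have e3 : x ≠ z + s := hcan _ _ (by rwa [← add_assoc])
      have e4 : x + s ≠ z := hcan _ _ (by rwa [add_right_comm])
      have e5 : x + s ≠ z + s := by simpa using e2
      have e6 : z ≠ z + s := by simpa using n3
      simp only [Multiset.insert_eq_cons, Multiset.nodup_cons, Multiset.mem_cons,
        Multiset.mem_singleton, Multiset.nodup_singleton]
      tauto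
    · simp only [Multiset.insert_eq_cons, Multiset.mem_cons, Multiset.mem_singleton]
      push Not
      exact ⟨m1.symm, m3.symm, m2.symm, m4.symm⟩
    · simp
    · simp only [Multiset.insert_eq_cons, Multiset.sum_cons, Multiset.sum_singleton]
      have : x + (x + s + (z + (z + s))) = (x + x) + (z + z) + (s + s) := by abel
      rw [this, h2 x, h2 z, h2 s]; simp
  have hp : ∀ x : G, x ≠ 0 → Atom ({x, x} : Multiset G) := by
    intro x hx
    have := atom_pair hx
    rwa [hneg] at this
  have A1 := hat a b n1 n2 n5 n6 n4 n7
  have A2 := hat a (a + b) n1 n4 n5 n7 (by rw [← add_assoc, h2, zero_add]; exact n2)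
    (by rw [← add_assoc, h2, zero_add]; exact n6)
  have A3 := hat b (a + b) n2 n4 n6 n7 (by rw [add_comm a b, ← add_assoc, h2, zero_add]; exact n1)
    (by rw [add_comm a b, ← add_assoc, h2, zero_add]; exact n5)
  have f3 := (Fac.single A1).add ((Fac.single A2).add (Fac.single A3))
  refine ⟨_, f3.sum_eq, ⟨_, f3, by simp⟩, ?_⟩
  have f6 := ((Fac.single (hp _ n1)).add ((Fac.single (hp _ n5)).add (Fac.single (hp _ n2)))).add
    ((Fac.single (hp _ n6)).add ((Fac.single (hp _ n4)).add (Fac.single (hp _ n7))))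
  refine ⟨_, ⟨f6.1, f6.2.trans ?_⟩, by simp⟩
  simp only [Multiset.insert_eq_cons, ← Multiset.singleton_add]
  abel

lemma f2b {g : G} (ho : addOrderOf g = 4) (hD : davenport G = 4) {B : Multiset G}
    {F3 F6 : Multiset (Multiset G)} (h3 : Fac F3 B) (h6 : Fac F6 B) (c3 : Multiset.card F3 = 3)
    (c6 : Multiset.card F6 = 6) : False := by
  let w : G → ℚ := fun x => if x = 0 then 2 else 1
  have hw2 : ∀ A, Atom A → 2 ≤ wt w A ∧ (wt w A = 2 → Multiset.card A = 2 ∨ A = {0}) := by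
    intro A hA
    by_cases h0 : (0:G) ∈ A
    · rw [atom_mem_zero hA h0]
      simp [wt, w]
    · have : wt w A = Multiset.card A := by
        have h1 : wt w A = wt (fun _ => 1) A := wt_congr fun x hx => if_neg (by rintro rfl; exact h0 hx)
        rw [h1]; simp [wt]
      rw [this]
      constructor
      · have h1 := hA.one_le
        by_contra hlt
        have h2 : Multiset.card A = 1 := by
          have : (Multiset.card A : ℚ) < 2 := by linarith
          have : Multiset.card A < 2 := by exact_mod_cast this
          omega
        rw [atom_card_one hA h2] at h0
        simp at h0
      · intro h; left; exact_mod_cast h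
  have hw4 : ∀ A, Atom A → wt w A ≤ 4 ∧ (wt w A = 4 → Multiset.card A = 4) := by
    intro A hA
    by_cases h0 : (0:G) ∈ A
    · rw [atom_mem_zero hA h0]
      simp [wt, w]; norm_num
    · have : wt w A = Multiset.card A := by
        have h1 : wt w A = wt (fun _ => 1) A := wt_congr fun x hx => if_neg (by rintro rfl; exact h0 hx)
        rw [h1]; simp [wt]
      rw [this]
      have := le_dav hA
      rw [hD] at this
      exact ⟨by exact_mod_cast this, fun h => by exact_mod_cast h⟩
  have l1 := fac_wt_le h3.2 (w := w) (κ := 4) fun A hA => (hw4 A (h3.atom hA)).1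
  have l2 := fac_le_wt h6.2 (w := w) (κ := 2) fun A hA => (hw2 A (h6.atom hA)).1
  rw [c3] at l1
  rw [c6] at l2
  push_cast at l1 l2
  have hB : wt w B = 12 := by linarith
  -- all extreme
  have ext6 : ∀ A ∈ F6, wt w A = 2 := by
    intro A hA
    obtain ⟨F, rfl⟩ := Multiset.exists_cons_of_mem hA
    have e := h6.2
    rw [Multiset.sum_cons] at e
    have := fac_le_wt (rfl : F.sum = F.sum) (w := w) (κ := 2) fun A hA => (hw2 A (h6.atom (by simp [hA]))).1
    rw [← e, wt_add] at hB
    have h1 := (hw2 A (h6.atom (by simp))).1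
    rw [Multiset.card_cons] at c6
    have c5 : Multiset.card F = 5 := by omega
    rw [c5] at this
    push_cast at this
    linarith
  have ext3 : ∀ A ∈ F3, wt w A = 4 := by
    intro A hA
    obtain ⟨F, rfl⟩ := Multiset.exists_cons_of_mem hA
    have e := h3.2
    rw [Multiset.sum_cons] at e
    have := fac_wt_le (rfl : F.sum = F.sum) (w := w) (κ := 4) fun A hA => (hw4 A (h3.atom (by simp [hA]))).1
    rw [← e, wt_add] at hB
    have h1 := (hw4 A (h3.atom (by simp))).1
    rw [Multiset.card_cons] at c3
    have c5 : Multiset.card F = 2 := by omega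
    rw [c5] at this
    push_cast at this
    linarith
  have hgn : g ≠ -g := ne_neg_of_ord (by omega)
  have hg0 : g ≠ 0 := by rintro rfl; simp at ho
  let v : G → ℚ := fun x => (if x = g then 1 else 0) - (if x = -g then 1 else 0)
  have v6 : wt v B = 0 := by
    have := fac_wt_eq h6.2 (w := v) (κ := 0) (by
      intro A hA
      rcases (hw2 A (h6.atom hA)).2 (ext6 A hA) with h | h
      · obtain ⟨x, y, rfl⟩ := Multiset.card_eq_two.1 h
        have hs := (h6.atom hA).sum
        simp at hs
        have hy : y = -x := (neg_eq_of_add_eq_zero_right hs).symm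
        subst hy
        simp only [wt, v, Multiset.insert_eq_cons, Multiset.map_cons, Multiset.map_singleton,
          Multiset.sum_cons, Multiset.sum_singleton, neg_inj, neg_eq_iff_eq_neg, neg_neg]
        ring
      · rw [h]
        simp [wt, v, hg0.symm, hg0])
    rw [this]; simp
  have v3 : ∀ A ∈ F3, wt v A = 4 ∨ wt v A = -4 := by
    intro A hA
    have hc := (hw4 A (h3.atom hA)).2 (ext3 A hA)
    rcases c4_atoms ho hD (h3.atom hA) hc with rfl | rfl
    · left; rw [rep, wt_replicate, ho]; simp [v, hgn]
    · right; rw [rep, wt_replicate, addOrderOf_neg, ho]; simp [v, hgn.symm]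
  obtain ⟨X, Y, Z, rfl⟩ := Multiset.card_eq_three.1 c3
  have e := h3.2
  simp only [Multiset.insert_eq_cons, Multiset.sum_cons, Multiset.sum_singleton] at e
  rw [← e, wt_add, wt_add] at v6
  rcases v3 X (by simp) with hX | hX <;> rcases v3 Y (by simp) with hY | hY <;>
    rcases v3 Z (by simp) with hZ | hZ <;> rw [hX, hY, hZ] at v6 <;> norm_num at v6

lemma f2 (h2 : ∀ x : G, x + x = 0) (hI : Indep 2 3 G)
    (hL : systemL (Set.univ : Set G) = systemL (Set.univ : Set G')) (hD : davenport G' = 4)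
    {g : G'} (ho : addOrderOf g = 4) : False := by
  obtain ⟨B, hB, ⟨F3, h3, c3⟩, F6, h6, c6⟩ := f2a h2 hI
  have hmem : lengthSet Set.univ B ∈ systemL (Set.univ : Set G) :=
    ⟨B, ⟨by simp, hB⟩, rfl⟩
  have m3 : 3 ∈ lengthSet Set.univ B := mem_lengthSet.2 ⟨F3, h3, c3⟩
  have m6 : 6 ∈ lengthSet Set.univ B := mem_lengthSet.2 ⟨F6, h6, c6⟩
  rw [hL] at hmem
  obtain ⟨B', -, hB'⟩ := hmem
  rw [hB'] at m3 m6
  obtain ⟨F3', h3', c3'⟩ := mem_lengthSet.1 m3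
  obtain ⟨F6', h6', c6'⟩ := mem_lengthSet.1 m6
  exact f2b ho hD h3' h6' c3' c6'

end cyc2

end LSys

namespace LSys

section squarefree

variable {G : Type*} [AddCommGroup G] [Finite G] {S : Set G} {d N : ℕ} {g : G}

lemma reduce_mod (E : Set G) (n : ℕ) : ∀ B : Multiset G, Multiset.card B ≤ n → Over E B →
    ∃ Y V, B = Y + V ∧ Over E Y ∧ Over E V ∧ (∀ x, Y.count x ≤ addOrderOf x) ∧ HF1 V := by
  induction n with
  | zero =>
    intro B hB hO
    have : B = 0 := by simpa using hB
    subst this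
    exact ⟨0, 0, by simp, Over.zero, Over.zero, by simp, HF1.nil⟩
  | succ n ih =>
    intro B hB hO
    by_cases h : ∀ x, B.count x ≤ addOrderOf x
    · exact ⟨B, 0, by simp, hO, Over.zero, h, HF1.nil⟩
    · push Not at h
      obtain ⟨x, hx⟩ := h
      have hle : rep x ≤ B := by
        rw [rep, ← Multiset.le_count_iff_replicate_le]; omega
      obtain ⟨Q, rfl⟩ := Multiset.le_iff_exists_add.1 hle
      have hc : Multiset.card (rep x) = addOrderOf x := by simp [rep]
      have := ord_pos x
      rw [Multiset.card_add, hc] at hB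
      obtain ⟨Y, V, rfl, h1, h2, h3, h4⟩ := ih Q (by omega) (hO.le (Multiset.le_add_left _ _))
      refine ⟨Y, V + rep x, by abel, h1, h2.add (hO.le (Multiset.le_add_right _ _)), h3, h4.add (HF1.rep x)⟩

lemma hf1_pow (N : ℕ) (A : Multiset G) (h : ∀ x ∈ A, N • x = 0) : HF1 (N • A) := by
  induction A using Multiset.induction with
  | empty => simpa using HF1.nil
  | cons a s ih =>
    obtain ⟨k, hk⟩ := addOrderOf_dvd_of_nsmul_eq_zero (h a (by simp))
    rw [← Multiset.singleton_add, nsmul_add]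
    refine HF1.add ?_ (ih fun x hx => h x (by simp [hx]))
    have : N • ({a} : Multiset G) = k • rep a := by
      rw [Multiset.nsmul_singleton, hk, rep, Multiset.nsmul_replicate, mul_comm]
    rw [this]
    exact (HF1.rep a).nsmul k

lemma hf1_or_atom {T : Finset G} (hg : Good (T : Set G) d) (hT : T.card ≤ d + 2) {C : Multiset G}
    (hO : Over (T : Set G) C) (hs : C.sum = 0) (hc : ∀ x ∈ T, C.count x ≤ addOrderOf x) :
    HF1 C ∨ Atom C := by
  by_cases h : HF1 C
  · exact Or.inl h
  · right
    obtain ⟨F, hF⟩ := exists_fac C hs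
    have h1 := s2 hg hs T (fun x hx => hx) (le_sum_rep T hO hc) h hF
    have h0 : C ≠ 0 := by rintro rfl; exact h HF1.nil
    have := hF.pos h0
    exact hF.atom_of_card (by omega)

/-- cross number one for a mixing sequence over an independent set -/
lemma mx_kq_one (hC : Cong S d) (hNd : N = d + 2) (hd : 3 ≤ d) (hS : ∀ g ∈ S, N • g = 0)
    (hk : ∀ A, Over S A → Atom A → kq A < d + 1) {p k : ℕ} (hp : p.Prime) (hN : N = p ^ k)
    (hg : g ∈ S) (hg' : -g ∈ S) (ho : addOrderOf g = N) {E : Finset G} (hE : ∀ e ∈ E, e ∈ S)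
    (hEc : E.card ≤ d + 1) (h1 : g ∉ E) (h2 : -g ∉ E)
    (hind : ∀ e ∈ E, ∀ c : ℤ, IsCoprime c (p:ℤ) →
        c • e ∉ AddSubgroup.closure ((E.erase e : Finset G) : Set G))
    {F : Multiset G} (hF : Over (E : Set G) F) (hM : Mx N g F) :
    Good ((insert g E : Finset G) : Set G) d ∧ kq F = 1 - 1 / N := by
  have hord : ∀ x ∈ S, addOrderOf x ≤ d + 2 := fun x hx => by
    have := Nat.le_of_dvd (by omega) (addOrderOf_dvd_of_nsmul_eq_zero (hS x hx))
    omega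
  have good : ∀ x, x ∈ S → addOrderOf x = N → -x ∉ E → Good ((insert x E : Finset G) : Set G) d := by
    intro x hx hxo hxE
    have hsub : ((insert x E : Finset G) : Set G) ⊆ S := by
      intro y hy
      rcases Finset.mem_insert.1 hy with rfl | hy
      · exact hx
      · exact hE y hy
    refine ⟨hC.mono hsub, ?_, by omega, fun y hy => hord y (hsub hy), fun A hO hA => hk A (hO.mono hsub) hA⟩
    rw [Finset.coe_insert]
    exact lcn_insert hC hNd (by omega) hS hx hxo hE hind hxE
  have hG2 := good g hg ho h2
  have hG1 := good (-g) hg' (by simpa using ho) (by simpa using h1)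
  refine ⟨hG2, ?_⟩
  have hN0 : (0:ℚ) < N := by exact_mod_cast (by omega : 0 < N)
  have hN5 : (5:ℚ) ≤ N := by exact_mod_cast (by omega : 5 ≤ N)
  have hN1 : ((N - 1 : ℕ) : ℚ) = N - 1 := by rw [Nat.cast_sub (by omega)]; simp
  have hgn : g ≠ -g := ne_neg_of_ord (by omega)
  have hE1 : (E : Set G) ⊆ ((insert (-g) E : Finset G) : Set G) := by intro x hx; simp at hx ⊢; tauto
  have hE2 : (E : Set G) ⊆ ((insert g E : Finset G) : Set G) := by intro x hx; simp at hx ⊢; tauto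
  have m1 : -g ∈ ((insert (-g) E : Finset G) : Set G) := by simp
  have m2 : g ∈ ((insert g E : Finset G) : Set G) := by simp
  have hFs : F.sum = g := by
    have := hM.2.2.1.sum
    rw [Multiset.sum_cons] at this
    have := neg_eq_of_add_eq_zero_right this
    simpa using this.symm
  -- the multiplier
  obtain ⟨j, hj2, hj3, hjp⟩ : ∃ j, 2 ≤ j ∧ j ≤ 3 ∧ Nat.Coprime j p := by
    by_cases h : p = 2
    · exact ⟨3, by omega, by omega, by rw [h]; decide⟩
    · exact ⟨2, by omega, by omega, (Nat.coprime_primes Nat.prime_two hp).2 (Ne.symm h)⟩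
  have hjN : Nat.Coprime j N := by rw [hN]; exact hjp.pow_right k
  obtain ⟨t, s, hts⟩ : ∃ t s : ℕ, j * t = 1 + s * N := by
    obtain ⟨t, ht⟩ := Nat.exists_mul_mod_eq_one_of_coprime hjN (by omega)
    refine ⟨t, j * t / N, ?_⟩
    have := Nat.mod_add_div (j * t) N
    rw [ht.2] at this
    rw [mul_comm (j * t / N)]; exact this.symm
  obtain ⟨Y, V, hYV, hYO, hVO, hYc, hV⟩ := reduce_mod (E : Set G) _ (j • F) le_rfl (hF.nsmul j)
  have hYs : Y.sum = j • g := by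
    have : (j • F).sum = Y.sum + V.sum := by rw [hYV, Multiset.sum_add]
    rw [hV.sum, add_zero, Multiset.sum_nsmul, hFs] at this
    exact this.symm
  have hYg : Y.count g = 0 := Multiset.count_eq_zero.2 fun h => h1 (by simpa using hYO _ h)
  have hYg' : Y.count (-g) = 0 := Multiset.count_eq_zero.2 fun h => h2 (by simpa using hYO _ h)
  have hNF : HF1 (N • F) := hf1_pow N F fun x hx => hS x (hE x (by simpa using hF x hx))
  have hcount : ∀ (a : ℕ) (x : G), a ≤ N → addOrderOf x = N → Y.count x = 0 → ∀ y,
      (Multiset.replicate a x + Y).count y ≤ addOrderOf y := by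
    intro a x ha hx hY y
    rw [Multiset.count_add, Multiset.count_replicate]
    split_ifs with h
    · rw [← h, hY]; omega
    · simpa using hYc y
  have d1 : HF1 (Multiset.replicate j (-g) + Y) ∨ Atom (Multiset.replicate j (-g) + Y) := by
    apply hf1_or_atom hG1 ((Finset.card_insert_le _ _).trans (by omega))
      ((over_replicate m1 _).add (hYO.mono hE1))
    · rw [Multiset.sum_add, Multiset.sum_replicate, hYs]; simp
    · intro x _; exact hcount j (-g) (by omega) (by simpa using ho) hYg' x
  have hNg : N • g = 0 := hS g hg
  have d2 : HF1 (Multiset.replicate (N - j) g + Y) ∨ Atom (Multiset.replicate (N - j) g + Y) := by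
    apply hf1_or_atom hG2 ((Finset.card_insert_le _ _).trans (by omega))
      ((over_replicate m2 _).add (hYO.mono hE2))
    · rw [Multiset.sum_add, Multiset.sum_replicate, hYs, ← add_nsmul, Nat.sub_add_cancel (by omega), hNg]
    · intro x _; exact hcount (N - j) g (by omega) ho hYg x
  rcases d1 with d1 | d1
  · -- `U = (-g) F` is half factorial
    have e1 : j • (-g ::ₘ F) = (Multiset.replicate j (-g) + Y) + V := by
      rw [← Multiset.singleton_add, nsmul_add, hYV, Multiset.nsmul_singleton, add_assoc]
    have hj : HF1 (t • (j • (-g ::ₘ F))) := by rw [e1]; exact (d1.add hV).nsmul t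
    rw [← mul_nsmul, hts, add_nsmul, one_nsmul, mul_comm s, mul_nsmul] at hj
    have hO : Over ((insert (-g) E : Finset G) : Set G) (-g ::ₘ F) := by
      intro x hx
      rcases Multiset.mem_cons.1 hx with rfl | hx
      · exact m1
      · exact hE1 (hF x hx)
    have hVV : HF1 (s • N • (-g ::ₘ F)) := (hf1_pow N _ (by
      intro x hx
      rcases Multiset.mem_cons.1 hx with rfl | hx
      · exact hS _ hg'
      · exact hS x (hE x (by simpa using hF x hx)))).nsmul s
    have := preserve hG1 hO ((hO.nsmul N).nsmul s) hVV hj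
    have := this.of_atom hM.2.2.1
    rw [(mx_kq ho F).1] at this
    linarith
  rcases d2 with d2 | d2
  · exfalso
    have hjt : s + 1 ≤ t := by
      by_contra hc
      have : t ≤ s := by omega
      have : j * t ≤ N * s := Nat.mul_le_mul (by omega) this
      rw [hts, mul_comm s] at this
      omega
    obtain ⟨u, rfl⟩ := Nat.exists_eq_add_of_le hjt
    have hj : HF1 ((s + 1 + u) • ((Multiset.replicate (N - j) g + Y) + V)) := (d2.add hV).nsmul _
    have e2 : (s + 1 + u) • ((Multiset.replicate (N - j) g + Y) + V) =
        (Multiset.replicate (N - 1) g + F) + (u • rep g + s • N • F) := by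
      rw [add_assoc (Multiset.replicate (N - j) g), ← hYV, nsmul_add, ← mul_nsmul, hts, add_nsmul F 1, one_nsmul, mul_comm s, mul_nsmul,
        Multiset.nsmul_replicate, rep, ho, Multiset.nsmul_replicate]
      have : (s + 1 + u) * (N - j) = (N - 1) + u * N := by
        obtain ⟨M, rfl⟩ := Nat.exists_eq_add_of_le (show j ≤ N by omega)
        have h3 : j + M - j = M := by omega
        rw [h3]
        have h4 : (s + 1 + u) * (j + M) = 1 + s * (j + M) + (s + 1 + u) * M := by rw [mul_add, mul_comm _ j, hts]
        have h5 : (s + 1 + u) * (j + M) = s * (j + M) + (j + M) + u * (j + M) := by ring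
        omega
      rw [this, Multiset.replicate_add]
      abel
    rw [e2] at hj
    have hO : Over ((insert g E : Finset G) : Set G) (Multiset.replicate (N - 1) g + F) :=
      (over_replicate m2 _).add (hF.mono hE2)
    have := preserve hG2 hO (((over_rep m2).nsmul u).add (((hF.mono hE2).nsmul N).nsmul s))
      (((HF1.rep g).nsmul u).add (hNF.nsmul s)) hj
    have h3 := this.of_atom hM.2.2.2
    rw [(mx_kq ho F).2, hN1] at h3
    have h4 := hG1.lcn _ (fun x hx => by
      rcases Multiset.mem_cons.1 hx with rfl | hx
      · exact m1
      · exact hE1 (hF x hx)) hM.2.2.1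
    rw [(mx_kq ho F).1] at h4
    have : (N - 1 : ℚ) / N = 1 - 1 / N := by field_simp
    rw [this] at h3
    have : (1:ℚ) / N ≤ 1 / 5 := one_div_le_one_div_of_le (by norm_num) hN5
    linarith
  · exfalso
    have hO : Over S ((Multiset.replicate j (-g) + Y) + rep g) :=
      ((over_replicate hg' _).add (hYO.mono hE)).add (over_rep hg)
    have hg0 : g ≠ 0 := by rintro rfl; simp at ho; omega
    have f1 : Fac ({Multiset.replicate j (-g) + Y} + {rep g}) ((Multiset.replicate j (-g) + Y) + rep g) :=
      (Fac.single d1).add (Fac.single (rep_atom g))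
    have f2 : Fac ({Multiset.replicate (N - j) g + Y} + j • {({g, -g} : Multiset G)})
        ((Multiset.replicate j (-g) + Y) + rep g) := by
      have := (Fac.single d2).add ((Fac.single (atom_pair hg0)).nsmul j)
      refine ⟨this.1, this.2.trans ?_⟩
      rw [show ({g, -g} : Multiset G) = {g} + {-g} from rfl, nsmul_add, Multiset.nsmul_singleton,
        Multiset.nsmul_singleton, rep, ho]
      have : Multiset.replicate N g = Multiset.replicate (N - j) g + Multiset.replicate j g := by
        rw [← Multiset.replicate_add, Nat.sub_add_cancel (by omega)]
      rw [this]; abel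
    have h3 := hC _ hO _ _ f2 f1
    simp at h3
    have h4 := int_gap h3 (by omega)
    omega

/-- a half factorial sequence has integral cross number -/
lemma not_hf1_of_kq {B : Multiset G} {m : ℤ} {x : ℚ} (h : kq B = m + x) (h0 : 0 < x) (h1 : x < 1) :
    ¬ HF1 B := by
  intro hB
  obtain ⟨F, -, hF⟩ := hB.exists_card
  rw [h] at hF
  have e1 : (m:ℚ) < (Multiset.card F : ℤ) := by push_cast; linarith
  have e2 : ((Multiset.card F : ℤ) : ℚ) < ((m + 1 : ℤ) : ℚ) := by push_cast; linarith
  have e3 : m < (Multiset.card F : ℤ) := by exact_mod_cast e1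
  have e4 : (Multiset.card F : ℤ) < m + 1 := by exact_mod_cast e2
  omega

lemma mx_sqf (hC : Cong S d) (hNd : N = d + 2) (hd : 3 ≤ d) (hS : ∀ g ∈ S, N • g = 0)
    (hk : ∀ A, Over S A → Atom A → kq A < d + 1) {p k : ℕ} (hp : p.Prime) (hN : N = p ^ k)
    (hg : g ∈ S) (hg' : -g ∈ S) (ho : addOrderOf g = N) {E : Finset G} (hE : ∀ e ∈ E, e ∈ S)
    (hEc : E.card ≤ d + 1) (h1 : g ∉ E) (h2 : -g ∉ E)
    (hind : ∀ e ∈ E, ∀ c : ℤ, IsCoprime c (p:ℤ) →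
        c • e ∉ AddSubgroup.closure ((E.erase e : Finset G) : Set G))
    {F : Multiset G} (hF : Over (E : Set G) F) (hM : Mx N g F) :
    F = E.val ∧ E.card = d + 1 ∧ ∀ e ∈ E, addOrderOf e = N := by
  obtain ⟨hG, hkF⟩ := mx_kq_one hC hNd hd hS hk hp hN hg hg' ho hE hEc h1 h2 hind hF hM
  have hN5 : (5:ℚ) ≤ N := by exact_mod_cast (by omega : 5 ≤ N)
  have hNq : (N:ℚ) = d + 2 := by rw [hNd]; push_cast; ring
  have hFs : F.sum = g := by
    have := hM.2.2.1.sum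
    rw [Multiset.sum_cons] at this
    have := neg_eq_of_add_eq_zero_right this
    simpa using this.symm
  have hcle : ∀ x, F.count x ≤ addOrderOf x := fun x =>
    (Multiset.count_le_of_le x (Multiset.le_cons_self F (-g))).trans (hM.2.2.1.count_le x)
  have hTE : F.toFinset ⊆ E := fun x hx => by simpa using hF x (by simpa using hx)
  obtain ⟨Q, hQ⟩ := Multiset.le_iff_exists_add.1
    (le_sum_rep F.toFinset (fun x hx => by simpa using hx) (fun x _ => hcle x))
  have hkR : kq (∑ x ∈ F.toFinset, rep x) = F.toFinset.card := by
    have := fac_wt_eq (w := fun g => 1 / (addOrderOf g : ℚ)) (κ := 1) (B := ∑ g ∈ F.toFinset, rep g)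
      (F := F.toFinset.val.map rep) rfl (by
        intro A hA
        obtain ⟨x, -, rfl⟩ := Multiset.mem_map.1 hA
        exact kq_rep x)
    rw [show kq (∑ x ∈ F.toFinset, rep x) = _ from this, Multiset.card_map, mul_one]
    rfl
  have hsR : (∑ x ∈ F.toFinset, rep x).sum = 0 := by
    have : HF1 (∑ x ∈ F.toFinset, rep x) := HF1.msum (by
      intro A hA; obtain ⟨g, -, rfl⟩ := Multiset.mem_map.1 hA; exact HF1.rep g)
    exact this.sum
  have hQO : Over (F.toFinset : Set G) Q := by
    intro x hx
    have : x ∈ ∑ x ∈ F.toFinset, rep x := by rw [hQ]; exact Multiset.mem_add.2 (Or.inr hx)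
    rw [Multiset.mem_sum] at this
    obtain ⟨y, hy, hxy⟩ := this
    rw [Multiset.eq_of_mem_replicate hxy]; exact hy
  have hQc : ∀ x, Q.count x ≤ addOrderOf x := by
    intro x
    by_cases hx : x ∈ F.toFinset
    · have e1 : Q.count x ≤ (∑ x ∈ F.toFinset, rep x).count x := by
        rw [hQ]; exact Multiset.count_le_of_le x (Multiset.le_add_left _ _)
      rw [Multiset.count_sum', Finset.sum_eq_single x] at e1
      · simpa [rep] using e1
      · intro b _ hb
        simp [rep, Multiset.count_replicate, hb]
      · intro h; exact absurd hx h
    · rw [Multiset.count_eq_zero.2 fun h => hx (hQO x h)]; exact Nat.zero_le _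
  have hQg : Q.count g = 0 := Multiset.count_eq_zero.2 fun h => h1 (hTE (hQO _ h))
  have hs : (g ::ₘ Q).sum = 0 := by
    rw [hQ, Multiset.sum_add, hFs] at hsR
    rw [Multiset.sum_cons]; exact hsR
  have hkQ : kq (g ::ₘ Q) = ((F.toFinset.card - 1 : ℤ) : ℚ) + 2 / N := by
    rw [hQ, kq_add, hkF] at hkR
    rw [kq_cons, ho]; push_cast
    rw [← hkR]; ring
  have hn : ¬ HF1 (g ::ₘ Q) := not_hf1_of_kq hkQ (by positivity) (by
    rw [div_lt_one (by linarith)]; linarith)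
  obtain ⟨F1, hF1⟩ := exists_fac _ hs
  have hsub : (((insert g F.toFinset) : Finset G) : Set G) ⊆ ((insert g E : Finset G) : Set G) := by
    exact_mod_cast Finset.insert_subset_insert g hTE
  have h3 := s2 hG hs (insert g F.toFinset) (fun x hx => hsub hx) (le_sum_rep _ (by
      intro x hx
      rcases Multiset.mem_cons.1 hx with rfl | hx
      · simp
      · have := hQO x hx
        simp at this ⊢; tauto) (by
      intro x _
      rw [Multiset.count_cons]
      split_ifs with hx
      · rw [hx, hQg, ho]; omega
      · simpa using hQc x)) hn hF1
  have h4 := hF1.pos (by simp)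
  have h5 := Finset.card_insert_le g F.toFinset
  have h6 := Finset.card_le_card hTE
  have hEF : F.toFinset = E := Finset.eq_of_subset_of_card_le hTE (by omega)
  have hEcard : E.card = d + 1 := by omega
  -- all multiplicities are one
  have hord : ∀ x ∈ S, addOrderOf x ≤ N := fun x hx =>
    Nat.le_of_dvd (by omega) (addOrderOf_dvd_of_nsmul_eq_zero (hS x hx))
  have hkF' : ∑ x ∈ E, (1 / N : ℚ) = ∑ x ∈ E, (F.count x : ℚ) * (1 / (addOrderOf x : ℚ)) := by
    have : kq F = ∑ x ∈ E, (F.count x : ℚ) * (1 / (addOrderOf x : ℚ)) := by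
      have := wt_finset (fun g => 1 / (addOrderOf g : ℚ)) F
      rw [hEF] at this; exact this
    rw [← this, hkF, Finset.sum_const, hEcard, nsmul_eq_mul]
    push_cast
    rw [hNq]; field_simp; ring
  have hle : ∀ x ∈ E, (1 / N : ℚ) ≤ (F.count x : ℚ) * (1 / (addOrderOf x : ℚ)) := by
    intro x hx
    have c1 : (1:ℚ) ≤ F.count x := by
      have : x ∈ F := by rw [← hEF] at hx; simpa using hx
      exact_mod_cast Multiset.one_le_count_iff_mem.2 this
    have c2 : (1 / N : ℚ) ≤ 1 / (addOrderOf x : ℚ) :=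
      one_div_le_one_div_of_le (by exact_mod_cast ord_pos x) (by exact_mod_cast hord x (hE x hx))
    have c3 : (0:ℚ) ≤ 1 / (addOrderOf x : ℚ) := by positivity
    nlinarith
  have heq := (Finset.sum_eq_sum_iff_of_le hle).1 hkF'
  have hboth : ∀ x ∈ E, F.count x = 1 ∧ addOrderOf x = N := by
    intro x hx
    have e1 := heq x hx
    have hpos : (0:ℚ) < addOrderOf x := by exact_mod_cast ord_pos x
    have e2 : (addOrderOf x : ℚ) = F.count x * N := by
      field_simp at e1; linarith
    have e3 : addOrderOf x = F.count x * N := by exact_mod_cast e2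
    have e4 := hord x (hE x hx)
    have e5 : 1 ≤ F.count x := by
      have : x ∈ F := by rw [← hEF] at hx; simpa using hx
      exact Multiset.one_le_count_iff_mem.2 this
    have e6 : F.count x = 1 := by
      by_contra hc
      have : 2 * N ≤ F.count x * N := Nat.mul_le_mul_right N (by omega)
      omega
    rw [e6] at e3
    exact ⟨e6, by omega⟩
  refine ⟨?_, hEcard, fun e he => (hboth e he).2⟩
  ext x
  by_cases hx : x ∈ E
  · rw [(hboth x hx).1, Multiset.count_eq_one_of_mem E.nodup hx]
  · rw [Multiset.count_eq_zero.2 fun h => hx (by simpa using hF x h),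
      Multiset.count_eq_zero.2 fun h => hx h]

/-- structure of mixing sequences -/
lemma mx_struct (hC : Cong S d) (hNd : N = d + 2) (hd : 3 ≤ d) (hS : ∀ g ∈ S, N • g = 0)
    (hk : ∀ A, Over S A → Atom A → kq A < d + 1) {p k : ℕ} (hp : p.Prime) (hN : N = p ^ k)
    (hNI : ∀ q : ℕ, q.Prime → ¬ Indep q (d + 2) G)
    (hg : g ∈ S) (hg' : -g ∈ S) (ho : addOrderOf g = N)
    {F : Multiset G} (hF : Over S F) (hM : Mx N g F) :
    ∃ E : Finset G, F = E.val ∧ E.card = d + 1 ∧ (∀ e ∈ E, addOrderOf e = N) ∧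
      ∀ e ∈ E, ∀ c : ℤ, IsCoprime c (p:ℤ) →
        c • e ∉ AddSubgroup.closure ((E.erase e : Finset G) : Set G) := by
  have hg0 : g ≠ 0 := by rintro rfl; simp at ho; omega
  have hFs : F.sum = g := by
    have := hM.2.2.1.sum
    rw [Multiset.sum_cons] at this
    have := neg_eq_of_add_eq_zero_right this
    simpa using this.symm
  obtain ⟨q, E, c, hq, hEF, hEc, hqg, hc0, hcE, -, hind⟩ := mixing_basis (a := 0) hNI hg0 hFs
  have hqp : q = p := by
    rw [ho, hN] at hqg
    exact (Nat.prime_dvd_prime_iff_eq hq hp).1 (hq.dvd_of_dvd_pow hqg)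
  subst hqp
  have hE : ∀ e ∈ E, e ∈ F := fun e he => by simpa using hEF he
  have hES : ∀ e ∈ E, e ∈ S := fun e he => hF e (hE e he)
  have h1 : g ∉ E := fun h => hM.1 (hE _ h)
  have h2 : -g ∉ E := fun h => hM.2.1 (hE _ h)
  rw [← natCast_zsmul] at hc0 hcE
  obtain ⟨F', hF', hM'⟩ := mx_exists hC hNd (by omega) hg hg' ho hES h1 h2 hcE hc0
  rcases hM' with hM' | hM'
  · obtain ⟨e1, e2, e3⟩ := mx_sqf hC hNd hd hS hk hp hN hg hg' ho hES hEc h1 h2 hind hF' hM'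
    refine ⟨E, ?_, e2, e3, hind⟩
    have hle : F' ≤ F := by
      rw [e1]; exact (Multiset.le_iff_subset E.nodup).2 fun x hx => hE x hx
    have := hM.2.2.1.min (Multiset.cons_le_cons (-g) hle) hM'.2.2.1.sum (by simp)
    rw [← e1]
    exact ((Multiset.cons_inj_right _).1 this).symm
  · exfalso
    obtain ⟨e1, e2, e3⟩ := mx_sqf hC hNd hd hS hk hp hN hg' (by simpa using hg) (by simpa using ho)
      hES hEc h2 (by simpa using h1) hind hF' hM'
    have hle : F' ≤ F := by
      rw [e1]; exact (Multiset.le_iff_subset E.nodup).2 fun x hx => hE x hx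
    have hA := hM'.2.2.1
    rw [neg_neg] at hA
    have hle2 : g ::ₘ F' ≤ Multiset.replicate (N - 1) g + F := by
      rw [← Multiset.singleton_add]
      refine add_le_add ?_ hle
      rw [Multiset.singleton_le]
      exact Multiset.mem_replicate.2 ⟨by omega, rfl⟩
    have := congrArg (Multiset.count g) (hM.2.2.2.min hle2 hA.sum (by simp))
    rw [Multiset.count_cons_self, Multiset.count_add, Multiset.count_replicate_self,
      Multiset.count_eq_zero.2 hM.1, Multiset.count_eq_zero.2 fun h => hM.1 (Multiset.mem_of_le hle h)] at this
    omega

lemma mx_nonpair (hC : Cong S d) (hNd : N = d + 2) (hd : 3 ≤ d) (hS : ∀ g ∈ S, N • g = 0)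
    (hk : ∀ A, Over S A → Atom A → kq A < d + 1) {p k : ℕ} (hp : p.Prime) (hN : N = p ^ k)
    (hNI : ∀ q : ℕ, q.Prime → ¬ Indep q (d + 2) G)
    (hg : g ∈ S) (hg' : -g ∈ S) (ho : addOrderOf g = N)
    {F : Multiset G} (hF : Over S F) (hM : Mx N g F) :
    Multiset.card F = d + 1 ∧ (∀ e ∈ F, addOrderOf e = N) ∧ ∀ e ∈ F, -e ∉ S := by
  obtain ⟨E, rfl, hEc, hEo, hind⟩ := mx_struct hC hNd hd hS hk hp hN hNI hg hg' ho hF hM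
  refine ⟨hEc, fun e he => hEo e he, fun e he heS => ?_⟩
  have he : e ∈ E := he
  have hFs : E.val.sum = g := by
    have := hM.2.2.1.sum
    rw [Multiset.sum_cons] at this
    have := neg_eq_of_add_eq_zero_right this
    simpa using this.symm
  have hgE : g ∉ E := fun h => hM.1 h
  have hgE' : -g ∉ E := fun h => hM.2.1 h
  have hneg : -e ∉ E := by
    intro h
    refine hind (-e) h 1 isCoprime_one_left ?_
    rw [one_smul]
    apply AddSubgroup.neg_mem
    apply AddSubgroup.subset_closure
    have : e ≠ -e := ne_neg_of_ord (by rw [hEo e he]; omega)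
    simp [he, this]
  have hEr : -e ∉ E.erase e := fun h => hneg (Finset.mem_of_mem_erase h)
  let E2 : Finset G := insert (-e) (E.erase e)
  have hE2S : ∀ x ∈ E2, x ∈ S := by
    intro x hx
    rcases Finset.mem_insert.1 hx with rfl | hx
    · exact heS
    · exact hF x (Finset.mem_of_mem_erase hx)
  have hE2c : E2.card = d + 1 := by
    rw [Finset.card_insert_of_notMem hEr, Finset.card_erase_of_mem he]; omega
  have hind2 : ∀ x ∈ E2, ∀ c : ℤ, IsCoprime c (p:ℤ) →
      c • x ∉ AddSubgroup.closure ((E2.erase x : Finset G) : Set G) := by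
    intro x hx c hc hmem
    rcases Finset.mem_insert.1 hx with rfl | hx
    · rw [show E2.erase (-e) = E.erase e from Finset.erase_insert hEr] at hmem
      apply hind e he c hc
      have := AddSubgroup.neg_mem _ hmem
      simpa using this
    · obtain ⟨hxe, hxE⟩ := Finset.mem_erase.1 hx
      apply hind x hxE c hc
      refine (AddSubgroup.closure_le _).2 ?_ hmem
      intro y hy
      have hy : y ∈ E2.erase x := hy
      obtain ⟨hyx, hy⟩ := Finset.mem_erase.1 hy
      rcases Finset.mem_insert.1 hy with rfl | hy
      · apply AddSubgroup.neg_mem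
        apply AddSubgroup.subset_closure
        simp [he, Ne.symm hxe]
      · apply AddSubgroup.subset_closure
        simp [Finset.mem_of_mem_erase hy, hyx]
  have hgE2 : g ∉ E2 := by
    intro h
    rcases Finset.mem_insert.1 h with h | h
    · apply hgE'; rw [h, neg_neg]; exact he
    · exact hgE (Finset.mem_of_mem_erase h)
  have hgE2' : -g ∉ E2 := by
    intro h
    rcases Finset.mem_insert.1 h with h | h
    · apply hgE; rw [neg_inj.1 h]; exact he
    · exact hgE' (Finset.mem_of_mem_erase h)
  have good : ∀ x, x ∈ S → addOrderOf x = N → -x ∉ E2 → Good ((insert x E2 : Finset G) : Set G) d := by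
    intro x hx hxo hxE
    have hsub : ((insert x E2 : Finset G) : Set G) ⊆ S := by
      intro y hy
      rcases Finset.mem_insert.1 hy with rfl | hy
      · exact hx
      · exact hE2S y hy
    refine ⟨hC.mono hsub, ?_, by omega, fun y hy => ?_, fun A hO hA => hk A (hO.mono hsub) hA⟩
    · rw [Finset.coe_insert]
      exact lcn_insert hC hNd (by omega) hS hx hxo hE2S hind2 hxE
    · have := Nat.le_of_dvd (by omega) (addOrderOf_dvd_of_nsmul_eq_zero (hS y (hsub hy)))
      omega
  let F2 : Multiset G := Multiset.replicate (N - 1) (-e) + (E.erase e).val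
  have hF2O : Over (E2 : Set G) F2 := by
    refine (over_replicate (by simp [E2]) _).add ?_
    intro x hx
    have hx : x ∈ E.erase e := hx
    exact Finset.mem_coe.2 (Finset.mem_insert_of_mem hx)
  have hF2s : F2.sum = g := by
    have h1 : e + (E.erase e).val.sum = g := by
      rw [← hFs, ← Multiset.sum_cons, ← Finset.insert_val_of_notMem (Finset.notMem_erase e E),
        Finset.insert_erase he]
    have h2 : (N - 1) • e + e = 0 := by
      rw [← succ_nsmul, show N - 1 + 1 = N by omega]
      exact hS e (hF e he)
    rw [Multiset.sum_add, Multiset.sum_replicate, smul_neg, ← h1, eq_neg_of_add_eq_zero_left h2, neg_neg]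
  have hF2k : kq F2 = ((N - 1 : ℕ) : ℚ) / N + ((N - 2 : ℕ) : ℚ) / N := by
    rw [kq_add, kq_replicate, addOrderOf_neg, hEo e he]
    congr 1
    have : kq (E.erase e).val = _ := wt_congr (w' := fun _ => (1:ℚ) / N) (fun x hx => by
      rw [hEo x (Finset.mem_of_mem_erase hx)])
    rw [this]
    have hc : Multiset.card (E.erase e).val = N - 2 := by
      have := Finset.card_erase_of_mem he
      rw [← Finset.card_def]; omega
    simp only [wt, Multiset.map_const', Multiset.sum_replicate, hc, nsmul_eq_mul]
    ring
  have hF2c : ∀ x, F2.count x ≤ addOrderOf x := by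
    intro x
    rw [Multiset.count_add, Multiset.count_replicate]
    split_ifs with h
    · rw [← h, Multiset.count_eq_zero.2 fun h => hEr h, addOrderOf_neg, hEo e he]; omega
    · have h1 := Multiset.nodup_iff_count_le_one.1 (E.erase e).nodup x
      have := ord_pos x
      omega
  have hcount : ∀ (a : ℕ) (x : G), a ≤ N → addOrderOf x = N → x ∉ E2 → ∀ y,
      (Multiset.replicate a x + F2).count y ≤ addOrderOf y := by
    intro a x ha hx hY y
    rw [Multiset.count_add, Multiset.count_replicate]
    split_ifs with h
    · rw [← h, Multiset.count_eq_zero.2 fun h => hY (hF2O x h)]; omega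
    · simpa using hF2c y
  have hN5 : (5:ℚ) ≤ N := by exact_mod_cast (by omega : 5 ≤ N)
  have hN0 : (N:ℚ) ≠ 0 := by linarith
  have hN1 : ((N - 1 : ℕ) : ℚ) = N - 1 := by rw [Nat.cast_sub (by omega)]; simp
  have hN2 : ((N - 2 : ℕ) : ℚ) = N - 2 := by rw [Nat.cast_sub (by omega)]; simp
  rw [hN1, hN2] at hF2k
  have hE1' : ∀ x, (E2 : Set G) ⊆ ((insert x E2 : Finset G) : Set G) := by
    intro x y hy; exact Finset.mem_coe.2 (Finset.mem_insert_of_mem hy)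
  have a1 : Atom (-g ::ₘ F2) := by
    have e1 : -g ::ₘ F2 = Multiset.replicate 1 (-g) + F2 := by simp
    rw [e1]
    refine (hf1_or_atom (good (-g) hg' (by simpa using ho) (by simpa using hgE2))
      ((Finset.card_insert_le _ _).trans (by omega))
      ((over_replicate (by simp) _).add (hF2O.mono (hE1' _))) ?_ ?_).resolve_left ?_
    · rw [Multiset.sum_add, hF2s]; simp
    · intro x _; exact hcount 1 (-g) (by omega) (by simpa using ho) hgE2' x
    · rw [← e1]
      refine not_hf1_of_kq (m := 1) (x := (N - 2) / N) ?_ (div_pos (by linarith) (by linarith)) ?_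
      · rw [(mx_kq ho F2).1, hF2k]; push_cast; field_simp; ring
      · rw [div_lt_one (by linarith)]; linarith
  have a2 : Atom (Multiset.replicate (N - 1) g + F2) := by
    refine (hf1_or_atom (good g hg ho hgE2')
      ((Finset.card_insert_le _ _).trans (by omega))
      ((over_replicate (by simp) _).add (hF2O.mono (hE1' _))) ?_ ?_).resolve_left ?_
    · rw [Multiset.sum_add, hF2s, Multiset.sum_replicate, ← succ_nsmul, show N - 1 + 1 = N by omega]
      exact hS g hg
    · intro x _; exact hcount (N - 1) g (by omega) ho hgE2 x
    · refine not_hf1_of_kq (m := 2) (x := (N - 4) / N) ?_ (div_pos (by linarith) (by linarith)) ?_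
      · rw [(mx_kq ho F2).2, hF2k, hN1]; push_cast; field_simp; ring
      · rw [div_lt_one (by linarith)]; linarith
  obtain ⟨E3, hE3, -⟩ := mx_struct hC hNd hd hS hk hp hN hNI hg hg' ho
    (hF2O.mono hE2S) ⟨fun h => hgE2 (hF2O _ h), fun h => hgE2' (hF2O _ h), a1, a2⟩
  have h1 := Multiset.nodup_iff_count_le_one.1 E3.nodup (-e)
  rw [← hE3, Multiset.count_add, Multiset.count_replicate_self] at h1
  omega

/-- weights on congruence sets in the case `N = d + 2` -/
lemma weight_top {p k : ℕ} (h : Homog G p k (d + 1)) (hNd : p ^ k = d + 2) (hd : 3 ≤ d)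
    (hC : Cong S d) : ∃ (w : G → ℚ) (κ : ℚ), (∀ g, 0 ≤ w g) ∧ 0 ≤ κ ∧ κ < d + 1 ∧
      ∀ A, Over S A → Atom A → 1 ≤ wt w A ∧ wt w A ≤ κ := by
  obtain ⟨N, hN⟩ : ∃ N, N = p ^ k := ⟨_, rfl⟩
  have hNd' : N = d + 2 := by omega
  have hS : ∀ g ∈ S, N • g = 0 := fun g _ => by rw [hN]; exact h.tors g
  have hk : ∀ A, Over S A → Atom A → kq A < d + 1 := fun A _ hA => by
    have := h.kq_lt (by omega) hA
    push_cast at this; exact this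
  have hNI : ∀ q : ℕ, q.Prime → ¬ Indep q (d + 2) G := fun q hq => h.not_indep (by omega) hq
  have hN5 : (5:ℚ) ≤ N := by exact_mod_cast (by omega : 5 ≤ N)
  have hNq : (N:ℚ) = d + 2 := by rw [hNd']; push_cast; ring
  let X : Set G := {g | g ∈ S ∧ -g ∈ S ∧ addOrderOf g = N}
  have hXneg : ∀ g ∈ X, -g ∈ X := fun g hg =>
    ⟨hg.2.1, by simpa using hg.1, by simpa using hg.2.2⟩
  let w : G → ℚ := fun g => if g ∈ X then 1 / 2 else 1 / (addOrderOf g : ℚ)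
  have hwMx : ∀ g ∈ X, ∀ F, Over S F → Mx N g F → wt w F = 1 - 1 / N := by
    intro g hg F hF hM
    obtain ⟨h1, h2, h3⟩ := mx_nonpair hC hNd' hd hS hk h.prime hN hNI hg.1 hg.2.1 hg.2.2 hF hM
    have : wt w F = _ := wt_congr (w' := fun _ => (1:ℚ) / N) (fun x hx => by
      simp only [w]
      rw [if_neg (fun hX => h3 x hx hX.2.1), h2 x hx])
    rw [this]
    simp only [wt, Multiset.map_const', Multiset.sum_replicate, h1, nsmul_eq_mul]
    push_cast
    rw [hNq]; field_simp; ring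
  have hinv : (0:ℚ) < 1 / N ∧ (1:ℚ) / N ≤ 1 / 5 :=
    ⟨by positivity, one_div_le_one_div_of_le (by norm_num) hN5⟩
  refine ⟨w, N - 2 + 1 / 2 + 2 * (1 / N), fun g => by simp only [w]; split_ifs <;> positivity,
    by linarith, by linarith, ?_⟩
  intro A hO hA
  by_cases hX : ∃ g ∈ X, g ∈ A
  · obtain ⟨g, hg, hgA⟩ := hX
    have hwg : w g = 1 / 2 := if_pos hg
    have hgn : g ≠ -g := ne_neg_of_ord (by rw [hg.2.2]; omega)
    have hg0 : g ≠ 0 := by rintro rfl; have := hg.2.2; simp at this; omega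
    by_cases h2 : -g ∈ A
    · rw [atom_card_two hA hgA h2 (Or.inr hgn) hg0,
        show ({g, -g} : Multiset G) = g ::ₘ -g ::ₘ 0 from rfl, wt_cons, wt_cons, wt_zero, hwg,
        show w (-g) = 1 / 2 from if_pos (hXneg g hg)]
      constructor <;> linarith
    have hd1 := decomp A g
    have hca := Multiset.one_le_count_iff_mem.2 hgA
    obtain ⟨a, ha⟩ : ∃ a, a = A.count g := ⟨_, rfl⟩
    obtain ⟨R, hR⟩ : ∃ R, R = A.filter (fun x => x ≠ g) := ⟨_, rfl⟩
    rw [← ha, ← hR] at hd1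
    rw [← ha] at hca
    have hRO : Over S R := by rw [hR]; exact hO.le (Multiset.filter_le _ _)
    have hRg : g ∉ R := by rw [hR]; simp
    have hRg' : -g ∉ R := by rw [hR]; intro h; exact h2 (Multiset.mem_of_mem_filter h)
    have hwA : wt w A = a * (1 / 2) + wt w R := by
      rw [hd1, wt_add, wt_replicate, hwg]
    by_cases hR0 : R = 0
    · have h1 := hA.sum
      rw [hd1, hR0, add_zero, Multiset.sum_replicate] at h1
      have h3 := Nat.le_of_dvd hca (addOrderOf_dvd_of_nsmul_eq_zero h1)
      have h4 := hA.count_le g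
      rw [hg.2.2] at h3 h4
      have h5 : a = N := by omega
      rw [hwA, hR0, wt_zero, h5]
      constructor <;> linarith
    rw [hd1] at hA
    obtain ⟨haN, hm⟩ := mix2 hC hNd' (by omega) hg.1 hg.2.1 hg.2.2 hca hRO hR0 hRg hRg' hA
    rcases hm with ⟨ha1, hM⟩ | ⟨M, hMc, hMs, hM⟩
    · rw [hwA, ha1, hwMx (-g) (hXneg g hg) R hRO hM]
      push_cast
      constructor <;> linarith
    · have hMO : ∀ Y ∈ M, Over S Y := fun Y hY => hRO.le (by rw [← hMs]; exact le_sum_of_mem hY)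
      have hwR := fac_wt_eq (w := w) (κ := 1 - 1 / N) hMs fun Y hY => hwMx g hg Y (hMO Y hY) (hM Y hY)
      obtain ⟨b, hb⟩ : ∃ b, N = a + b := ⟨N - a, by omega⟩
      rw [hwA, hwR, hMc, show N - a = b by omega]
      have hbN : (N:ℚ) = a + b := by exact_mod_cast hb
      have ha1 : (1:ℚ) ≤ a := by exact_mod_cast hca
      have hb1 : (1:ℚ) ≤ b := by exact_mod_cast (by omega : 1 ≤ b)
      obtain ⟨i, hi⟩ : ∃ i, i = (1:ℚ) / N := ⟨_, rfl⟩
      have hNi : (N:ℚ) * i = 1 := by rw [hi]; field_simp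
      rw [← hi] at hinv ⊢
      obtain ⟨i0, i1⟩ := hinv
      have hbe : (b:ℚ) = N - a := by linarith
      constructor
      · nlinarith
      · have : (a:ℚ) * (1 / 2) + b * (1 - i) = N - 1 - a * (1 / 2 - i) := by
          rw [hbe]; linear_combination -hNi
        rw [this]
        nlinarith
  · push Not at hX
    have h2 : wt w A = kq A := wt_congr fun x hx => if_neg fun h => hX x h hx
    rw [h2]
    constructor
    · by_contra hc
      push Not at hc
      obtain ⟨g, hg, hg', ho, rfl⟩ := pair_of_small hC (by omega) hS hNd' hO hA hc
      exact hX g ⟨hg, hg', ho⟩ (by simp)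
    · have h3 := h.kq_le (by omega) hA
      have hpk : ((p:ℚ) ^ k) = N := by rw [hN]; push_cast; rfl
      rw [hpk] at h3
      push_cast at h3
      have h4 : (d:ℚ) = N - 2 := by linarith
      rw [h4] at h3
      have h5 : kq A ≤ ((N - 2 + 1) * (N - 1) + 1) / N := by
        rw [le_div_iff₀ (by linarith)]; linarith
      have h6 : ((N - 2 + 1) * (N - 1) + 1 : ℚ) / N = N - 2 + 2 * (1 / N) := by field_simp; ring
      linarith

end squarefree

end LSys

namespace LSys

section final

variable {G G' : Type*} [AddCommGroup G] [Finite G] [AddCommGroup G'] [Finite G'] {p k r : ℕ}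

/-- weights on congruence sets of `G` -/
lemma Homog.weight (h : Homog G p k r) (hr : 2 ≤ r)
    (hn : p ^ k ≤ r ∨ (p ^ k = r + 1 ∧ 4 ≤ r)) {S : Set G} (hC : Cong S (r - 1)) :
    ∃ (w : G → ℚ) (κ : ℚ), (∀ g, 0 ≤ w g) ∧ 0 ≤ κ ∧ κ < r ∧
      ∀ A, Over S A → Atom A → 1 ≤ wt w A ∧ wt w A ≤ κ := by
  rcases hn with hn | ⟨hn, hr4⟩
  · have hL : LCN S := lcn_small hC (N := p ^ k) (by have := h.two_le; omega) (fun g _ => h.tors g)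
      (by omega)
    have h2 : (2:ℚ) ≤ p ^ k := by exact_mod_cast h.two_le
    have hr2 : (2:ℚ) ≤ r := by exact_mod_cast hr
    refine ⟨fun g => 1 / (addOrderOf g : ℚ), (r * (p ^ k - 1) + 1) / p ^ k, fun g => by positivity,
      div_nonneg (by nlinarith) (by linarith), ?_, ?_⟩
    · rw [div_lt_iff₀ (by linarith)]; nlinarith
    · intro A hO hA
      change 1 ≤ kq A ∧ kq A ≤ _
      refine ⟨hL A hO hA, ?_⟩
      rw [le_div_iff₀ (by linarith)]
      have := h.kq_le (by omega) hA
      linarith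
  · obtain ⟨d, rfl⟩ : ∃ d, r = d + 1 := ⟨r - 1, by omega⟩
    simp only [Nat.add_sub_cancel] at hC
    obtain ⟨w, κ, h1, h2, h3, h4⟩ := weight_top h hn (by omega) hC
    exact ⟨w, κ, h1, h2, by push_cast; exact h3, h4⟩

lemma Homog.kq_lt' (h : Homog G p k r) (hr : 2 ≤ r)
    (hn : p ^ k ≤ r ∨ (p ^ k = r + 1 ∧ 4 ≤ r))
    (hL : systemL (Set.univ : Set G) = systemL (Set.univ : Set G')) {N : ℕ} (hN : 0 < N)
    (hS : ∀ g : G', N • g = 0) {S : Set G'} (hC : Cong S (r - 1)) {A : Multiset G'}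
    (hO : Over S A) (hA : Atom A) : kq A < r := by
  obtain ⟨F, hF, hc⟩ := pow_fac N hN A fun g _ => hS g
  have f1 : Fac (N • {A}) (N • A) := (Fac.single hA).nsmul N
  have hfam := (family_of_cong hC (hO.nsmul N) f1 hF (x0 := N) (by simp) rfl).transfer hL.symm
  obtain ⟨T, hT, hw⟩ := extraction hfam
  obtain ⟨w, κ, h1, h2, h3, h4⟩ := h.weight hr hn hT
  have := hw w κ h1 h2 h4
  rw [hc] at this
  have hN' : (0:ℚ) < N := by exact_mod_cast hN
  have : kq A ≤ κ := by
    by_contra hc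
    push Not at hc
    nlinarith
  linarith

/-- the case of an exponent which is a prime power -/
lemma iso_of_pp {n : ℕ} (φ : G ≃+ (Fin r → ZMod n)) (hD : davenport G = davenport G')
    (hD4 : 4 ≤ davenport G) (hDn : davenport G = r * (n - 1) + 1) {q j : ℕ} (hq : q.Prime)
    (hI : ¬ Indep q (r + 1) G') (hS : ∀ g : G', q ^ j • g = 0) (hle : q ^ j ≤ n) :
    Nonempty (G ≃+ G') := by
  haveI : Fact q.Prime := ⟨hq⟩
  haveI := Fintype.ofFinite G'
  obtain ⟨E, -, hEc, ⟨c, hc, hcT⟩, -⟩ := PB0 hq (Finset.univ : Finset G') r hI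
  let y : Fin r → G' := fun i => if h : (i : ℕ) < E.card then (E.equivFin.symm ⟨i, h⟩ : G') else 0
  have hy : (E : Set G') ⊆ Set.range y := by
    intro x hx
    refine ⟨⟨E.equivFin ⟨x, hx⟩, (E.equivFin ⟨x, hx⟩).2.trans_le hEc⟩, ?_⟩
    simp [y]
  have hgen : AddSubgroup.closure (Set.range y) = ⊤ := by
    rw [eq_top_iff]
    intro t _
    have h1 := AddSubgroup.closure_mono hy (hcT t (Finset.mem_univ t))
    have hcop : IsCoprime (c : ℤ) ((q ^ j : ℕ) : ℤ) := Nat.isCoprime_iff_coprime.2 (hc.pow_right j)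
    obtain ⟨a, b, hab⟩ := hcop
    have : t = a • (c • t) := by
      have h2 : ((a * c + b * ((q ^ j : ℕ) : ℤ)) : ℤ) • t = t := by rw [hab, one_smul]
      rw [add_smul, mul_smul, mul_smul, natCast_zsmul, natCast_zsmul, hS, smul_zero, add_zero] at h2
      exact h2.symm
    rw [this]
    exact AddSubgroup.zsmul_mem _ h1 _
  have h1 := dav_le_of_gen q j y (fun i => hS _) hgen
  have hqn : q ^ j = n := by
    by_contra hne
    have h2 : q ^ j - 1 + 1 ≤ n - 1 := by
      have := pow_pos hq.pos j
      omega
    have h3 := Nat.mul_le_mul_left r h2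
    rw [mul_add] at h3
    have : r ≠ 0 := by rintro rfl; omega
    omega
  exact iso_of_gen φ hD y (fun i => by rw [← hqn]; exact hS _) hgen

theorem main_iso {n : ℕ} (φ : G ≃+ (Fin r → ZMod n)) (hD4 : 4 ≤ davenport G) (hrn : n - 1 ≤ r)
    (hpp : IsPrimePow n)
    (hL : systemL (Set.univ : Set G) = systemL (Set.univ : Set G')) : Nonempty (G ≃+ G') := by
  obtain ⟨p, k, hp, hk, hn⟩ := (isPrimePow_nat_iff n).1 hpp
  have h : Homog G p k r := homog_of_equiv hp hk hn.symm φ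
  have hn2 : 2 ≤ n := by rw [← hn]; exact h.two_le
  have hr : 2 ≤ r := by
    haveI : Fact p.Prime := ⟨hp⟩
    obtain ⟨e, he⟩ := h.gen
    have := dav_le_of_gen p k e (fun i => h.tors _) he
    rw [hn] at this
    by_contra hc
    have h1 : r ≤ 1 := by omega
    have : r * (n - 1) ≤ 1 * 1 := Nat.mul_le_mul h1 (by omega)
    omega
  have hDn : davenport G = r * (n - 1) + 1 := by rw [h.dav hr, hn]
  have hD := dav_eq (by omega) hL
  have hnr : p ^ k ≤ r + 1 := by omega
  have hNI : ∀ q, 2 ≤ q → ¬ Indep q (r + 1) G' := fun q hq => h.not_indep' hr hnr hL hq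
  have hord : ∀ g : G', addOrderOf g ≤ r + 1 := fun g => h.ord_le' hr hnr hL g
  obtain ⟨g0, hg0⟩ := AddMonoid.exists_addOrderOf_eq_exponent (G := G') AddMonoid.ExponentExists.of_finite
  obtain ⟨N, hN⟩ : ∃ N, N = AddMonoid.exponent G' := ⟨_, rfl⟩
  rw [← hN] at hg0
  have hS : ∀ g : G', N • g = 0 := fun g => by rw [hN]; exact AddMonoid.exponent_nsmul_eq_zero g
  have hN0 : 0 < N := by rw [← hg0]; exact ord_pos g0
  have hNr : N ≤ r + 1 := by rw [← hg0]; exact hord g0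
  by_cases hq : n = r + 1 ∧ ∃ q j : ℕ, q.Prime ∧ N = q ^ j
  · obtain ⟨hn1, q, j, hq, rfl⟩ := hq
    exact iso_of_pp φ hD hD4 hDn hq (hNI q hq.two_le) hS (by omega)
  have hcase : p ^ k ≤ r ∨ (p ^ k = r + 1 ∧ 4 ≤ r) := by
    rw [hn]
    by_cases hn1 : n = r + 1
    · right
      refine ⟨hn1, ?_⟩
      have hq' : ¬ ∃ q j : ℕ, q.Prime ∧ N = q ^ j := fun h => hq ⟨hn1, h⟩
      have hNn : N ≠ n := fun h => hq' ⟨p, k, hp, by rw [h, hn]⟩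
      by_contra hc
      have : N = 1 ∨ N = 2 ∨ N = 3 := by omega
      rcases this with h | h | h
      · exact hq' ⟨2, 0, Nat.prime_two, by simpa using h⟩
      · exact hq' ⟨2, 1, Nat.prime_two, by simpa using h⟩
      · exact hq' ⟨3, 1, Nat.prime_three, by simpa using h⟩
    · left; omega
  have hkq : ∀ {S : Set G'}, Cong S (r - 1) → ∀ A, Over S A → Atom A → kq A < r :=
    fun hC A hO hA => h.kq_lt' hr hcase hL hN0 hS hC hO hA
  have hind : Indep n r G := by rw [← hn]; exact h.ind
  obtain ⟨S, hC, hw⟩ := extraction ((fam_indep hn2 hr hind).transfer hL)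
  by_cases hLS : LCN S
  · exact iso_of_indep φ hD (lcn_case hn2 hr (by rw [← hD, hDn]) hord hC hLS (hkq hC) hw)
  exfalso
  have hNr1 : N = r + 1 := by
    by_contra hne
    exact hLS (lcn_small hC hN0 (fun g _ => hS g) (by omega))
  have hnr' : n ≤ r := by
    by_contra hc
    exact hq ⟨by omega, p, k, hp, by rw [hn]; omega⟩
  obtain ⟨d, rfl⟩ : ∃ d, r = d + 1 := ⟨r - 1, by omega⟩
  simp only [Nat.add_sub_cancel] at hC
  have hNN : ¬ Indep N (d + 1) G' := by
    intro hI
    have h1 := indep_dav (by omega) hr hI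
    rw [← hD, hDn] at h1
    have h2 : (d + 1) * (n - 1 + 1) ≤ (d + 1) * (N - 1) := Nat.mul_le_mul_left _ (by omega)
    rw [mul_add] at h2
    omega
  obtain ⟨-, w, hw0, hw1⟩ := nonlcn hC (by omega) (by omega) hS (fun q hq => hNI q hq.two_le) hNN
    (fun A hO hA => by
      have := hkq (S := S) (by simpa using hC) A hO hA
      push_cast at this; exact this) hLS
  have h1 := hw w (N / 2) hw0 (by positivity) hw1
  have hn2' : n = 2 := by
    by_contra hne
    obtain ⟨m, rfl⟩ : ∃ m, n = m + 3 := ⟨n - 3, by omega⟩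
    rw [hNr1, show m + 3 - 1 = m + 2 by omega] at h1
    push_cast at h1
    have hd1 : (1:ℚ) ≤ d := by exact_mod_cast (by omega : 1 ≤ d)
    have hm : (0:ℚ) ≤ m := by positivity
    nlinarith
  subst hn2'
  have hD' : davenport G' = d + 1 + 1 := by rw [← hD, hDn]; omega
  by_cases h4 : 4 ≤ d + 1
  · exact f1 h4 hind hL hD' (hg0.trans hNr1)
  · have h3 : d = 2 := by omega
    subst h3
    refine f2 (fun x => ?_) hind hL hD' (hg0.trans hNr1)
    have := h.tors x
    rw [hn, two_nsmul] at this
    exact this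

end final

end LSys

/-- If `G ≅ C_n^r` with `D(G) ≥ 4`, `r ≥ n − 1`, `n` a prime
power, and `𝓛(G) = 𝓛(G')` for a finite abelian group `G'`, then `G ≅ G'`. -/
theorem stmt1 {G G' : Type*} [AddCommGroup G] [Fintype G] [AddCommGroup G'] [Fintype G']
    (n r : ℕ) (hG : Nonempty (G ≃+ (Fin r → ZMod n)))
    (hD : 4 ≤ davenport G)
    (hrn : n - 1 ≤ r) (hpp : IsPrimePow n)
    (hL : systemL (Set.univ : Set G) = systemL (Set.univ : Set G')) :
    Nonempty (G ≃+ G') := by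
  obtain ⟨φ⟩ := hG
  exact LSys.main_iso φ hD hrn hpp hL
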